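/- Hölder regularity on ℝ^N: let u be a viscosity solution of 1_{f,ψ} on ℝ^N × (0,T) such that for some constants c₁, c₂ one has ψ(y) − c₁|x−y|^{γ_ψ} − c₂ t^{1/(q(α+1)−α)} ≤ u(x,t) ≤ ψ(y) + c₁|x−y|^{γ_ψ} + c₂ t^{1/(q(α+1)−α)} for all x, y, t, where q = q₁/γ_ψ and q₁ = max(2, (α+2)/(α+1)). Assume f is uniformly continuous and bounded, Hölder continuous with exponent γ_f with respect to t uniformly in x, and ψ is Hölder continuous with exponent γ_ψ on ℝ^N and bounded. Then u is Hölder continuous with exponent γ_ψ with respect to x and with exponent γ* = min(γ_f, 1/(q(α+1)−α)) with respect to t, on every compact subset of ℝ^N × (0,T). -/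

import Mathlib

open Set Filter Metric
open scoped RealInnerProductSpace

noncomputable section

/-- Euclidean space `ℝ^N`. -/
abbrev EucSp (N : ℕ) := EuclideanSpace ℝ (Fin N)

/-- `N × N` real matrices. -/
abbrev MatN (N : ℕ) := Matrix (Fin N) (Fin N) ℝ

variable {N : ℕ}

/-- Spatial Hessian matrix of a function `φ : ℝ^N → ℝ`. -/
noncomputable def hessMat (φ : EucSp N → ℝ) (x : EucSp N) : MatN N := fun i j =>
  iteratedFDeriv ℝ 2 φ x ![EuclideanSpace.single i (1 : ℝ), EuclideanSpace.single j (1 : ℝ)]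

/-- Upper semicontinuous envelope `u*`. -/
noncomputable def uscEnv (u : EucSp N → ℝ → ℝ) (x : EucSp N) (t : ℝ) : ℝ :=
  Filter.limsup (fun p : EucSp N × ℝ => u p.1 p.2) (nhds (x, t))

/-- Lower semicontinuous envelope `u_*`. -/
noncomputable def lscEnv (u : EucSp N → ℝ → ℝ) (x : EucSp N) (t : ℝ) : ℝ :=
  Filter.liminf (fun p : EucSp N × ℝ => u p.1 p.2) (nhds (x, t))

/-- The first order term `h(x,t)·p |p|^α`. -/
noncomputable def gradTerm (h : EucSp N → ℝ → EucSp N) (α : ℝ) (x : EucSp N) (t : ℝ)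
    (p : EucSp N) : ℝ :=
  ⟪h x t, p⟫ * ‖p‖ ^ α

/-- Viscosity subsolution of `u_t - F(x,∇u,D²u) - h(x,t)·∇u|∇u|^α ≤ f` in `Ω × (0,T)`,
in the sense of Definition 1 of the paper. -/
def IsSubSol (Ω : Set (EucSp N)) (T : ℝ) (F : EucSp N → EucSp N → MatN N → ℝ)
    (h : EucSp N → ℝ → EucSp N) (α : ℝ) (f : EucSp N → ℝ → ℝ)
    (u : EucSp N → ℝ → ℝ) : Prop :=
  ∀ x₀ ∈ Ω, ∀ t₀ ∈ Set.Ioo (0 : ℝ) T,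
    (∀ φ : EucSp N → ℝ → ℝ,
      ContDiff ℝ 2 (fun p : EucSp N × ℝ => φ p.1 p.2) →
      (∀ᶠ p : EucSp N × ℝ in nhds (x₀, t₀), uscEnv u p.1 p.2 ≤ φ p.1 p.2) →
      uscEnv u x₀ t₀ = φ x₀ t₀ →
      gradient (fun x => φ x t₀) x₀ ≠ 0 →
      deriv (fun s => φ x₀ s) t₀
          - F x₀ (gradient (fun x => φ x t₀) x₀) (hessMat (fun x => φ x t₀) x₀)
          - gradTerm h α x₀ t₀ (gradient (fun x => φ x t₀) x₀)
        ≤ f x₀ t₀) ∧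
    (∀ δ₁ > (0 : ℝ), ∀ φ : ℝ → ℝ, ContDiff ℝ 2 φ → φ t₀ = 0 →
      (∀ t ∈ Set.Ioo (t₀ - δ₁) (t₀ + δ₁), uscEnv u x₀ t - φ t ≤ uscEnv u x₀ t₀) →
      (∀ᶠ x in nhds x₀,
        sSup ((fun t => uscEnv u x t - φ t) '' Set.Ioo (t₀ - δ₁) (t₀ + δ₁)) =
          sSup ((fun t => uscEnv u x₀ t - φ t) '' Set.Ioo (t₀ - δ₁) (t₀ + δ₁))) →
      deriv φ t₀ ≤ f x₀ t₀)

/-- Viscosity supersolution of `u_t - F(x,∇u,D²u) - h(x,t)·∇u|∇u|^α ≥ f` in `Ω × (0,T)`,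
in the sense of Definition 1 of the paper. -/
def IsSuperSol (Ω : Set (EucSp N)) (T : ℝ) (F : EucSp N → EucSp N → MatN N → ℝ)
    (h : EucSp N → ℝ → EucSp N) (α : ℝ) (f : EucSp N → ℝ → ℝ)
    (u : EucSp N → ℝ → ℝ) : Prop :=
  ∀ x₀ ∈ Ω, ∀ t₀ ∈ Set.Ioo (0 : ℝ) T,
    (∀ φ : EucSp N → ℝ → ℝ,
      ContDiff ℝ 2 (fun p : EucSp N × ℝ => φ p.1 p.2) →
      (∀ᶠ p : EucSp N × ℝ in nhds (x₀, t₀), φ p.1 p.2 ≤ lscEnv u p.1 p.2) →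
      lscEnv u x₀ t₀ = φ x₀ t₀ →
      gradient (fun x => φ x t₀) x₀ ≠ 0 →
      f x₀ t₀ ≤
        deriv (fun s => φ x₀ s) t₀
          - F x₀ (gradient (fun x => φ x t₀) x₀) (hessMat (fun x => φ x t₀) x₀)
          - gradTerm h α x₀ t₀ (gradient (fun x => φ x t₀) x₀)) ∧
    (∀ δ₁ > (0 : ℝ), ∀ φ : ℝ → ℝ, ContDiff ℝ 2 φ → φ t₀ = 0 →
      (∀ t ∈ Set.Ioo (t₀ - δ₁) (t₀ + δ₁), lscEnv u x₀ t₀ ≤ lscEnv u x₀ t - φ t) →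
      (∀ᶠ x in nhds x₀,
        sInf ((fun t => lscEnv u x t - φ t) '' Set.Ioo (t₀ - δ₁) (t₀ + δ₁)) =
          sInf ((fun t => lscEnv u x₀ t - φ t) '' Set.Ioo (t₀ - δ₁) (t₀ + δ₁))) →
      f x₀ t₀ ≤ deriv φ t₀)

/-- Continuity of `F` on `Ω × (ℝ^N∖{0}) × S`. -/
def Fcont (Ω : Set (EucSp N)) (F : EucSp N → EucSp N → MatN N → ℝ) : Prop :=
  ContinuousOn (fun z : EucSp N × EucSp N × MatN N => F z.1 z.2.1 z.2.2)
    (Ω ×ˢ ({p : EucSp N | p ≠ 0} ×ˢ (Set.univ : Set (MatN N))))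

/-- Hypothesis (H1): homogeneity. -/
def H1 (Ω : Set (EucSp N)) (F : EucSp N → EucSp N → MatN N → ℝ) (α : ℝ) : Prop :=
  ∀ x ∈ Ω, ∀ p : EucSp N, p ≠ 0 → ∀ X : MatN N, X.IsSymm →
    ∀ t : ℝ, t ≠ 0 → ∀ μ : ℝ, 0 ≤ μ →
      F x (t • p) (μ • X) = |t| ^ α * μ * F x p X

/-- Hypothesis (H2): uniform ellipticity. -/
def H2 (Ω : Set (EucSp N)) (F : EucSp N → EucSp N → MatN N → ℝ) (α a A : ℝ) : Prop :=
  0 < a ∧ a ≤ A ∧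
    ∀ x ∈ Ω, ∀ p : EucSp N, p ≠ 0 → ∀ M P : MatN N, M.IsSymm → P.IsSymm → P.PosSemidef →
      a * ‖p‖ ^ α * P.trace ≤ F x p (M + P) - F x p M ∧
        F x p (M + P) - F x p M ≤ A * ‖p‖ ^ α * P.trace

/-- Hypothesis (H3): continuity estimate for doubled variables. -/
def H3 (Ω : Set (EucSp N)) (F : EucSp N → EucSp N → MatN N → ℝ) : Prop :=
  ∃ ω : ℝ → ℝ, Continuous ω ∧ ω 0 = 0 ∧
    ∀ X Y : MatN N, X.IsSymm → Y.IsSymm → ∀ ζ : ℝ, 0 < ζ →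
      (Matrix.fromBlocks X 0 0 Y +
        ζ • (1 : Matrix (Fin N ⊕ Fin N) (Fin N ⊕ Fin N) ℝ)).PosSemidef →
      ((4 * ζ) • Matrix.fromBlocks (1 : MatN N) (-1) (-1) (1 : MatN N) -
        Matrix.fromBlocks X 0 0 Y).PosSemidef →
      ∀ x ∈ Ω, ∀ y ∈ Ω, x ≠ y →
        F x (ζ • (x - y)) X - F y (ζ • (x - y)) (-Y) ≤ ω (ζ * ‖x - y‖ ^ 2)

/-- Frobenius norm of a matrix. -/
noncomputable def frobNorm (X : MatN N) : ℝ := Real.sqrt (∑ i, ∑ j, (X i j) ^ 2)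

/-- Hypothesis (H4): Hölder-type continuity of `F` in `x`. -/
def H4 (Ω : Set (EucSp N)) (F : EucSp N → EucSp N → MatN N → ℝ) (α : ℝ) : Prop :=
  ∃ ω' : ℝ → ℝ, Continuous ω' ∧ ω' 0 = 0 ∧
    ∀ x ∈ Ω, ∀ y ∈ Ω, ∀ p : EucSp N, p ≠ 0 → ∀ X : MatN N, X.IsSymm →
      |F x p X - F y p X| ≤ ω' ‖x - y‖ * ‖p‖ ^ α * frobNorm X

/-- Hypothesis (H5): regularity of `h`. -/
def H5 (Ω : Set (EucSp N)) (T : ℝ) (h : EucSp N → ℝ → EucSp N) (α : ℝ) : Prop :=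
  ∃ ωh : ℝ, 0 < ωh ∧ ωh ≤ 1 ∧ ∃ ch : ℝ, 0 < ch ∧
    (∀ x ∈ Ω, ∀ t ∈ Set.Ioo (0 : ℝ) T, ∀ s ∈ Set.Ioo (0 : ℝ) T,
      ‖h x t - h x s‖ ≤ ch * |t - s| ^ ωh) ∧
    (α ≤ 0 → ∀ x ∈ Ω, ∀ y ∈ Ω, ∀ t ∈ Set.Ioo (0 : ℝ) T,
      ‖h x t - h y t‖ ≤ ch * ‖x - y‖ ^ (1 + α)) ∧
    (0 < α → ∀ x ∈ Ω, ∀ y ∈ Ω, ∀ t ∈ Set.Ioo (0 : ℝ) T,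
      ⟪h x t - h y t, x - y⟫ ≤ 0)

/-- Hypothesis (H6): uniform Lipschitz-type condition on `F` in the gradient variable. -/
def H6 (F : EucSp N → EucSp N → MatN N → ℝ) (α : ℝ) : Prop :=
  ∃ C : ℝ, 0 < C ∧ ∀ x : EucSp N, ∀ p : EucSp N, p ≠ 0 → ∀ q : EucSp N, ‖q‖ < ‖p‖ / 2 →
    ∀ X : MatN N, X.IsSymm →
      |F x (p + q) X - F x p X| ≤ C * ‖p‖ ^ (α - 1) * ‖q‖ * frobNorm X

/-- `h` is continuous and bounded on `Ω × (0,T)`. -/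
def HContBdd (Ω : Set (EucSp N)) (T : ℝ) (h : EucSp N → ℝ → EucSp N) : Prop :=
  ContinuousOn (fun p : EucSp N × ℝ => h p.1 p.2) (Ω ×ˢ Set.Ioo 0 T) ∧
    ∃ C : ℝ, ∀ x ∈ Ω, ∀ t ∈ Set.Ioo (0 : ℝ) T, ‖h x t‖ ≤ C

/-- Uniform exterior cone condition. -/
def UnifExtCone (Ω : Set (EucSp N)) : Prop :=
  ∃ φ₀ ∈ Set.Ioo (0 : ℝ) Real.pi, ∃ r : ℝ, 0 < r ∧
    ∀ z ∈ frontier Ω, ∃ n : EucSp N, ‖n‖ = 1 ∧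
      {x : EucSp N | ⟪x - z, n⟫ ≤ Real.cos φ₀ * ‖x - z‖} ∩ closure Ω ∩
        Metric.ball z r = {z}

/-- `u = ψ` on the parabolic boundary `(∂Ω × (0,T)) ∪ (Ω × {0})`. -/
def BoundaryEq (Ω : Set (EucSp N)) (T : ℝ) (u ψ : EucSp N → ℝ → ℝ) : Prop :=
  (∀ x ∈ frontier Ω, ∀ t ∈ Set.Ioo (0 : ℝ) T, u x t = ψ x t) ∧
    (∀ x ∈ Ω, u x 0 = ψ x 0)

/-- The global barrier family of Proposition 1 of the paper, with Hölder
exponent `γ` and constants `c₁ ≤ W_z(x)/|x-z|^γ ≤ c₂`. -/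
def IsBarrierFamily (Ω : Set (EucSp N)) (T : ℝ) (F : EucSp N → EucSp N → MatN N → ℝ)
    (h : EucSp N → ℝ → EucSp N) (α γ c₁ c₂ : ℝ) : Prop :=
  γ ∈ Set.Ioo (0 : ℝ) 1 ∧ 0 < c₁ ∧ 0 < c₂ ∧
    ∀ z ∈ frontier Ω, ∃ W : EucSp N → ℝ,
      ContinuousOn W (closure Ω) ∧ W z = 0 ∧
      (∀ x ∈ Ω, x ≠ z → 0 < W x) ∧
      (∀ x ∈ Ω, gradient W x ≠ 0) ∧
      (∀ x ∈ Ω, c₁ * ‖x - z‖ ^ γ ≤ W x ∧ W x ≤ c₂ * ‖x - z‖ ^ γ) ∧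
      (∀ x₀ ∈ Ω, ∀ φ : EucSp N → ℝ, ContDiff ℝ 2 φ →
        (∀ᶠ x in nhds x₀, φ x ≤ W x) → φ x₀ = W x₀ → gradient φ x₀ ≠ 0 →
        ∀ t ∈ Set.Ioo (0 : ℝ) T,
          F x₀ (gradient φ x₀) (hessMat φ x₀) + gradTerm h α x₀ t (gradient φ x₀) ≤ -1)

/-- `ψ` is `γ`-Hölder in `x` (with constant `cψ`) and Lipschitz in `t`
(with constant `Lψ`). -/
def PsiHolderLip (Ω : Set (EucSp N)) (T γ cψ Lψ : ℝ) (ψ : EucSp N → ℝ → ℝ) : Prop :=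
  (∀ x ∈ closure Ω, ∀ y ∈ closure Ω, ∀ t ∈ Set.Icc (0 : ℝ) T,
      |ψ x t - ψ y t| ≤ cψ * ‖x - y‖ ^ γ) ∧
    (∀ x ∈ closure Ω, ∀ t ∈ Set.Icc (0 : ℝ) T, ∀ s ∈ Set.Icc (0 : ℝ) T,
      |ψ x t - ψ x s| ≤ Lψ * |t - s|)

/-- A continuous viscosity solution of the problem `1_{f,ψ}` on a bounded domain. -/
def IsSolution (Ω : Set (EucSp N)) (T : ℝ) (F : EucSp N → EucSp N → MatN N → ℝ)
    (h : EucSp N → ℝ → EucSp N) (α : ℝ) (f : EucSp N → ℝ → ℝ)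
    (ψ : EucSp N → ℝ → ℝ) (u : EucSp N → ℝ → ℝ) : Prop :=
  ContinuousOn (fun p : EucSp N × ℝ => u p.1 p.2) (closure Ω ×ˢ Set.Icc 0 T) ∧
    IsSubSol Ω T F h α f u ∧ IsSuperSol Ω T F h α f u ∧ BoundaryEq Ω T u ψ

/-- A continuous viscosity solution of `1_{f,ψ}` on `ℝ^N × (0,T)` with initial datum `ψ`. -/
def IsSolutionRN {N : ℕ} (T : ℝ) (F : EucSp N → EucSp N → MatN N → ℝ)
    (h : EucSp N → ℝ → EucSp N) (α : ℝ) (f : EucSp N → ℝ → ℝ)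
    (ψ : EucSp N → ℝ) (u : EucSp N → ℝ → ℝ) : Prop :=
  ContinuousOn (fun p : EucSp N × ℝ => u p.1 p.2)
      ((Set.univ : Set (EucSp N)) ×ˢ Set.Ico 0 T) ∧
    IsSubSol (Set.univ : Set (EucSp N)) T F h α f u ∧
    IsSuperSol (Set.univ : Set (EucSp N)) T F h α f u ∧
    ∀ x : EucSp N, u x 0 = ψ x

section SecondOrder

variable {E : Type*} [NormedAddCommGroup E] [InnerProductSpace ℝ E]

lemma eq_zero_of_inner_le_sq (v : E) (K : ℝ) (h : ∀ z : E, ⟪v, z⟫ ≤ K * ‖z‖ ^ 2) : v = 0 := by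
  by_contra hv
  have hp : 0 < ‖v‖ ^ 2 := by positivity
  have hs : ∀ s : ℝ, 0 < s → 1 ≤ K * s := by
    intro s hs
    have := h (s • v)
    rw [inner_smul_right, real_inner_self_eq_norm_sq, norm_smul, Real.norm_of_nonneg hs.le] at this
    have h2 : (s * ‖v‖ ^ 2) * 1 ≤ (s * ‖v‖ ^ 2) * (K * s) := by nlinarith
    exact le_of_mul_le_mul_left h2 (by positivity)
  have h1 := hs (1 / (2 * (|K| + 1))) (by positivity)
  rw [mul_one_div, le_div_iff₀ (by positivity)] at h1
  nlinarith [le_abs_self K, abs_nonneg K]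

lemma sq_norm_add_sub (x h : E) : ‖x + h‖ ^ 2 + ‖x - h‖ ^ 2 = 2 * ‖x‖ ^ 2 + 2 * ‖h‖ ^ 2 := by
  have := parallelogram_law_with_norm ℝ x h
  nlinarith

/-- A function with upper paraboloids everywhere and a midpoint semiconvexity bound is `C^{1,1}`. -/
lemma exists_lipschitz_gradient {f : E → ℝ} {μ l : ℝ} (hμ : 0 ≤ μ) (hl : 0 ≤ l)
    (hup : ∀ x, ∃ p : E, ∀ h, f (x + h) ≤ f x + ⟪p, h⟫ + μ / 2 * ‖h‖ ^ 2)
    (hmid : ∀ x h, 2 * f x - l * ‖h‖ ^ 2 ≤ f (x + h) + f (x - h)) :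
    ∃ (g : E → E) (K : NNReal), LipschitzWith K g ∧
      ∀ x h, |f (x + h) - f x - ⟪g x, h⟫| ≤ K * ‖h‖ ^ 2 := by
  choose g hg using hup
  set K : ℝ := μ + l with hK
  have hK0 : 0 ≤ K := by positivity
  have hex : ∀ x h, |f (x + h) - f x - ⟪g x, h⟫| ≤ K * ‖h‖ ^ 2 := by
    intro x h
    rw [abs_le]
    have h1 := hg x h
    have h2 := hg x (-h)
    have h3 := hmid x h
    rw [inner_neg_right, norm_neg, ← sub_eq_add_neg] at h2
    have : 0 ≤ ‖h‖ ^ 2 := by positivity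
    constructor <;> nlinarith
  refine ⟨g, ⟨6 * K, by positivity⟩, ?_, ?_⟩
  · refine LipschitzWith.of_dist_le_mul fun x y => ?_
    rw [dist_eq_norm, dist_eq_norm]
    show _ ≤ 6 * K * _
    have key : ∀ h : E, ⟪g x - g y, h⟫ ≤ K * (‖h‖ ^ 2 + ‖x - y + h‖ ^ 2 + ‖x - y‖ ^ 2) := by
      intro h
      have h1 := (abs_le.1 (hex x h)).1
      have h2 := (abs_le.1 (hex y (x - y + h))).2
      have h3 := (abs_le.1 (hex y (x - y))).1
      have e1 : y + (x - y + h) = x + h := by abel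
      have e2 : y + (x - y) = x := by abel
      rw [e1, inner_add_right] at h2
      rw [e2] at h3
      rw [inner_sub_left]
      linarith
    rcases eq_or_ne (g x - g y) 0 with h0 | h0
    · rw [h0, norm_zero]; positivity
    · have hn : 0 < ‖g x - g y‖ := norm_pos_iff.2 h0
      set d := ‖x - y‖ with hd
      have k := key ((d / ‖g x - g y‖) • (g x - g y))
      have hnn : ‖(d / ‖g x - g y‖) • (g x - g y)‖ = d := by
        rw [norm_smul, Real.norm_of_nonneg (by positivity)]; field_simp
      have h4 := norm_add_le (x - y) ((d / ‖g x - g y‖) • (g x - g y))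
      rw [hnn] at k h4
      rw [inner_smul_right, real_inner_self_eq_norm_sq] at k
      have e : d / ‖g x - g y‖ * ‖g x - g y‖ ^ 2 = d * ‖g x - g y‖ := by field_simp
      rw [e] at k
      have h5 : ‖x - y + (d / ‖g x - g y‖) • (g x - g y)‖ ^ 2 ≤ (2 * d) ^ 2 := by
        gcongr; linarith
      have h6 : d * ‖g x - g y‖ ≤ d * (6 * K * d) := by
        refine k.trans ?_
        have : K * (d ^ 2 + ‖x - y + (d / ‖g x - g y‖) • (g x - g y)‖ ^ 2 + d ^ 2)
          ≤ K * (d ^ 2 + (2 * d) ^ 2 + d ^ 2) := by gcongr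
        refine this.trans (le_of_eq ?_); ring
      rcases eq_or_lt_of_le (norm_nonneg (x - y)) with h7 | h7
      · have : x = y := by rw [← sub_eq_zero, ← norm_eq_zero, ← h7]
        exact absurd (by rw [this, sub_self]) h0
      · exact le_of_mul_le_mul_left h6 h7
  · intro x h
    refine (hex x h).trans ?_
    show K * _ ≤ 6 * K * _
    have : 0 ≤ ‖h‖ ^ 2 := by positivity
    nlinarith [mul_nonneg hK0 this]

lemma hasDerivAt_along {f : E → ℝ} {g : E → E} {K : ℝ}
    (hex : ∀ x h, |f (x + h) - f x - ⟪g x, h⟫| ≤ K * ‖h‖ ^ 2) (x h : E) (s : ℝ) :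
    HasDerivAt (fun s : ℝ => f (x + s • h)) ⟪g (x + s • h), h⟫ s := by
  rw [hasDerivAt_iff_isLittleO]
  have : (fun t : ℝ => f (x + t • h) - f (x + s • h) - (t - s) • ⟪g (x + s • h), h⟫)
      =O[nhds s] fun t => (t - s) ^ 2 := by
    refine Asymptotics.IsBigO.of_bound (K * ‖h‖ ^ 2) (Eventually.of_forall fun t => ?_)
    have := hex (x + s • h) ((t - s) • h)
    have e : x + s • h + (t - s) • h = x + t • h := by module
    rw [e, inner_smul_right, norm_smul, mul_pow, Real.norm_eq_abs, sq_abs] at this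
    rw [Real.norm_eq_abs, Real.norm_eq_abs, abs_of_nonneg (sq_nonneg (t - s)), smul_eq_mul]
    linarith
  refine this.trans_isLittleO ?_
  have h2 : Tendsto (fun t : ℝ => t - s) (nhds s) (nhds 0) :=
    tendsto_sub_nhds_zero_iff.2 tendsto_id
  have := (Asymptotics.isLittleO_pow_id (𝕜 := ℝ) (n := 2) (by norm_num)).comp_tendsto h2
  simpa [Function.comp_def] using this

/-- Second order expansion at a point where the Lipschitz gradient is differentiable. -/
lemma second_order_expansion {f : E → ℝ} {g : E → E} {K : ℝ}
    (hex : ∀ x h, |f (x + h) - f x - ⟪g x, h⟫| ≤ K * ‖h‖ ^ 2)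
    {x : E} {X : E →L[ℝ] E} (hX : HasFDerivAt g X x) {ε : ℝ} (hε : 0 < ε) :
    ∀ᶠ h in nhds (0 : E),
      |f (x + h) - f x - ⟪g x, h⟫ - 1 / 2 * ⟪X h, h⟫| ≤ ε * ‖h‖ ^ 2 := by
  have h1 := hasFDerivAt_iff_isLittleO_nhds_zero.1 hX
  have h2 := h1.def hε
  obtain ⟨r, hr, h3⟩ := Metric.eventually_nhds_iff_ball.1 h2
  refine Metric.eventually_nhds_iff_ball.2 ⟨r, hr, fun h hh => ?_⟩
  have hd : ∀ s ∈ Icc (0 : ℝ) 1, HasDerivWithinAt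
      (fun s : ℝ => f (x + s • h) - s * ⟪g x, h⟫ - s ^ 2 * (1 / 2 * ⟪X h, h⟫))
      (⟪g (x + s • h), h⟫ - ⟪g x, h⟫ - s * ⟪X h, h⟫) (Icc 0 1) s := by
    intro s _
    have a := ((hasDerivAt_along hex x h s).sub ((hasDerivAt_id s).mul_const ⟪g x, h⟫)).sub
      ((hasDerivAt_pow 2 s).mul_const (1 / 2 * ⟪X h, h⟫))
    refine (a.congr_deriv ?_).hasDerivWithinAt
    simp only [Nat.cast_ofNat]
    ring
  have := norm_image_sub_le_of_norm_deriv_le_segment_01' (C := ε * ‖h‖ ^ 2) hd ?_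
  · simp only [one_smul, zero_smul, add_zero, Real.norm_eq_abs] at this
    convert this using 2
    ring
  · intro s hs
    have hmem : s • h ∈ ball (0 : E) r := by
      rw [mem_ball_zero_iff, norm_smul, Real.norm_of_nonneg hs.1]
      rw [mem_ball_zero_iff] at hh
      nlinarith [norm_nonneg h, hs.2]
    have h4 := h3 _ hmem
    have e : ⟪g (x + s • h), h⟫ - ⟪g x, h⟫ - s * ⟪X h, h⟫
        = ⟪g (x + s • h) - g x - X (s • h), h⟫ := by
      rw [inner_sub_left, inner_sub_left, map_smul, inner_smul_left]; simp
    rw [e]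
    refine (norm_inner_le_norm _ _).trans ?_
    rw [norm_smul, Real.norm_of_nonneg hs.1] at h4
    calc _ ≤ ε * (s * ‖h‖) * ‖h‖ := by gcongr
      _ ≤ ε * (1 * ‖h‖) * ‖h‖ := by gcongr; exact hs.2.le
      _ = _ := by ring

end SecondOrder

section Jensen

variable {E : Type*} [NormedAddCommGroup E] [InnerProductSpace ℝ E]

lemma eventually_smul_nhds_zero {P : E → Prop} (h : ∀ᶠ z in nhds (0 : E), P z) (v : E) :
    ∀ᶠ s in nhds (0 : ℝ), P (s • v) := by
  have : Tendsto (fun s : ℝ => s • v) (nhds 0) (nhds 0) := by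
    have := (by fun_prop : Continuous fun s : ℝ => s • v).tendsto 0
    simpa using this
  exact this.eventually h

lemma symmetric_second_difference {f : E → ℝ} {g : E → E} {K : ℝ}
    (hex : ∀ x h, |f (x + h) - f x - ⟪g x, h⟫| ≤ K * ‖h‖ ^ 2)
    {x : E} {X : E →L[ℝ] E} (hX : HasFDerivAt g X x) (h : E) {ε : ℝ} (hε : 0 < ε) :
    ∀ᶠ s in nhds (0 : ℝ),
      |f (x + s • h) + f (x - s • h) - 2 * f x - s ^ 2 * ⟪X h, h⟫| ≤ ε * s ^ 2 := by
  have h1 := second_order_expansion hex hX (ε := ε / (2 * (‖h‖ ^ 2 + 1))) (by positivity)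
  filter_upwards [eventually_smul_nhds_zero h1 h, eventually_smul_nhds_zero h1 (-h)] with s a b
  rw [smul_neg, ← sub_eq_add_neg] at b
  simp only [inner_neg_right, map_neg, inner_neg_left, norm_neg, inner_smul_right,
    map_smul, inner_smul_left, norm_smul, mul_pow, Real.norm_eq_abs, sq_abs, RCLike.conj_to_real]
    at a b
  have hb : ε / (2 * (‖h‖ ^ 2 + 1)) * (s ^ 2 * ‖h‖ ^ 2) ≤ ε / 2 * s ^ 2 := by
    rw [div_mul_eq_mul_div, div_le_iff₀ (by positivity)]
    nlinarith [mul_nonneg hε.le (sq_nonneg s)]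
  rw [abs_le] at a b ⊢
  constructor <;> nlinarith

lemma exists_small_ne_zero {P : ℝ → Prop} (h : ∀ᶠ s in nhds (0 : ℝ), P s) : ∃ s, 0 < s ∧ P s := by
  have h' : ∀ᶠ s in nhdsWithin (0 : ℝ) (Ioi 0), P s := h.filter_mono nhdsWithin_le_nhds
  obtain ⟨s, hs, hp⟩ := (eventually_mem_nhdsWithin.and h').exists
  exact ⟨s, hs, hp⟩

lemma neg_le_inner_of_semiconvex {f : E → ℝ} {g : E → E} {K l : ℝ}
    (hex : ∀ x h, |f (x + h) - f x - ⟪g x, h⟫| ≤ K * ‖h‖ ^ 2)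
    (hmid : ∀ x h, 2 * f x - l * ‖h‖ ^ 2 ≤ f (x + h) + f (x - h))
    {x : E} {X : E →L[ℝ] E} (hX : HasFDerivAt g X x) (h : E) :
    -(l * ‖h‖ ^ 2) ≤ ⟪X h, h⟫ := by
  refine le_of_forall_pos_le_add fun ε hε => ?_
  obtain ⟨s, hs, h1⟩ := exists_small_ne_zero (symmetric_second_difference hex hX h hε)
  have h2 := hmid x (s • h)
  rw [norm_smul, Real.norm_of_nonneg hs.le, mul_pow] at h2
  have h3 := (abs_le.1 h1).2
  have : s ^ 2 * (-(l * ‖h‖ ^ 2)) ≤ s ^ 2 * (⟪X h, h⟫ + ε) := by nlinarith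
  exact le_of_mul_le_mul_left this (by positivity)

lemma inner_add_le_of_max {f₁ f₂ : E → ℝ} {g₁ g₂ : E → E} {K₁ K₂ η : ℝ} {S : E →L[ℝ] E}
    (hex₁ : ∀ x h, |f₁ (x + h) - f₁ x - ⟪g₁ x, h⟫| ≤ K₁ * ‖h‖ ^ 2)
    (hex₂ : ∀ x h, |f₂ (x + h) - f₂ x - ⟪g₂ x, h⟫| ≤ K₂ * ‖h‖ ^ 2)
    {x y : E} {X Y : E →L[ℝ] E} (hX : HasFDerivAt g₁ X x) (hY : HasFDerivAt g₂ Y y) (p q : E)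
    (hmax : ∀ z w, f₁ z + f₂ w - (1 / 2 * ⟪S (z - w), z - w⟫ + η / 2 * (‖z‖ ^ 2 + ‖w‖ ^ 2))
        - ⟪p, z⟫ - ⟪q, w⟫ ≤
      f₁ x + f₂ y - (1 / 2 * ⟪S (x - y), x - y⟫ + η / 2 * (‖x‖ ^ 2 + ‖y‖ ^ 2))
        - ⟪p, x⟫ - ⟪q, y⟫) (h k : E) :
    ⟪X h, h⟫ + ⟪Y k, k⟫ ≤ ⟪S (h - k), h - k⟫ + η * (‖h‖ ^ 2 + ‖k‖ ^ 2) := by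
  refine le_of_forall_pos_le_add fun ε hε => ?_
  obtain ⟨s, hs, h1, h2⟩ := exists_small_ne_zero
    ((symmetric_second_difference hex₁ hX h (half_pos hε)).and
      (symmetric_second_difference hex₂ hY k (half_pos hε)))
  have m1 := hmax (x + s • h) (y + s • k)
  have m2 := hmax (x - s • h) (y - s • k)
  have e1 : x + s • h - (y + s • k) = (x - y) + s • (h - k) := by module
  have e2 : x - s • h - (y - s • k) = (x - y) - s • (h - k) := by module
  rw [e1] at m1
  rw [e2] at m2
  have n1 := sq_norm_add_sub x (s • h)
  have n2 := sq_norm_add_sub y (s • k)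
  simp only [norm_smul, Real.norm_of_nonneg hs.le, mul_pow] at n1 n2
  simp only [map_add, map_sub, inner_add_left, inner_add_right, inner_sub_left, inner_sub_right,
    map_smul, inner_smul_left, inner_smul_right, RCLike.conj_to_real] at m1 m2 ⊢
  have h3 := (abs_le.1 h1).1
  have h4 := (abs_le.1 h2).1
  have n3 : η / 2 * (‖x + s • h‖ ^ 2 + ‖y + s • k‖ ^ 2)
      + η / 2 * (‖x - s • h‖ ^ 2 + ‖y - s • k‖ ^ 2)
      = η / 2 * (2 * ‖x‖ ^ 2 + 2 * (s ^ 2 * ‖h‖ ^ 2) + (2 * ‖y‖ ^ 2 + 2 * (s ^ 2 * ‖k‖ ^ 2))) := by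
    linear_combination (η / 2) * (n1 + n2)
  have : s ^ 2 * (⟪X h, h⟫ + ⟪Y k, k⟫) ≤ s ^ 2 * ((⟪S h, h⟫ - ⟪S k, h⟫ - (⟪S h, k⟫ - ⟪S k, k⟫)
      + η * (‖h‖ ^ 2 + ‖k‖ ^ 2) + ε)) := by nlinarith
  have := le_of_mul_le_mul_left this (by positivity)
  linarith

lemma gradient_eq_of_max_left {f : E → ℝ} {g : E → E} {K η : ℝ} {S : E →L[ℝ] E}
    (hS : ∀ a b, ⟪S a, b⟫ = ⟪a, S b⟫)
    (hex : ∀ x h, |f (x + h) - f x - ⟪g x, h⟫| ≤ K * ‖h‖ ^ 2) (x y p : E)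
    (hmax : ∀ z, f z - (1 / 2 * ⟪S (z - y), z - y⟫ + η / 2 * ‖z‖ ^ 2) - ⟪p, z⟫ ≤
      f x - (1 / 2 * ⟪S (x - y), x - y⟫ + η / 2 * ‖x‖ ^ 2) - ⟪p, x⟫) :
    g x = S (x - y) + η • x + p := by
  rw [← sub_eq_zero]
  refine eq_zero_of_inner_le_sq _ (K + ‖S‖ + |η|) fun h => ?_
  have m := hmax (x + h)
  have e : x + h - y = (x - y) + h := by abel
  rw [e, map_add, inner_add_left, inner_add_right, inner_add_right, norm_add_sq_real] at m
  have h1 := (abs_le.1 (hex x h)).1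
  have h2 : ⟪S h, x - y⟫ = ⟪S (x - y), h⟫ := by rw [hS, real_inner_comm]
  rw [inner_sub_left, inner_add_left, inner_add_left, inner_smul_left, RCLike.conj_to_real]
  rw [inner_add_right] at m
  have h3 : ⟪S h, h⟫ ≤ ‖S‖ * ‖h‖ ^ 2 := by
    refine (real_inner_le_norm _ _).trans ?_
    calc _ ≤ ‖S‖ * ‖h‖ * ‖h‖ := by gcongr; exact S.le_opNorm h
      _ = _ := by ring
  have h4 : η * ‖h‖ ^ 2 ≤ |η| * ‖h‖ ^ 2 := by gcongr; exact le_abs_self η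
  have h5 : 0 ≤ ‖S‖ * ‖h‖ ^ 2 := by positivity
  have h6 : 0 ≤ |η| * ‖h‖ ^ 2 := by positivity
  nlinarith

variable [FiniteDimensional ℝ E]

open MeasureTheory in
/-- A Lipschitz map cannot send a null set onto a ball. -/
lemma exists_mem_ball_of_lipschitz_of_ae {V : Type*} [NormedAddCommGroup V] [NormedSpace ℝ V]
    [FiniteDimensional ℝ V] [MeasurableSpace V] [BorelSpace V] {Ψ : V → V} {K : NNReal}
    (hΨ : LipschitzWith K Ψ) {B : Set V} (hB : μH[Module.finrank ℝ V] B = 0) {ρ : ℝ} (hρ : 0 < ρ) :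
    ∃ p ∈ ball (0 : V) ρ, p ∉ Ψ '' B := by
  by_contra! hcon
  have h1 : μH[Module.finrank ℝ V] (ball (0 : V) ρ) ≤ 0 := by
    refine (measure_mono hcon).trans ?_
    have := hΨ.hausdorffMeasure_image_le (d := Module.finrank ℝ V) (by positivity) B
    rwa [hB, mul_zero] at this
  exact (measure_ball_pos _ (0 : V) hρ).not_ge h1

/-- Jensen's lemma for a sum of two `C^{1,1}` functions touched from above by a quadratic form:
slightly tilted maxima occur at points where both gradients are differentiable. -/
lemma exists_tilted_max {f₁ f₂ : E → ℝ} {g₁ g₂ : E → E} {K₁ K₂ : NNReal} {η : ℝ} (hη : 0 < η)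
    {S : E →L[ℝ] E} (hS : ∀ a b, ⟪S a, b⟫ = ⟪a, S b⟫)
    (hg₁ : LipschitzWith K₁ g₁) (hg₂ : LipschitzWith K₂ g₂)
    (hex₁ : ∀ x h, |f₁ (x + h) - f₁ x - ⟪g₁ x, h⟫| ≤ K₁ * ‖h‖ ^ 2)
    (hex₂ : ∀ x h, |f₂ (x + h) - f₂ x - ⟪g₂ x, h⟫| ≤ K₂ * ‖h‖ ^ 2)
    (hle : ∀ z w, f₁ z + f₂ w ≤ 1 / 2 * ⟪S (z - w), z - w⟫) (h0 : 0 ≤ f₁ 0 + f₂ 0)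
    {ρ : ℝ} (hρ : 0 < ρ) :
    ∃ x y p q : E, ‖x‖ ≤ ρ ∧ ‖y‖ ≤ ρ ∧ ‖p‖ ≤ ρ ∧ ‖q‖ ≤ ρ ∧
      DifferentiableAt ℝ g₁ x ∧ DifferentiableAt ℝ g₂ y ∧
      ∀ z w, f₁ z + f₂ w - (1 / 2 * ⟪S (z - w), z - w⟫ + η / 2 * (‖z‖ ^ 2 + ‖w‖ ^ 2))
        - ⟪p, z⟫ - ⟪q, w⟫ ≤
      f₁ x + f₂ y - (1 / 2 * ⟪S (x - y), x - y⟫ + η / 2 * (‖x‖ ^ 2 + ‖y‖ ^ 2))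
        - ⟪p, x⟫ - ⟪q, y⟫ := by
  let _ : MeasurableSpace E := borel E
  have _ : BorelSpace E := ⟨rfl⟩
  have hc₁ : Continuous f₁ := by
    rw [continuous_iff_continuousAt]
    intro x
    have : Tendsto (fun z => f₁ z - f₁ x) (nhds x) (nhds 0) := by
      refine squeeze_zero_norm (a := fun z => K₁ * ‖z - x‖ ^ 2 + |⟪g₁ x, z - x⟫|) (fun z => ?_) ?_
      · have := hex₁ x (z - x)
        rw [add_sub_cancel] at this
        rw [Real.norm_eq_abs]
        have h2 := abs_add_le (f₁ z - f₁ x - ⟪g₁ x, z - x⟫) ⟪g₁ x, z - x⟫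
        rw [sub_add_cancel] at h2
        linarith
      · have : Continuous fun z => K₁ * ‖z - x‖ ^ 2 + |⟪g₁ x, z - x⟫| := by fun_prop
        simpa using this.tendsto x
    exact tendsto_sub_nhds_zero_iff.1 this
  have hc₂ : Continuous f₂ := by
    rw [continuous_iff_continuousAt]
    intro x
    have : Tendsto (fun z => f₂ z - f₂ x) (nhds x) (nhds 0) := by
      refine squeeze_zero_norm (a := fun z => K₂ * ‖z - x‖ ^ 2 + |⟪g₂ x, z - x⟫|) (fun z => ?_) ?_
      · have := hex₂ x (z - x)
        rw [add_sub_cancel] at this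
        rw [Real.norm_eq_abs]
        have h2 := abs_add_le (f₂ z - f₂ x - ⟪g₂ x, z - x⟫) ⟪g₂ x, z - x⟫
        rw [sub_add_cancel] at h2
        linarith
      · have : Continuous fun z => K₂ * ‖z - x‖ ^ 2 + |⟪g₂ x, z - x⟫| := by fun_prop
        simpa using this.tendsto x
    exact tendsto_sub_nhds_zero_iff.1 this
  let Ψ : E × E → E × E := fun z =>
    (g₁ z.1 - S (z.1 - z.2) - η • z.1, g₂ z.2 - S (z.2 - z.1) - η • z.2)
  obtain ⟨K, hK⟩ : ∃ K, LipschitzWith K Ψ := by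
    have l1 : LipschitzWith (K₁ * 1) (fun z : E × E => g₁ z.1) := hg₁.comp LipschitzWith.prod_fst
    have l2 : LipschitzWith (K₂ * 1) (fun z : E × E => g₂ z.2) := hg₂.comp LipschitzWith.prod_snd
    let a := ContinuousLinearMap.fst ℝ E E
    let b := ContinuousLinearMap.snd ℝ E E
    have l3 := (S.comp (a - b)).lipschitz
    have l4 := (S.comp (b - a)).lipschitz
    have l5 := (η • a).lipschitz
    have l6 := (η • b).lipschitz
    exact ⟨_, ((l1.sub l3).sub l5).prodMk ((l2.sub l4).sub l6)⟩
  let d := Module.finrank ℝ (E × E)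
  let B : Set (E × E) := {z | ¬ DifferentiableAt ℝ g₁ z.1} ∪ {z | ¬ DifferentiableAt ℝ g₂ z.2}
  have hB : MeasureTheory.Measure.hausdorffMeasure (X := E × E) d B = 0 := by
    have _ : (MeasureTheory.volume : MeasureTheory.Measure (E × E)).IsAddHaarMeasure :=
      MeasureTheory.Measure.prod.instIsAddHaarMeasure _ _
    have hac : (MeasureTheory.Measure.hausdorffMeasure (X := E × E) d).AbsolutelyContinuous
        (MeasureTheory.volume : MeasureTheory.Measure (E × E)) :=
      MeasureTheory.Measure.absolutelyContinuous_isAddHaarMeasure _ _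
    refine hac ?_
    have n1 : (MeasureTheory.volume : MeasureTheory.Measure E) {z | ¬ DifferentiableAt ℝ g₁ z} = 0 :=
      hg₁.ae_differentiableAt
    have n2 : (MeasureTheory.volume : MeasureTheory.Measure E) {z | ¬ DifferentiableAt ℝ g₂ z} = 0 :=
      hg₂.ae_differentiableAt
    refine MeasureTheory.measure_union_null ?_ ?_
    · exact MeasureTheory.Measure.quasiMeasurePreserving_fst.preimage_null n1
    · exact MeasureTheory.Measure.quasiMeasurePreserving_snd.preimage_null n2
  have hr : 0 < min ρ (η * ρ / 4) := by positivity
  obtain ⟨⟨p, q⟩, hpq, hnot⟩ := exists_mem_ball_of_lipschitz_of_ae hK hB hr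
  rw [mem_ball_zero_iff, Prod.norm_def, max_lt_iff] at hpq
  obtain ⟨hp, hq⟩ := hpq
  simp only at hp hq
  let W : E × E → ℝ := fun z => f₁ z.1 + f₂ z.2 -
    (1 / 2 * ⟪S (z.1 - z.2), z.1 - z.2⟫ + η / 2 * (‖z.1‖ ^ 2 + ‖z.2‖ ^ 2)) - ⟪p, z.1⟫ - ⟪q, z.2⟫
  have hWc : Continuous W := by fun_prop
  have hfar : ∀ z : E × E, ρ < ‖z‖ → W z < W 0 := by
    intro z hz
    have h1 := hle z.1 z.2
    have h2 := neg_le_of_abs_le (abs_real_inner_le_norm p z.1)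
    have h3 := neg_le_of_abs_le (abs_real_inner_le_norm q z.2)
    have hz1 := norm_fst_le z
    have hz2 := norm_snd_le z
    have hz3 : ‖z‖ ^ 2 ≤ ‖z.1‖ ^ 2 + ‖z.2‖ ^ 2 := by
      rw [Prod.norm_def]
      rcases max_cases ‖z.1‖ ‖z.2‖ with ⟨h, _⟩ | ⟨h, _⟩ <;> rw [h] <;> nlinarith [sq_nonneg ‖z.1‖, sq_nonneg ‖z.2‖]
    have hW0 : W 0 = f₁ 0 + f₂ 0 := by simp [W]
    have hp' := hp.trans_le (min_le_right _ _)
    have hq' := hq.trans_le (min_le_right _ _)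
    have hz0 : 0 < ‖z‖ := hρ.trans hz
    have h4 : ‖p‖ * ‖z.1‖ ≤ η * ρ / 4 * ‖z‖ := by gcongr
    have h5 : ‖q‖ * ‖z.2‖ ≤ η * ρ / 4 * ‖z‖ := by gcongr
    have h6 : η * ρ / 2 * ‖z‖ < η / 2 * ‖z‖ ^ 2 := by
      have : 0 < η / 2 * ‖z‖ * (‖z‖ - ρ) := by
        have := sub_pos.2 hz
        positivity
      nlinarith
    have h7 : η / 2 * ‖z‖ ^ 2 ≤ η / 2 * (‖z.1‖ ^ 2 + ‖z.2‖ ^ 2) := by gcongr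
    rw [hW0]
    simp only [W]
    linarith
  obtain ⟨x, hx, hxm⟩ := (isCompact_closedBall (0 : E × E) ρ).exists_isMaxOn
    ⟨0, mem_closedBall_self hρ.le⟩ hWc.continuousOn
  have hmax : ∀ z, W z ≤ W x := by
    intro z
    rcases le_or_gt ‖z‖ ρ with h | h
    · exact hxm (mem_closedBall_zero_iff.2 h)
    · exact (hfar z h).le.trans (hxm (mem_closedBall_self hρ.le))
  have hxn : ‖x‖ ≤ ρ := mem_closedBall_zero_iff.1 hx
  have hm : ∀ z w, f₁ z + f₂ w - (1 / 2 * ⟪S (z - w), z - w⟫ + η / 2 * (‖z‖ ^ 2 + ‖w‖ ^ 2))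
        - ⟪p, z⟫ - ⟪q, w⟫ ≤ W x := fun z w => hmax (z, w)
  have G1 : g₁ x.1 = S (x.1 - x.2) + η • x.1 + p :=
    gradient_eq_of_max_left hS hex₁ _ _ _ fun z => by
      have := hm z x.2
      simp only [W] at this
      linarith
  have G2 : g₂ x.2 = S (x.2 - x.1) + η • x.2 + q :=
    gradient_eq_of_max_left hS hex₂ _ _ _ fun z => by
      have := hm x.1 z
      simp only [W] at this
      have e : ∀ w, ⟪S (x.1 - w), x.1 - w⟫ = ⟪S (w - x.1), w - x.1⟫ := fun w => by
        rw [← neg_sub w x.1, map_neg, inner_neg_neg]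
      rw [e, e] at this
      linarith
  have hxB : x ∉ B := by
    intro hxB
    refine hnot ⟨x, hxB, ?_⟩
    simp only [Ψ, G1, G2]
    ext1 <;> simp only <;> abel
  simp only [B, mem_union, mem_ofPred_eq, not_or, not_not] at hxB
  exact ⟨x.1, x.2, p, q, (norm_fst_le x).trans hxn, (norm_snd_le x).trans hxn,
    (hp.trans_le (min_le_left _ _)).le, (hq.trans_le (min_le_left _ _)).le, hxB.1, hxB.2, hm⟩

end Jensen

section Sums

variable {E : Type*} [NormedAddCommGroup E] [InnerProductSpace ℝ E]

/-- Sup-convolution of `u` over the closed ball of radius `R`. -/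
def supConv (u : E → ℝ) (R l : ℝ) (z : E) : ℝ :=
  sSup ((fun ξ => u ξ - l / 2 * ‖ξ - z‖ ^ 2) '' closedBall 0 R)

lemma mul_sq_norm_add_le {l μ : ℝ} (hl : 0 < l) (hμ : 0 < μ) (a b : E) :
    l * μ / (l + μ) * ‖a + b‖ ^ 2 ≤ l * ‖a‖ ^ 2 + μ * ‖b‖ ^ 2 := by
  rw [div_mul_eq_mul_div, div_le_iff₀ (by positivity)]
  have h1 : 0 ≤ ‖l • a - μ • b‖ ^ 2 := by positivity
  rw [norm_sub_sq_real, norm_smul, norm_smul, inner_smul_left, inner_smul_right,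
    RCLike.conj_to_real, Real.norm_of_nonneg hl.le, Real.norm_of_nonneg hμ.le] at h1
  rw [norm_add_sq_real]
  nlinarith

lemma inner_apply_self_le (S : E →L[ℝ] E) (h : E) : ⟪S h, h⟫ ≤ ‖S‖ * ‖h‖ ^ 2 := by
  refine (real_inner_le_norm _ _).trans ?_
  calc _ ≤ ‖S‖ * ‖h‖ * ‖h‖ := by gcongr; exact S.le_opNorm h
    _ = _ := by ring

variable [FiniteDimensional ℝ E] {u v : E → ℝ} {R l : ℝ}

lemma exists_supConv_eq (hR : 0 ≤ R) (hu : ContinuousOn u (closedBall 0 R)) (z : E) :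
    ∃ ξ ∈ closedBall (0 : E) R, supConv u R l z = u ξ - l / 2 * ‖ξ - z‖ ^ 2 ∧
      ∀ ξ' ∈ closedBall (0 : E) R, u ξ' - l / 2 * ‖ξ' - z‖ ^ 2 ≤ u ξ - l / 2 * ‖ξ - z‖ ^ 2 := by
  have hc : ContinuousOn (fun ξ => u ξ - l / 2 * ‖ξ - z‖ ^ 2) (closedBall 0 R) :=
    hu.sub (by fun_prop)
  obtain ⟨ξ, hξ, h1, h2⟩ := (isCompact_closedBall (0 : E) R).exists_sSup_image_eq_and_ge
    ⟨0, mem_closedBall_self hR⟩ hc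
  exact ⟨ξ, hξ, h1, h2⟩

lemma le_supConv (hR : 0 ≤ R) (hu : ContinuousOn u (closedBall 0 R)) (z : E) {ξ : E}
    (hξ : ξ ∈ closedBall (0 : E) R) : u ξ - l / 2 * ‖ξ - z‖ ^ 2 ≤ supConv u R l z := by
  obtain ⟨ξ', -, h1, h2⟩ := exists_supConv_eq (l := l) hR hu z
  exact h1 ▸ h2 ξ hξ

lemma supConv_midpoint (hR : 0 ≤ R) (hu : ContinuousOn u (closedBall 0 R)) (c h : E) :
    2 * supConv u R l c - l * ‖h‖ ^ 2 ≤ supConv u R l (c + h) + supConv u R l (c - h) := by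
  obtain ⟨ξ, hξ, h1, -⟩ := exists_supConv_eq (l := l) hR hu c
  have h2 := le_supConv (l := l) hR hu (c + h) hξ
  have h3 := le_supConv (l := l) hR hu (c - h) hξ
  have h4 := sq_norm_add_sub (ξ - c) h
  have e1 : ξ - (c + h) = ξ - c - h := by abel
  have e2 : ξ - (c - h) = ξ - c + h := by abel
  rw [e1] at h2
  rw [e2] at h3
  rw [h1]
  linear_combination h2 + h3 + l / 2 * h4

lemma continuous_supConv (hl : 0 ≤ l) (hR : 0 ≤ R) (hu : ContinuousOn u (closedBall 0 R)) :
    Continuous (supConv u R l) := by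
  have key : ∀ z w, supConv u R l z - supConv u R l w ≤ l / 2 * (‖w - z‖ * (2 * R + ‖w‖ + ‖z‖)) := by
    intro z w
    obtain ⟨ξ, hξ, h1, -⟩ := exists_supConv_eq (l := l) hR hu z
    have h2 := le_supConv (l := l) hR hu w hξ
    have h3 := norm_sub_le ξ w
    have h4 := norm_sub_le ξ z
    have h5 : ‖ξ‖ ≤ R := mem_closedBall_zero_iff.1 hξ
    have h6 : ‖ξ - w‖ - ‖ξ - z‖ ≤ ‖w - z‖ := by
      have := norm_sub_norm_le (ξ - w) (ξ - z)
      rwa [sub_sub_sub_cancel_left, norm_sub_rev z w] at this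
    have h7 : ‖ξ - w‖ ^ 2 - ‖ξ - z‖ ^ 2 ≤ ‖w - z‖ * (2 * R + ‖w‖ + ‖z‖) := by
      calc _ = (‖ξ - w‖ - ‖ξ - z‖) * (‖ξ - w‖ + ‖ξ - z‖) := by ring
        _ ≤ ‖w - z‖ * (‖ξ - w‖ + ‖ξ - z‖) := by gcongr
        _ ≤ _ := mul_le_mul_of_nonneg_left (by linarith) (norm_nonneg _)
    rw [h1]
    nlinarith
  rw [continuous_iff_continuousAt]
  intro z
  refine tendsto_sub_nhds_zero_iff.1 (squeeze_zero_norm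
    (a := fun w => l / 2 * (‖w - z‖ * (2 * R + ‖w‖ + ‖z‖))) (fun w => ?_) ?_)
  · rw [Real.norm_eq_abs, abs_le]
    have h1 := key z w
    have h2 := key w z
    rw [norm_sub_rev z w] at h2
    constructor <;> linarith
  · have : Continuous fun w => l / 2 * (‖w - z‖ * (2 * R + ‖w‖ + ‖z‖)) := by fun_prop
    simpa using this.tendsto z

/-- A `C^{1,1}` majorant of the sup-convolution, obtained by a further inf-convolution. -/
lemma exists_smooth_envelope {μ : ℝ} (hl : 0 < l) (hμ : 0 < μ) (hR : 0 ≤ R)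
    (hu : ContinuousOn u (closedBall 0 R)) :
    ∃ (k : E → ℝ) (g : E → E) (K : NNReal), LipschitzWith K g ∧
      (∀ x h, |k (x + h) - k x - ⟪g x, h⟫| ≤ K * ‖h‖ ^ 2) ∧
      (∀ x h, 2 * k x - l * ‖h‖ ^ 2 ≤ k (x + h) + k (x - h)) ∧
      (∀ z, supConv u R l z ≤ k z) ∧
      (∀ z₀ β p, (∀ z, supConv u R l z ≤ β + ⟪p, z - z₀⟫ + μ / 2 * ‖z - z₀‖ ^ 2) → k z₀ ≤ β) := by
  set m := l * μ / (l + μ) with hm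
  have hm0 : 0 < m := by positivity
  have hmμ : m < μ := by
    rw [hm, div_lt_iff₀ (by positivity)]
    nlinarith
  set s := supConv u R m with hs
  have hsc : Continuous s := continuous_supConv hm0.le hR hu
  have hmin : ∀ z, ∃ c, ∀ c', s c + μ / 2 * ‖z - c‖ ^ 2 ≤ s c' + μ / 2 * ‖z - c'‖ ^ 2 := by
    intro z
    refine Continuous.exists_forall_le (by fun_prop) ?_
    have h1 : Tendsto (fun c : E => (((μ - m) / 2) * ‖c‖ - μ * ‖z‖) * ‖c‖ + u 0) (cocompact E) atTop := by
      refine tendsto_atTop_add_const_right _ _ ?_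
      have hn := tendsto_norm_cocompact_atTop (E := E)
      refine Tendsto.atTop_mul_atTop₀ ?_ hn
      refine tendsto_atTop_add_const_right _ _ (hn.const_mul_atTop ?_)
      linarith
    refine tendsto_atTop_mono (fun c => ?_) h1
    have h2 := le_supConv (l := m) hR hu c (mem_closedBall_self hR)
    rw [zero_sub, norm_neg] at h2
    have h3 : ‖z - c‖ ^ 2 = ‖z‖ ^ 2 - 2 * ⟪z, c⟫ + ‖c‖ ^ 2 := norm_sub_sq_real z c
    have h4 := real_inner_le_norm z c
    have h5 : 0 ≤ μ * (‖z‖ * ‖c‖ - ⟪z, c⟫) := mul_nonneg hμ.le (by linarith)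
    have h6 : 0 ≤ μ / 2 * ‖z‖ ^ 2 := by positivity
    rw [h3]
    nlinarith
  choose c hc using hmin
  set k : E → ℝ := fun z => s (c z) + μ / 2 * ‖z - c z‖ ^ 2 with hk
  have hmid : ∀ x h, 2 * k x - l * ‖h‖ ^ 2 ≤ k (x + h) + k (x - h) := by
    intro x h
    set c₁ := c (x + h)
    set c₂ := c (x - h)
    set e := (1 / 2 : ℝ) • (c₁ + c₂) with he
    set d := (1 / 2 : ℝ) • (c₁ - c₂) with hd
    have h1 := supConv_midpoint (l := m) hR hu e d
    have e1 : e + d = c₁ := by rw [he, hd]; module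
    have e2 : e - d = c₂ := by rw [he, hd]; module
    rw [e1, e2] at h1
    have h2 := hc x e
    have h3 := sq_norm_add_sub (x - e) (h - d)
    have e3 : x - e + (h - d) = x + h - c₁ := by rw [← e1]; abel
    have e4 : x - e - (h - d) = x - h - c₂ := by rw [← e2]; abel
    rw [e3, e4] at h3
    have h4 := mul_sq_norm_add_le hl hμ h (d - h)
    rw [add_sub_cancel, norm_sub_rev d h, ← hm] at h4
    simp only [hk]
    rw [← hs] at h1
    nlinarith
  have hup : ∀ x, ∃ p : E, ∀ h, k (x + h) ≤ k x + ⟪p, h⟫ + μ / 2 * ‖h‖ ^ 2 := by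
    intro x
    refine ⟨μ • (x - c x), fun h => ?_⟩
    have h1 := hc (x + h) (c x)
    have e1 : x + h - c x = (x - c x) + h := by abel
    rw [e1, norm_add_sq_real] at h1
    rw [inner_smul_left, RCLike.conj_to_real]
    simp only [hk]
    linarith
  obtain ⟨g, K, hg, hex⟩ := exists_lipschitz_gradient hμ.le hl.le hup hmid
  refine ⟨k, g, K, hg, hex, hmid, fun z => ?_, fun z₀ β p hβ => ?_⟩
  · obtain ⟨ξ, hξ, h1, -⟩ := exists_supConv_eq (l := l) hR hu z
    have h2 := le_supConv (l := m) hR hu (c z) hξ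
    have h3 := mul_sq_norm_add_le hl hμ (ξ - z) (z - c z)
    rw [sub_add_sub_cancel, ← hm] at h3
    rw [h1]
    simp only [hk]
    rw [← hs] at h2
    linarith
  · set c₀ := z₀ - (1 / μ) • p with hc₀
    have h1 := hc z₀ c₀
    obtain ⟨ξ, hξ, h2, -⟩ := exists_supConv_eq (l := m) hR hu c₀
    set z := c₀ + (l / (l + μ)) • (ξ - c₀) with hz
    have h3 := (le_supConv (l := l) hR hu z hξ).trans (hβ z)
    have hlμ : l + μ ≠ 0 := by positivity
    have e1 : ξ - z = (μ / (l + μ)) • (ξ - c₀) := by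
      rw [hz, show μ / (l + μ) = 1 - l / (l + μ) by field_simp; ring]
      module
    have e2 : z - z₀ = (l / (l + μ)) • (ξ - c₀) - (1 / μ) • p := by
      rw [hz, hc₀]; module
    have e3 : z₀ - c₀ = (1 / μ) • p := by rw [hc₀]; abel
    rw [e1, e2, norm_sub_sq_real, inner_sub_right, inner_smul_right, inner_smul_right, norm_smul,
      inner_smul_right, inner_smul_left, norm_smul, norm_smul, RCLike.conj_to_real,
      real_inner_self_eq_norm_sq, real_inner_comm p] at h3
    simp only [mul_pow, Real.norm_eq_abs, sq_abs] at h3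
    rw [e3, norm_smul, mul_pow, Real.norm_eq_abs, sq_abs, hs, h2, ← hs] at h1
    simp only [hk]
    refine h1.trans ?_
    have e4 : m * ‖ξ - c₀‖ ^ 2 = l * ((μ / (l + μ)) ^ 2 * ‖ξ - c₀‖ ^ 2)
        + μ * ((l / (l + μ)) ^ 2 * ‖ξ - c₀‖ ^ 2) := by
      rw [hm]; field_simp; ring
    have e5 : μ * ((1 / μ) ^ 2 * ‖p‖ ^ 2) = 1 / μ * ‖p‖ ^ 2 := by field_simp
    have e6 : μ / 2 * (2 * (1 / μ * (l / (l + μ) * ⟪p, ξ - c₀⟫))) = l / (l + μ) * ⟪p, ξ - c₀⟫ := by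
      field_simp
    nlinarith

end Sums

section SumsTheorem

variable {E : Type*} [NormedAddCommGroup E] [InnerProductSpace ℝ E] [FiniteDimensional ℝ E]
  {u v : E → ℝ} {R l : ℝ}

lemma supConv_eq_of_touching {μ : ℝ} (hl : 0 ≤ l) (hR : 0 ≤ R)
    (hu : ContinuousOn u (closedBall 0 R)) {k : E → ℝ} (hk : ∀ z, supConv u R l z ≤ k z)
    (hk' : ∀ z₀ β p, (∀ z, supConv u R l z ≤ β + ⟪p, z - z₀⟫ + μ / 2 * ‖z - z₀‖ ^ 2) → k z₀ ≤ β)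
    {x p : E} (hx : ∀ z, k z ≤ k x + ⟪p, z - x⟫ + (μ - 1) / 2 * ‖z - x‖ ^ 2)
    (hμ : 0 ≤ μ) : supConv u R l x = k x := by
  refine le_antisymm (hk x) (not_lt.1 fun hlt => ?_)
  set m := (k x - supConv u R l x) / 2 with hm
  have hm0 : 0 < m := by rw [hm]; linarith
  have hc : Continuous fun z => supConv u R l z - ⟪p, z - x⟫ :=
    (continuous_supConv hl hR hu).sub (by fun_prop)
  have hnear : ∀ᶠ z in nhds x, supConv u R l z - ⟪p, z - x⟫ < k x - m := by
    refine hc.continuousAt.eventually (gt_mem_nhds ?_)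
    simp only [sub_self, inner_zero_right, hm]
    linarith
  obtain ⟨ρ, hρ, hb⟩ := Metric.eventually_nhds_iff_ball.1 hnear
  have h1 : k x ≤ k x - min m (ρ ^ 2 / 2) := by
    refine hk' x _ p fun z => ?_
    rcases lt_or_ge ‖z - x‖ ρ with h | h
    · have := hb z (by rwa [mem_ball, dist_eq_norm])
      have h2 : 0 ≤ μ / 2 * ‖z - x‖ ^ 2 := by positivity
      linarith [min_le_left m (ρ ^ 2 / 2)]
    · have h2 := (hk z).trans (hx z)
      have h3 : ρ ^ 2 ≤ ‖z - x‖ ^ 2 := by gcongr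
      linarith [min_le_right m (ρ ^ 2 / 2)]
  have : 0 < min m (ρ ^ 2 / 2) := by positivity
  linarith

lemma exists_touching_point (hl : 0 < l) (hR : 0 ≤ R)
    (hu : ContinuousOn u (closedBall 0 R)) {k : E → ℝ} (hk : ∀ z, supConv u R l z ≤ k z)
    {g : E → E} {K : ℝ} (hex : ∀ x h, |k (x + h) - k x - ⟪g x, h⟫| ≤ K * ‖h‖ ^ 2)
    {x : E} (hx : supConv u R l x = k x) :
    x + (1 / l) • g x ∈ closedBall (0 : E) R ∧
      ∀ h, x + (1 / l) • g x + h ∈ closedBall (0 : E) R →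
        u (x + (1 / l) • g x + h) - u (x + (1 / l) • g x) ≤ k (x + h) - k x := by
  obtain ⟨ξ, hξ, h1, -⟩ := exists_supConv_eq (l := l) hR hu x
  have h2 : l • (ξ - x) - g x = 0 := by
    refine eq_zero_of_inner_le_sq _ (K + l / 2) fun h => ?_
    have h3 := (le_supConv (l := l) hR hu (x + h) hξ).trans (hk _)
    have h4 := (abs_le.1 (hex x h)).2
    have e : ξ - (x + h) = ξ - x - h := by abel
    rw [e, norm_sub_sq_real] at h3
    rw [inner_sub_left, inner_smul_left, RCLike.conj_to_real]
    linarith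
  have h3 : x + (1 / l) • g x = ξ := by
    rw [← sub_eq_zero.1 h2, smul_smul, one_div_mul_cancel hl.ne', one_smul, add_sub_cancel]
  rw [h3]
  refine ⟨hξ, fun h hh => ?_⟩
  have h4 := (le_supConv (l := l) hR hu (x + h) hh).trans (hk _)
  rw [add_sub_add_right_eq_sub] at h4
  linarith

/-- Crandall–Ishii type theorem on sums. -/
lemma exists_jets_of_max (hR : 0 < R) (hl : 0 < l) (hu : ContinuousOn u (closedBall 0 R))
    (hv : ContinuousOn v (closedBall 0 R)) (hu0 : u 0 = 0) (hv0 : v 0 = 0) {S : E →L[ℝ] E}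
    (hS : ∀ a b, ⟪S a, b⟫ = ⟪a, S b⟫)
    (hmax : ∀ ξ ∈ closedBall (0 : E) R, ∀ η ∈ closedBall (0 : E) R, ∀ z w,
      u ξ + v η - l / 2 * ‖ξ - z‖ ^ 2 - l / 2 * ‖η - w‖ ^ 2 ≤ 1 / 2 * ⟪S (z - w), z - w⟫)
    {ε : ℝ} (hε : 0 < ε) :
    ∃ (ξ η p q : E) (X Y : E →L[ℝ] E), ‖ξ‖ < ε ∧ ‖η‖ < ε ∧ ‖p‖ < ε ∧ ‖q‖ < ε ∧
      (∀ᶠ z in nhds ξ, u z ≤ u ξ + ⟪p, z - ξ⟫ + 1 / 2 * ⟪X (z - ξ), z - ξ⟫) ∧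
      (∀ᶠ z in nhds η, v z ≤ v η + ⟪q, z - η⟫ + 1 / 2 * ⟪Y (z - η), z - η⟫) ∧
      (∀ h k, ⟪X h, h⟫ + ⟪Y k, k⟫ ≤ ⟪S (h - k), h - k⟫ + ε * (‖h‖ ^ 2 + ‖k‖ ^ 2)) ∧
      (∀ h, -(l * ‖h‖ ^ 2) ≤ ⟪X h, h⟫) ∧ ∀ h, -(l * ‖h‖ ^ 2) ≤ ⟪Y h, h⟫ := by
  set η₀ := ε / 2 with hη₀
  have hη : 0 < η₀ := half_pos hε
  set μ := ‖S‖ + η₀ + 1 with hμ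
  have hS0 := norm_nonneg S
  have hμ0 : 0 < μ := by positivity
  obtain ⟨k₁, g₁, K₁, hg₁, hex₁, hmid₁, hle₁, hmin₁⟩ := exists_smooth_envelope hl hμ0 hR.le hu
  obtain ⟨k₂, g₂, K₂, hg₂, hex₂, hmid₂, hle₂, hmin₂⟩ := exists_smooth_envelope hl hμ0 hR.le hv
  have hSle : ∀ h, ⟪S h, h⟫ ≤ μ * ‖h‖ ^ 2 := fun h =>
    (inner_apply_self_le S h).trans (by gcongr; rw [hμ]; linarith)
  have hquad : ∀ z₀ z w, 1 / 2 * ⟪S (z - w), z - w⟫ = 1 / 2 * ⟪S (z₀ - w), z₀ - w⟫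
      + ⟪S (z₀ - w), z - z₀⟫ + 1 / 2 * ⟪S (z - z₀), z - z₀⟫ := by
    intro z₀ z w
    have e : z - w = (z₀ - w) + (z - z₀) := by abel
    rw [e, map_add, inner_add_left, inner_add_right, inner_add_right, hS (z - z₀) (z₀ - w),
      real_inner_comm (S (z₀ - w)) (z - z₀)]
    ring
  have hsum : ∀ z w, supConv u R l z + supConv v R l w ≤ 1 / 2 * ⟪S (z - w), z - w⟫ := by
    intro z w
    obtain ⟨ξ, hξ, h1, -⟩ := exists_supConv_eq (l := l) hR.le hu z
    obtain ⟨η, hη, h2, -⟩ := exists_supConv_eq (l := l) hR.le hv w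
    have := hmax ξ hξ η hη z w
    linarith
  have hsum1 : ∀ z w, k₁ z + supConv v R l w ≤ 1 / 2 * ⟪S (z - w), z - w⟫ := by
    intro z₀ w
    have := hmin₁ z₀ (1 / 2 * ⟪S (z₀ - w), z₀ - w⟫ - supConv v R l w) (S (z₀ - w)) fun z => by
      have h1 := hsum z w
      rw [hquad z₀] at h1
      linarith [hSle (z - z₀)]
    linarith
  have hsum2 : ∀ z w, k₁ z + k₂ w ≤ 1 / 2 * ⟪S (z - w), z - w⟫ := by
    intro z w₀
    have := hmin₂ w₀ (1 / 2 * ⟪S (z - w₀), z - w₀⟫ - k₁ z) (S (w₀ - z)) fun w => by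
      have h1 := hsum1 z w
      have e : ∀ w, ⟪S (z - w), z - w⟫ = ⟪S (w - z), w - z⟫ := fun w => by
        rw [← neg_sub w z, map_neg, inner_neg_neg]
      rw [e, hquad w₀] at h1
      rw [e]
      linarith [hSle (w - w₀)]
    linarith
  have hk0 : 0 ≤ k₁ 0 + k₂ 0 := by
    have h1 := (le_supConv (l := l) hR.le hu 0 (mem_closedBall_self hR.le)).trans (hle₁ 0)
    have h2 := (le_supConv (l := l) hR.le hv 0 (mem_closedBall_self hR.le)).trans (hle₂ 0)
    simp only [hu0, hv0, sub_self, norm_zero] at h1 h2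
    linarith
  set c := 2 + (2 * ‖S‖ + η₀ + 1) * (1 + 1 / l) with hc
  have hc0 : 0 < c := by positivity
  set ρ := min (ε / 2) (R / 2) / c with hρ
  have hρ0 : 0 < ρ := by positivity
  obtain ⟨x, y, p, q, hx, hy, hp, hq, hdx, hdy, hm⟩ :=
    exists_tilted_max hη hS hg₁ hg₂ hex₁ hex₂ hsum2 hk0 hρ0
  have hm1 : ∀ z, k₁ z - (1 / 2 * ⟪S (z - y), z - y⟫ + η₀ / 2 * ‖z‖ ^ 2) - ⟪p, z⟫ ≤
      k₁ x - (1 / 2 * ⟪S (x - y), x - y⟫ + η₀ / 2 * ‖x‖ ^ 2) - ⟪p, x⟫ := fun z => by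
    linarith [hm z y]
  have hm2 : ∀ z, k₂ z - (1 / 2 * ⟪S (z - x), z - x⟫ + η₀ / 2 * ‖z‖ ^ 2) - ⟪q, z⟫ ≤
      k₂ y - (1 / 2 * ⟪S (y - x), y - x⟫ + η₀ / 2 * ‖y‖ ^ 2) - ⟪q, y⟫ := fun z => by
    have e : ∀ w, ⟪S (w - x), w - x⟫ = ⟪S (x - w), x - w⟫ := fun w => by
      rw [← neg_sub x w, map_neg, inner_neg_neg]
    rw [e, e]
    linarith [hm x z]
  have G1 := gradient_eq_of_max_left hS hex₁ _ _ _ hm1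
  have G2 := gradient_eq_of_max_left hS hex₂ _ _ _ hm2
  have hparab : ∀ (k : E → ℝ) (x y p : E),
      (∀ z, k z - (1 / 2 * ⟪S (z - y), z - y⟫ + η₀ / 2 * ‖z‖ ^ 2) - ⟪p, z⟫ ≤
      k x - (1 / 2 * ⟪S (x - y), x - y⟫ + η₀ / 2 * ‖x‖ ^ 2) - ⟪p, x⟫) →
      ∀ z, k z ≤ k x + ⟪S (x - y) + η₀ • x + p, z - x⟫ + (μ - 1) / 2 * ‖z - x‖ ^ 2 := by
    intro k x y p h z
    have h1 := h z
    rw [hquad x z] at h1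
    have h2 := inner_apply_self_le S (z - x)
    have e : ‖z‖ ^ 2 = ‖x‖ ^ 2 + 2 * ⟪x, z - x⟫ + ‖z - x‖ ^ 2 := by
      rw [← norm_add_sq_real, add_sub_cancel]
    rw [e] at h1
    rw [inner_add_left, inner_add_left, inner_smul_left, RCLike.conj_to_real, hμ]
    have e2 : ⟪p, z⟫ = ⟪p, x⟫ + ⟪p, z - x⟫ := by rw [← inner_add_right, add_sub_cancel]
    rw [e2] at h1
    linarith
  have hgn : ∀ a b r : E, ‖a‖ ≤ ρ → ‖b‖ ≤ ρ → ‖r‖ ≤ ρ →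
      ‖S (a - b) + η₀ • a + r‖ ≤ (2 * ‖S‖ + η₀ + 1) * ρ := by
    intro a b r ha hb hr
    have h1 : ‖S (a - b)‖ ≤ ‖S‖ * (ρ + ρ) :=
      (S.le_opNorm _).trans (by gcongr; exact (norm_sub_le a b).trans (by gcongr))
    have h2 : ‖η₀ • a‖ ≤ η₀ * ρ := by rw [norm_smul, Real.norm_of_nonneg hη.le]; gcongr
    refine (norm_add₃_le).trans ?_
    linarith
  have hcρ : c * ρ = min (ε / 2) (R / 2) := by rw [hρ]; field_simp
  have hgρ : (2 * ‖S‖ + η₀ + 1) * ρ < ε := by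
    have h1 : (2 * ‖S‖ + η₀ + 1) * ρ ≤ c * ρ := by
      gcongr
      have : 0 < (2 * ‖S‖ + η₀ + 1) * (1 / l) := by positivity
      rw [hc]; linarith
    linarith [min_le_left (ε / 2) (R / 2)]
  have hξρ : ∀ a g : E, ‖a‖ ≤ ρ → ‖g‖ ≤ (2 * ‖S‖ + η₀ + 1) * ρ →
      ‖a + (1 / l) • g‖ ≤ min (ε / 2) (R / 2) := by
    intro a g ha hg
    rw [← hcρ]
    refine (norm_add_le _ _).trans ?_
    have : ‖(1 / l) • g‖ ≤ 1 / l * ((2 * ‖S‖ + η₀ + 1) * ρ) := by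
      rw [norm_smul, Real.norm_of_nonneg (by positivity)]
      gcongr
    have h2 : 0 < (2 * ‖S‖ + η₀ + 1) * ρ := by positivity
    rw [hc]
    nlinarith
  have n1 := hgn x y p hx hy hp
  have n2 := hgn y x q hy hx hq
  rw [← G1] at n1
  rw [← G2] at n2
  have t1 := supConv_eq_of_touching hl.le hR.le hu hle₁ hmin₁ (hparab k₁ x y p hm1) hμ0.le
  have t2 := supConv_eq_of_touching hl.le hR.le hv hle₂ hmin₂ (hparab k₂ y x q hm2) hμ0.le
  obtain ⟨-, j1⟩ := exists_touching_point hl hR.le hu hle₁ hex₁ t1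
  obtain ⟨-, j2⟩ := exists_touching_point hl hR.le hv hle₂ hex₂ t2
  obtain ⟨X, hX⟩ := hdx
  obtain ⟨Y, hY⟩ := hdy
  have hjet : ∀ (u k : E → ℝ) (g : E → E) (K : NNReal) (x : E) (X : E →L[ℝ] E),
      (∀ x h, |k (x + h) - k x - ⟪g x, h⟫| ≤ K * ‖h‖ ^ 2) → HasFDerivAt g X x →
      ‖x + (1 / l) • g x‖ ≤ min (ε / 2) (R / 2) →
      (∀ h, x + (1 / l) • g x + h ∈ closedBall (0 : E) R →
        u (x + (1 / l) • g x + h) - u (x + (1 / l) • g x) ≤ k (x + h) - k x) →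
      ∀ᶠ z in nhds (x + (1 / l) • g x), u z ≤ u (x + (1 / l) • g x)
        + ⟪g x, z - (x + (1 / l) • g x)⟫ + 1 / 2 * ⟪(X + η₀ • ContinuousLinearMap.id ℝ E)
          (z - (x + (1 / l) • g x)), z - (x + (1 / l) • g x)⟫ := by
    intro u k g K x X hex hX hn hj
    set ξ := x + (1 / l) • g x
    have h1 : Tendsto (fun z => z - ξ) (nhds ξ) (nhds 0) := by
      have := (by fun_prop : Continuous fun z => z - ξ).tendsto ξ
      simpa using this
    filter_upwards [h1.eventually (second_order_expansion hex hX (half_pos hη)),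
      Metric.ball_mem_nhds ξ (half_pos hR)] with z hz hzb
    have h2 := hj (z - ξ) (by
      rw [add_sub_cancel, mem_closedBall_zero_iff]
      rw [mem_ball, dist_eq_norm] at hzb
      have := norm_add_le (z - ξ) ξ
      rw [sub_add_cancel] at this
      linarith [min_le_right (ε / 2) (R / 2)])
    rw [add_sub_cancel] at h2
    have h3 := (abs_le.1 hz).2
    rw [add_apply, smul_apply, ContinuousLinearMap.id_apply,
      inner_add_left, inner_smul_left, real_inner_self_eq_norm_sq, RCLike.conj_to_real]
    linarith
  have hlt : min (ε / 2) (R / 2) < ε := (min_le_left _ _).trans_lt (by linarith)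
  have happ : ∀ (X : E →L[ℝ] E) h, ⟪(X + η₀ • ContinuousLinearMap.id ℝ E) h, h⟫
      = ⟪X h, h⟫ + η₀ * ‖h‖ ^ 2 := by
    intro X h
    rw [add_apply, smul_apply, ContinuousLinearMap.id_apply,
      inner_add_left, inner_smul_left, real_inner_self_eq_norm_sq, RCLike.conj_to_real]
  refine ⟨_, _, g₁ x, g₂ y, X + η₀ • ContinuousLinearMap.id ℝ E,
    Y + η₀ • ContinuousLinearMap.id ℝ E, (hξρ x _ hx n1).trans_lt hlt,
    (hξρ y _ hy n2).trans_lt hlt, n1.trans_lt hgρ, n2.trans_lt hgρ,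
    hjet u k₁ g₁ K₁ x X hex₁ hX (hξρ x _ hx n1) j1, hjet v k₂ g₂ K₂ y Y hex₂ hY (hξρ y _ hy n2) j2,
    fun h k => ?_, fun h => ?_, fun h => ?_⟩
  · rw [happ, happ]
    have := inner_add_le_of_max hex₁ hex₂ hX hY p q hm h k
    rw [hη₀] at this ⊢
    linarith
  · rw [happ]
    have h1 := neg_le_inner_of_semiconvex hex₁ hmid₁ hX h
    have h2 : 0 ≤ η₀ * ‖h‖ ^ 2 := by positivity
    linarith
  · rw [happ]
    have h1 := neg_le_inner_of_semiconvex hex₂ hmid₂ hY h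
    have h2 : 0 ≤ η₀ * ‖h‖ ^ 2 := by positivity
    linarith

end SumsTheorem

section Jets

/-- Matrix of the symmetric part of the quadratic form `w ↦ ⟪A w, w⟫`. -/
def symMat (A : EucSp N →L[ℝ] EucSp N) : MatN N := fun i j =>
  1 / 2 * (⟪A (EuclideanSpace.single i 1), EuclideanSpace.single j 1⟫
    + ⟪A (EuclideanSpace.single j 1), EuclideanSpace.single i 1⟫)

/-- Polar bilinear form of `w ↦ ⟪A w, w⟫ / 2`. -/
def polarForm (A : EucSp N →L[ℝ] EucSp N) : EucSp N →L[ℝ] EucSp N →L[ℝ] ℝ :=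
  (LinearMap.mk₂ ℝ (fun v w => 1 / 2 * (⟪A v, w⟫ + ⟪A w, v⟫))
    (fun _ _ _ => by simp only [map_add, inner_add_left, inner_add_right]; ring)
    (fun c v w => by
      simp only [map_smul, inner_smul_left, inner_smul_right, RCLike.conj_to_real, smul_eq_mul]
      ring)
    (fun _ _ _ => by simp only [map_add, inner_add_left, inner_add_right]; ring)
    (fun c v w => by
      simp only [map_smul, inner_smul_left, inner_smul_right, RCLike.conj_to_real, smul_eq_mul]
      ring)).mkContinuous₂ ‖A‖ fun v w => by
    have h1 := (norm_inner_le_norm (𝕜 := ℝ) (A v) w).trans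
      (mul_le_mul_of_nonneg_right (A.le_opNorm v) (norm_nonneg w))
    have h2 := (norm_inner_le_norm (𝕜 := ℝ) (A w) v).trans
      (mul_le_mul_of_nonneg_right (A.le_opNorm w) (norm_nonneg v))
    have h3 := norm_add_le ⟪A v, w⟫ ⟪A w, v⟫
    simp only [Real.norm_eq_abs, LinearMap.mk₂_apply, abs_mul] at *
    rw [abs_of_pos (by norm_num : (0 : ℝ) < 1 / 2)]
    linarith

lemma polarForm_apply (A : EucSp N →L[ℝ] EucSp N) (v w : EucSp N) :
    polarForm A v w = 1 / 2 * (⟪A v, w⟫ + ⟪A w, v⟫) := by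
  simp [polarForm]

lemma hasFDerivAt_quadratic (A : EucSp N →L[ℝ] EucSp N) (p x₀ : EucSp N) (c : ℝ) (x : EucSp N) :
    HasFDerivAt (fun y => c + ⟪p, y - x₀⟫ + 1 / 2 * ⟪A (y - x₀), y - x₀⟫)
      (innerSL ℝ p + polarForm A (x - x₀)) x := by
  have h0 : HasFDerivAt (fun y : EucSp N => y - x₀) (ContinuousLinearMap.id ℝ _) x :=
    (hasFDerivAt_id x).sub_const x₀
  have h1 := (A.hasFDerivAt.comp x h0).inner ℝ h0
  have h2 := (((innerSL ℝ p).hasFDerivAt.comp x h0).const_add c).add (h1.const_mul (1 / 2))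
  refine h2.congr_fderiv ?_
  ext w
  simp [polarForm_apply, real_inner_comm, inner_sub_left, inner_sub_right]
  ring

lemma gradient_quadratic (A : EucSp N →L[ℝ] EucSp N) (p x₀ : EucSp N) (c : ℝ) :
    gradient (fun y => c + ⟪p, y - x₀⟫ + 1 / 2 * ⟪A (y - x₀), y - x₀⟫) x₀ = p := by
  refine HasGradientAt.gradient ?_
  rw [hasGradientAt_iff_hasFDerivAt]
  refine (hasFDerivAt_quadratic A p x₀ c x₀).congr_fderiv ?_
  ext w
  simp

lemma hessMat_quadratic (A : EucSp N →L[ℝ] EucSp N) (p x₀ : EucSp N) (c : ℝ) :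
    hessMat (fun y => c + ⟪p, y - x₀⟫ + 1 / 2 * ⟪A (y - x₀), y - x₀⟫) x₀ = symMat A := by
  have h1 : fderiv ℝ (fun y => c + ⟪p, y - x₀⟫ + 1 / 2 * ⟪A (y - x₀), y - x₀⟫)
      = fun x => innerSL ℝ p + polarForm A (x - x₀) :=
    funext fun x => (hasFDerivAt_quadratic A p x₀ c x).fderiv
  have h2 : HasFDerivAt (fun x => innerSL ℝ p + polarForm A (x - x₀)) (polarForm A) x₀ := by
    have h0 : HasFDerivAt (fun y : EucSp N => y - x₀) (ContinuousLinearMap.id ℝ _) x₀ :=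
      (hasFDerivAt_id x₀).sub_const x₀
    exact ((polarForm A).hasFDerivAt.comp x₀ h0).const_add _
  ext i j
  rw [hessMat, iteratedFDeriv_two_apply, h1, h2.fderiv, polarForm_apply, symMat]
  rfl

/-- Jet form of the subsolution property for a continuous function. -/
def HasSubJets (T : ℝ) (F : EucSp N → EucSp N → MatN N → ℝ)
    (h : EucSp N → ℝ → EucSp N) (α : ℝ) (f : EucSp N → ℝ → ℝ) (u : EucSp N → ℝ → ℝ) : Prop :=
  ∀ x₀, ∀ t₀ ∈ Ioo (0 : ℝ) T,
    (∀ (p : EucSp N) (τ : ℝ) (A : EucSp N →L[ℝ] EucSp N) (b : EucSp N) (c : ℝ), p ≠ 0 →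
      (∀ᶠ z : EucSp N × ℝ in nhds (x₀, t₀), u z.1 z.2 ≤ u x₀ t₀ + ⟪p, z.1 - x₀⟫ + τ * (z.2 - t₀)
        + 1 / 2 * ⟪A (z.1 - x₀), z.1 - x₀⟫ + (z.2 - t₀) * ⟪b, z.1 - x₀⟫ + c * (z.2 - t₀) ^ 2) →
      τ - F x₀ p (symMat A) - gradTerm h α x₀ t₀ p ≤ f x₀ t₀) ∧
    (∀ δ > (0 : ℝ), Ioo (t₀ - δ) (t₀ + δ) ⊆ Ioo 0 T → ∀ τ κ : ℝ,
      (∀ t ∈ Ioo (t₀ - δ) (t₀ + δ), u x₀ t - (τ * (t - t₀) + κ * (t - t₀) ^ 2) ≤ u x₀ t₀) →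
      (∀ᶠ x in nhds x₀,
        sSup ((fun t => u x t - (τ * (t - t₀) + κ * (t - t₀) ^ 2)) '' Ioo (t₀ - δ) (t₀ + δ)) =
        sSup ((fun t => u x₀ t - (τ * (t - t₀) + κ * (t - t₀) ^ 2)) '' Ioo (t₀ - δ) (t₀ + δ))) →
      τ ≤ f x₀ t₀)

variable {T α : ℝ} {F : EucSp N → EucSp N → MatN N → ℝ} {h : EucSp N → ℝ → EucSp N}
  {f u : EucSp N → ℝ → ℝ}

lemma continuousAt_of_mem (hu : ContinuousOn (fun p : EucSp N × ℝ => u p.1 p.2) (univ ×ˢ Ioo 0 T))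
    (x : EucSp N) {t : ℝ} (ht : t ∈ Ioo 0 T) :
    ContinuousAt (fun p : EucSp N × ℝ => u p.1 p.2) (x, t) :=
  hu.continuousAt ((isOpen_univ.prod isOpen_Ioo).mem_nhds ⟨mem_univ _, ht⟩)

lemma uscEnv_eq (hu : ContinuousOn (fun p : EucSp N × ℝ => u p.1 p.2) (univ ×ˢ Ioo 0 T))
    (x : EucSp N) {t : ℝ} (ht : t ∈ Ioo 0 T) : uscEnv u x t = u x t :=
  (continuousAt_of_mem hu x ht).tendsto.limsup_eq

lemma lscEnv_eq (hu : ContinuousOn (fun p : EucSp N × ℝ => u p.1 p.2) (univ ×ˢ Ioo 0 T))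
    (x : EucSp N) {t : ℝ} (ht : t ∈ Ioo 0 T) : lscEnv u x t = u x t :=
  (continuousAt_of_mem hu x ht).tendsto.liminf_eq

lemma eventually_mem_Ioo (x : EucSp N) {t : ℝ} (ht : t ∈ Ioo 0 T) :
    ∀ᶠ z : EucSp N × ℝ in nhds (x, t), z.2 ∈ Ioo 0 T :=
  continuous_snd.continuousAt.eventually (isOpen_Ioo.mem_nhds ht)

/-- Quadratic test function. -/
def quadTest (x₀ : EucSp N) (t₀ c₀ : ℝ) (p : EucSp N) (τ : ℝ) (A : EucSp N →L[ℝ] EucSp N)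
    (b : EucSp N) (c : ℝ) (x : EucSp N) (t : ℝ) : ℝ :=
  c₀ + ⟪p, x - x₀⟫ + τ * (t - t₀) + 1 / 2 * ⟪A (x - x₀), x - x₀⟫ + (t - t₀) * ⟪b, x - x₀⟫
    + c * (t - t₀) ^ 2

lemma contDiff_quadTest (x₀ : EucSp N) (t₀ c₀ : ℝ) (p : EucSp N) (τ : ℝ)
    (A : EucSp N →L[ℝ] EucSp N) (b : EucSp N) (c : ℝ) :
    ContDiff ℝ 2 (fun z : EucSp N × ℝ => quadTest x₀ t₀ c₀ p τ A b c z.1 z.2) := by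
  unfold quadTest
  have h1 : ContDiff ℝ 2 fun z : EucSp N × ℝ => z.1 - x₀ := by fun_prop
  have h2 : ContDiff ℝ 2 fun z : EucSp N × ℝ => z.2 - t₀ := by fun_prop
  exact ((((contDiff_const.add (contDiff_const.inner ℝ h1)).add (contDiff_const.mul h2)).add
    (contDiff_const.mul ((A.contDiff.comp h1).inner ℝ h1))).add
    (h2.mul (contDiff_const.inner ℝ h1))).add (contDiff_const.mul (h2.pow 2))

lemma quadTest_slice (x₀ : EucSp N) (t₀ c₀ : ℝ) (p : EucSp N) (τ : ℝ)
    (A : EucSp N →L[ℝ] EucSp N) (b : EucSp N) (c : ℝ) :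
    (fun x => quadTest x₀ t₀ c₀ p τ A b c x t₀)
      = fun y => c₀ + ⟪p, y - x₀⟫ + 1 / 2 * ⟪A (y - x₀), y - x₀⟫ := by
  ext x
  simp [quadTest]

lemma hasDerivAt_poly (τ κ t₀ c₀ : ℝ) :
    HasDerivAt (fun s : ℝ => c₀ + τ * (s - t₀) + κ * (s - t₀) ^ 2) τ t₀ := by
  have h1 : HasDerivAt (fun s : ℝ => s - t₀) 1 t₀ := (hasDerivAt_id t₀).sub_const t₀
  refine (((h1.const_mul τ).const_add c₀).add ((h1.pow 2).const_mul κ)).congr_deriv ?_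
  simp

lemma deriv_quadTest (x₀ : EucSp N) (t₀ c₀ : ℝ) (p : EucSp N) (τ : ℝ)
    (A : EucSp N →L[ℝ] EucSp N) (b : EucSp N) (c : ℝ) :
    deriv (fun s => quadTest x₀ t₀ c₀ p τ A b c x₀ s) t₀ = τ := by
  have : (fun s => quadTest x₀ t₀ c₀ p τ A b c x₀ s)
      = fun s => c₀ + τ * (s - t₀) + c * (s - t₀) ^ 2 := by
    ext s
    simp [quadTest]
  rw [this]
  exact (hasDerivAt_poly τ c t₀ c₀).deriv

lemma hasSubJets_of_isSubSol
    (hu : ContinuousOn (fun p : EucSp N × ℝ => u p.1 p.2) (univ ×ˢ Ioo 0 T))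
    (hs : IsSubSol univ T F h α f u) : HasSubJets T F h α f u := by
  intro x₀ t₀ ht₀
  obtain ⟨hA, hB⟩ := hs x₀ (mem_univ _) t₀ ht₀
  constructor
  · intro p τ A b c hp hle
    have := hA (quadTest x₀ t₀ (u x₀ t₀) p τ A b c) (contDiff_quadTest ..) ?_ ?_ ?_
    · rwa [quadTest_slice, gradient_quadratic, hessMat_quadratic, deriv_quadTest] at this
    · filter_upwards [hle, eventually_mem_Ioo x₀ ht₀] with z hz hzt
      rw [uscEnv_eq hu _ hzt]
      exact hz
    · rw [uscEnv_eq hu _ ht₀]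
      simp [quadTest]
    · rwa [quadTest_slice, gradient_quadratic]
  · intro δ hδ hsub τ κ hle hloc
    have e : ∀ x, (fun t => uscEnv u x t - (τ * (t - t₀) + κ * (t - t₀) ^ 2)) '' Ioo (t₀ - δ) (t₀ + δ)
        = (fun t => u x t - (τ * (t - t₀) + κ * (t - t₀) ^ 2)) '' Ioo (t₀ - δ) (t₀ + δ) :=
      fun x => image_congr fun t ht => by rw [uscEnv_eq hu _ (hsub ht)]
    have := hB δ hδ (fun t => τ * (t - t₀) + κ * (t - t₀) ^ 2) (by fun_prop) (by simp)
      (fun t ht => by rw [uscEnv_eq hu _ (hsub ht), uscEnv_eq hu _ ht₀]; exact hle t ht)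
      (by simpa only [e] using hloc)
    have hd := (hasDerivAt_poly τ κ t₀ 0).deriv
    simp only [zero_add] at hd
    rwa [hd] at this

lemma symMat_neg (A : EucSp N →L[ℝ] EucSp N) : symMat (-A) = -symMat A := by
  ext i j
  simp [symMat]
  ring

lemma hasSubJets_neg_of_isSuperSol
    (hu : ContinuousOn (fun p : EucSp N × ℝ => u p.1 p.2) (univ ×ˢ Ioo 0 T))
    (hs : IsSuperSol univ T F h α f u) :
    HasSubJets T (fun x p X => -F x (-p) (-X)) h α (fun x t => -f x t) (fun x t => -u x t) := by
  intro x₀ t₀ ht₀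
  obtain ⟨hA, hB⟩ := hs x₀ (mem_univ _) t₀ ht₀
  constructor
  · intro p τ A b c hp hle
    have := hA (quadTest x₀ t₀ (u x₀ t₀) (-p) (-τ) (-A) (-b) (-c)) (contDiff_quadTest ..) ?_ ?_ ?_
    · rw [quadTest_slice, gradient_quadratic, hessMat_quadratic, deriv_quadTest, symMat_neg] at this
      simp only [gradTerm, inner_neg_right, norm_neg] at this ⊢
      linarith
    · filter_upwards [hle, eventually_mem_Ioo x₀ ht₀] with z hz hzt
      rw [lscEnv_eq hu _ hzt]
      simp only [quadTest, inner_neg_left, neg_apply]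
      linarith
    · rw [lscEnv_eq hu _ ht₀]
      simp [quadTest]
    · rw [quadTest_slice, gradient_quadratic]
      exact neg_ne_zero.2 hp
  · intro δ hδ hsub τ κ hle hloc
    have e : ∀ x, (fun t => lscEnv u x t - (-τ * (t - t₀) + -κ * (t - t₀) ^ 2)) ''
          Ioo (t₀ - δ) (t₀ + δ)
        = -((fun t => -u x t - (τ * (t - t₀) + κ * (t - t₀) ^ 2)) '' Ioo (t₀ - δ) (t₀ + δ)) := by
      intro x
      rw [← image_neg_eq_neg, image_image]
      exact image_congr fun t ht => by rw [lscEnv_eq hu _ (hsub ht)]; ring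
    have := hB δ hδ (fun t => -τ * (t - t₀) + -κ * (t - t₀) ^ 2) (by fun_prop) (by simp)
      (fun t ht => by
        rw [lscEnv_eq hu _ (hsub ht), lscEnv_eq hu _ ht₀]
        linarith [hle t ht])
      (by
        filter_upwards [hloc] with x hx
        rw [e, e, Real.sInf_def, Real.sInf_def, neg_neg, neg_neg, hx])
    have hd := (hasDerivAt_poly (-τ) (-κ) t₀ 0).deriv
    simp only [zero_add] at hd
    rw [hd] at this
    linarith

end Jets

section MatrixForms

lemma symMat_isSymm (A : EucSp N →L[ℝ] EucSp N) : (symMat A).IsSymm := by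
  ext i j
  simp only [Matrix.transpose_apply, symMat]
  ring

lemma symMat_add (A B : EucSp N →L[ℝ] EucSp N) : symMat (A + B) = symMat A + symMat B := by
  ext i j
  simp only [symMat, add_apply, inner_add_left, Matrix.add_apply]
  ring

lemma symMat_smul (c : ℝ) (A : EucSp N →L[ℝ] EucSp N) : symMat (c • A) = c • symMat A := by
  ext i j
  simp only [symMat, smul_apply, inner_smul_left, RCLike.conj_to_real, Matrix.smul_apply,
    smul_eq_mul]
  ring

lemma symMat_id : symMat (ContinuousLinearMap.id ℝ (EucSp N)) = 1 := by
  ext i j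
  rcases eq_or_ne i j with rfl | h
  · simp [symMat]
    norm_num
  · simp [symMat, EuclideanSpace.inner_single_left, h, h.symm]

lemma dotProduct_symMat (A : EucSp N →L[ℝ] EucSp N) (w : Fin N → ℝ) :
    w ⬝ᵥ (symMat A).mulVec w = ⟪A (WithLp.toLp 2 w), WithLp.toLp 2 w⟫ := by
  have hw : (WithLp.toLp 2 w : EucSp N) = ∑ i, w i • EuclideanSpace.single i 1 := by
    ext j
    simp [Pi.single_apply]
  have h1 : ⟪A (WithLp.toLp 2 w), WithLp.toLp 2 w⟫ = ∑ i, ∑ j, w i * w j *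
      ⟪A (EuclideanSpace.single i 1), EuclideanSpace.single j 1⟫ := by
    rw [hw, map_sum, sum_inner]
    refine Finset.sum_congr rfl fun i _ => ?_
    rw [inner_sum]
    refine Finset.sum_congr rfl fun j _ => ?_
    rw [map_smul, inner_smul_left, inner_smul_right, RCLike.conj_to_real]
    ring
  have h2 : ⟪A (WithLp.toLp 2 w), WithLp.toLp 2 w⟫ = ∑ i, ∑ j, w i * w j *
      ⟪A (EuclideanSpace.single j 1), EuclideanSpace.single i 1⟫ := by
    rw [h1, Finset.sum_comm]
    refine Finset.sum_congr rfl fun i _ => Finset.sum_congr rfl fun j _ => ?_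
    ring
  have h3 : w ⬝ᵥ (symMat A).mulVec w = 1 / 2 * (⟪A (WithLp.toLp 2 w), WithLp.toLp 2 w⟫
      + ⟪A (WithLp.toLp 2 w), WithLp.toLp 2 w⟫) := by
    nth_rewrite 1 [h1]
    rw [h2, ← Finset.sum_add_distrib, Finset.mul_sum, dotProduct]
    refine Finset.sum_congr rfl fun i _ => ?_
    rw [Matrix.mulVec, dotProduct, Finset.mul_sum, ← Finset.sum_add_distrib, Finset.mul_sum]
    refine Finset.sum_congr rfl fun j _ => ?_
    rw [symMat]
    ring
  rw [h3]
  ring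

lemma symMat_posSemidef {A : EucSp N →L[ℝ] EucSp N} (hA : ∀ w, 0 ≤ ⟪A w, w⟫) :
    (symMat A).PosSemidef := by
  refine Matrix.PosSemidef.of_dotProduct_mulVec_nonneg ?_ fun w => ?_
  · rw [Matrix.IsHermitian, Matrix.conjTranspose_eq_transpose_of_trivial]
    exact symMat_isSymm A
  · rw [star_trivial, dotProduct_symMat]
    exact hA _

open scoped MatrixOrder in
lemma inner_le_trace_symMat {A : EucSp N →L[ℝ] EucSp N} (hA : ∀ w, 0 ≤ ⟪A w, w⟫) (w : EucSp N) :
    ⟪A w, w⟫ ≤ (symMat A).trace * ‖w‖ ^ 2 := by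
  obtain ⟨B, hB⟩ := CStarAlgebra.nonneg_iff_eq_star_mul_self.mp (symMat_posSemidef hA).nonneg
  rw [Matrix.star_eq_conjTranspose, Matrix.conjTranspose_eq_transpose_of_trivial] at hB
  have h1 := dotProduct_symMat A w
  rw [hB, ← Matrix.mulVec_mulVec, Matrix.dotProduct_mulVec, Matrix.vecMul_transpose] at h1
  change _ = ⟪A w, w⟫ at h1
  rw [← h1, hB, Matrix.trace, EuclideanSpace.norm_sq_eq, Finset.sum_mul]
  simp only [Matrix.diag_apply, Matrix.mul_apply, Matrix.transpose_apply, dotProduct,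
    Matrix.mulVec, Real.norm_eq_abs, sq_abs]
  rw [← Finset.sum_mul, Finset.sum_comm, Finset.sum_mul]
  refine Finset.sum_le_sum fun i _ => ?_
  have := Finset.sum_mul_sq_le_sq_mul_sq Finset.univ (fun j => B i j) (fun j => w j)
  simp only [sq] at this ⊢
  exact this

lemma frobNorm_symMat_le {A : EucSp N →L[ℝ] EucSp N} {B : ℝ} (hB : 0 ≤ B)
    (hA : ∀ w, |⟪A w, w⟫| ≤ B * ‖w‖ ^ 2) : frobNorm (symMat A) ≤ 3 * B * N := by
  rw [frobNorm]
  refine Real.sqrt_le_iff.2 ⟨by positivity, ?_⟩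
  have hent : ∀ i j, (symMat A i j) ^ 2 ≤ (3 * B) ^ 2 := by
    intro i j
    refine sq_le_sq' ?_ ?_ <;>
    · have h1 := hA (EuclideanSpace.single i 1 + EuclideanSpace.single j 1)
      have h2 := hA (EuclideanSpace.single i 1)
      have h3 := hA (EuclideanSpace.single j 1)
      have h4 : ‖(EuclideanSpace.single i 1 + EuclideanSpace.single j 1 : EucSp N)‖ ^ 2 ≤ 2 ^ 2 := by
        gcongr
        refine (norm_add_le _ _).trans ?_
        simp
        norm_num
      have h5 := mul_le_mul_of_nonneg_left h4 hB
      simp only [map_add, inner_add_left, inner_add_right, PiLp.norm_single, norm_one,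
        one_pow, mul_one] at h1 h2 h3
      rw [abs_le] at h1 h2 h3
      rw [symMat]
      linarith [h1.1, h1.2, h2.1, h2.2, h3.1, h3.2]
  calc ∑ i, ∑ j, (symMat A i j) ^ 2 ≤ ∑ _i : Fin N, ∑ _j : Fin N, (3 * B) ^ 2 :=
        Finset.sum_le_sum fun i _ => Finset.sum_le_sum fun j _ => hent i j
    _ = (3 * B * N) ^ 2 := by
        simp
        ring

lemma blockDiag_posSemidef {G : Matrix (Fin N ⊕ Fin N) (Fin N ⊕ Fin N) ℝ} (hG : G.IsSymm)
    (h : ∀ v w : Fin N → ℝ, 0 ≤ Sum.elim v w ⬝ᵥ G.mulVec (Sum.elim v w)) : G.PosSemidef := by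
  refine Matrix.PosSemidef.of_dotProduct_mulVec_nonneg ?_ fun x => ?_
  · rwa [Matrix.IsHermitian, Matrix.conjTranspose_eq_transpose_of_trivial]
  · have := h (x ∘ Sum.inl) (x ∘ Sum.inr)
    rwa [Sum.elim_comp_inl_inr] at this

variable {F : EucSp N → EucSp N → MatN N → ℝ}

/-- The estimate of (H3) with a prescribed modulus on the whole space. -/
def IsModulusFor (F : EucSp N → EucSp N → MatN N → ℝ) (ω : ℝ → ℝ) : Prop :=
  ∀ X Y : MatN N, X.IsSymm → Y.IsSymm → ∀ ζ : ℝ, 0 < ζ →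
    (Matrix.fromBlocks X 0 0 Y +
      ζ • (1 : Matrix (Fin N ⊕ Fin N) (Fin N ⊕ Fin N) ℝ)).PosSemidef →
    ((4 * ζ) • Matrix.fromBlocks (1 : MatN N) (-1) (-1) (1 : MatN N) -
      Matrix.fromBlocks X 0 0 Y).PosSemidef →
    ∀ x ∈ (univ : Set (EucSp N)), ∀ y ∈ (univ : Set (EucSp N)), x ≠ y →
      F x (ζ • (x - y)) X - F y (ζ • (x - y)) (-Y) ≤ ω (ζ * ‖x - y‖ ^ 2)

/-- The estimate of (H6) with a prescribed constant. -/
def IsGradLipschitz (F : EucSp N → EucSp N → MatN N → ℝ) (α C : ℝ) : Prop :=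
  ∀ x : EucSp N, ∀ p : EucSp N, p ≠ 0 → ∀ q : EucSp N, ‖q‖ < ‖p‖ / 2 →
    ∀ X : MatN N, X.IsSymm →
      |F x (p + q) X - F x p X| ≤ C * ‖p‖ ^ (α - 1) * ‖q‖ * frobNorm X

lemma norm_sq_toLp (w : Fin N → ℝ) : ‖(WithLp.toLp 2 w : EucSp N)‖ ^ 2 = w ⬝ᵥ w := by
  rw [EuclideanSpace.norm_sq_eq, dotProduct]
  simp [sq]

lemma h3_of_forms {ω : ℝ → ℝ} (hω : IsModulusFor F ω)
    {X Y : EucSp N →L[ℝ] EucSp N} {ζ : ℝ} (hζ : 0 < ζ)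
    (hX : ∀ w, -(ζ * ‖w‖ ^ 2) ≤ ⟪X w, w⟫) (hY : ∀ w, -(ζ * ‖w‖ ^ 2) ≤ ⟪Y w, w⟫)
    (hXY : ∀ v w, ⟪X v, v⟫ + ⟪Y w, w⟫ ≤ 4 * ζ * ‖v - w‖ ^ 2) {x y : EucSp N} (hxy : x ≠ y) :
    F x (ζ • (x - y)) (symMat X) - F y (ζ • (x - y)) (-symMat Y) ≤ ω (ζ * ‖x - y‖ ^ 2) := by
  have hb : (Matrix.fromBlocks (symMat X) 0 0 (symMat Y)).IsSymm :=
    Matrix.IsSymm.fromBlocks (symMat_isSymm X) (by simp) (symMat_isSymm Y)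
  have hq : ∀ v w : Fin N → ℝ, Sum.elim v w ⬝ᵥ
      (Matrix.fromBlocks (symMat X) 0 0 (symMat Y)).mulVec (Sum.elim v w)
      = ⟪X (WithLp.toLp 2 v), WithLp.toLp 2 v⟫ + ⟪Y (WithLp.toLp 2 w), WithLp.toLp 2 w⟫ := by
    intro v w
    rw [Matrix.fromBlocks_mulVec, sumElim_dotProduct_sumElim]
    simp [dotProduct_symMat]
  refine hω _ _ (symMat_isSymm X) (symMat_isSymm Y) ζ hζ ?_ ?_ x (mem_univ _) y (mem_univ _) hxy
  · refine blockDiag_posSemidef (hb.add (Matrix.isSymm_one.smul ζ)) fun v w => ?_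
    rw [Matrix.add_mulVec, dotProduct_add, hq, Matrix.smul_mulVec, Matrix.one_mulVec,
      dotProduct_smul, sumElim_dotProduct_sumElim, ← norm_sq_toLp, ← norm_sq_toLp,
      smul_eq_mul]
    linarith [hX (WithLp.toLp 2 v), hY (WithLp.toLp 2 w)]
  · have hs : (Matrix.fromBlocks (1 : MatN N) (-1) (-1) (1 : MatN N)).IsSymm :=
      Matrix.IsSymm.fromBlocks Matrix.isSymm_one (by simp) Matrix.isSymm_one
    refine blockDiag_posSemidef ((hs.smul (4 * ζ)).sub hb) fun v w => ?_
    rw [Matrix.sub_mulVec, dotProduct_sub, hq, Matrix.smul_mulVec, dotProduct_smul,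
      Matrix.fromBlocks_mulVec, sumElim_dotProduct_sumElim, smul_eq_mul]
    have h1 := hXY (WithLp.toLp 2 v) (WithLp.toLp 2 w)
    rw [← WithLp.toLp_sub, norm_sq_toLp] at h1
    simp only [Sum.elim_comp_inl, Sum.elim_comp_inr, Matrix.one_mulVec, Matrix.neg_mulVec,
      dotProduct_add, dotProduct_neg, sub_dotProduct, dotProduct_sub] at h1 ⊢
    linarith [dotProduct_comm v w]

lemma inner_add_smul_apply (X Y : EucSp N →L[ℝ] EucSp N) (c : ℝ) (w : EucSp N) :
    ⟪(X + c • Y) w, w⟫ = ⟪X w, w⟫ + c * ⟪Y w, w⟫ := by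
  rw [add_apply, smul_apply, inner_add_left, inner_smul_left, RCLike.conj_to_real]

end MatrixForms

section ParabolicJets

lemma exists_jets_of_directional_max {E : Type*} [NormedAddCommGroup E] [InnerProductSpace ℝ E]
    [FiniteDimensional ℝ E] {R ζ c b : ℝ} (hR : 0 < R) (hζ : 0 < ζ) (hc0 : 0 ≤ c)
    (hc : c ≤ 2) (hb0 : 0 ≤ b) (hb : b ≤ 1) {e : E} (he : ‖e‖ = 1) {u v : E → ℝ}
    (hu : ContinuousOn u (closedBall 0 R)) (hv : ContinuousOn v (closedBall 0 R))
    (hu0 : u 0 = 0) (hv0 : v 0 = 0)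
    (hmax : ∀ ξ ∈ closedBall (0 : E) R, ∀ η ∈ closedBall (0 : E) R,
      u ξ + v η ≤ ζ / 2 * (c * ‖ξ - η‖ ^ 2 - (c + 2 * b) * ⟪e, ξ - η⟫ ^ 2))
    {ε : ℝ} (hε : 0 < ε) :
    ∃ (ξ η p q : E) (X Y : E →L[ℝ] E), ‖ξ‖ < ε ∧ ‖η‖ < ε ∧ ‖p‖ < ε ∧ ‖q‖ < ε ∧
      (∀ᶠ z in nhds ξ, u z ≤ u ξ + ⟪p, z - ξ⟫ + 1 / 2 * ⟪X (z - ξ), z - ξ⟫) ∧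
      (∀ᶠ z in nhds η, v z ≤ v η + ⟪q, z - η⟫ + 1 / 2 * ⟪Y (z - η), z - η⟫) ∧
      (∀ h k, ⟪X h, h⟫ + ⟪Y k, k⟫ ≤
        ζ * (2 * c * ‖h - k‖ ^ 2 - (2 * c + b) * ⟪e, h - k⟫ ^ 2) + ε * (‖h‖ ^ 2 + ‖k‖ ^ 2)) ∧
      (∀ h, -(8 * ζ * ‖h‖ ^ 2) ≤ ⟪X h, h⟫) ∧ ∀ h, -(8 * ζ * ‖h‖ ^ 2) ≤ ⟪Y h, h⟫ := by
  set S : E →L[ℝ] E := (ζ * (2 * c)) • ContinuousLinearMap.id ℝ E -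
    (ζ * (2 * c + b)) • (innerSL ℝ e).smulRight e with hSdef
  have hSa : ∀ a d, ⟪S a, d⟫ = ζ * (2 * c) * ⟪a, d⟫ - ζ * (2 * c + b) * (⟪e, a⟫ * ⟪e, d⟫) := by
    intro a d
    simp [hSdef, inner_sub_left, inner_smul_left]
  have hSq : ∀ d, ⟪S d, d⟫ = ζ * (2 * c * ‖d‖ ^ 2 - (2 * c + b) * ⟪e, d⟫ ^ 2) := by
    intro d
    rw [hSa, real_inner_self_eq_norm_sq]
    ring
  have hS : ∀ a d, ⟪S a, d⟫ = ⟪a, S d⟫ := by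
    intro a d
    rw [real_inner_comm (S d) a, hSa, hSa, real_inner_comm]
    ring
  have hCS : ∀ d : E, ⟪e, d⟫ ^ 2 ≤ ‖d‖ ^ 2 := by
    intro d
    have := abs_real_inner_le_norm e d
    rw [he, one_mul] at this
    rw [← sq_abs]
    gcongr
  have key : ∀ ξ ∈ closedBall (0 : E) R, ∀ η ∈ closedBall (0 : E) R, ∀ z w,
      u ξ + v η - (8 * ζ) / 2 * ‖ξ - z‖ ^ 2 - (8 * ζ) / 2 * ‖η - w‖ ^ 2 ≤
        1 / 2 * ⟪S (z - w), z - w⟫ := by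
    intro ξ hξ η hη z w
    have h1 := hmax ξ hξ η hη
    rw [hSq]
    set D := z - w
    set a := (ξ - z) - (η - w) with ha
    have hd : ξ - η = D + a := by
      simp only [D, a]
      abel
    have h2 : ‖a‖ ^ 2 ≤ 2 * (‖ξ - z‖ ^ 2 + ‖η - w‖ ^ 2) := by
      have := parallelogram_law_with_norm ℝ (ξ - z) (η - w)
      nlinarith [sq_nonneg ‖(ξ - z) + (η - w)‖]
    rw [hd, norm_add_sq_real, inner_add_right] at h1
    have h3 := hCS (D - a)
    rw [norm_sub_sq_real, inner_sub_right] at h3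
    have h4 := hCS a
    have h5 : c * (‖D‖ ^ 2 + 2 * ⟪D, a⟫ + ‖a‖ ^ 2) - (c + 2 * b) * (⟪e, D⟫ + ⟪e, a⟫) ^ 2 ≤
        2 * c * ‖D‖ ^ 2 - (2 * c + b) * ⟪e, D⟫ ^ 2 + 4 * ‖a‖ ^ 2 := by
      have h6 := mul_le_mul_of_nonneg_left h3 hc0
      have h7 : 0 ≤ b * (⟪e, D⟫ + 2 * ⟪e, a⟫) ^ 2 := by positivity
      have h8 : 2 * c * (‖a‖ ^ 2 - ⟪e, a⟫ ^ 2) ≤ 4 * (‖a‖ ^ 2 - ⟪e, a⟫ ^ 2) := by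
        apply mul_le_mul_of_nonneg_right <;> linarith
      have h9 : 2 * b * ⟪e, a⟫ ^ 2 ≤ 4 * ⟪e, a⟫ ^ 2 :=
        mul_le_mul_of_nonneg_right (by linarith) (sq_nonneg _)
      nlinarith
    have h6 := mul_le_mul_of_nonneg_left h5 (by positivity : 0 ≤ ζ / 2)
    have h7 := mul_le_mul_of_nonneg_left h2 (by positivity : 0 ≤ 2 * ζ)
    linarith
  obtain ⟨ξ, η, p, q, X, Y, h1, h2, h3, h4, h5, h6, h7, h8, h9⟩ :=
    exists_jets_of_max hR (by positivity : 0 < 8 * ζ) hu hv hu0 hv0 hS key hε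
  exact ⟨ξ, η, p, q, X, Y, h1, h2, h3, h4, h5, h6, fun h k => by rw [← hSq]; exact h7 h k, h8, h9⟩

/-- A second order upper bound of `u` at `(x₀, t₀)` with gradient `p`, time slope `τ`
and spatial Hessian `A`. -/
def ParabolicJet (u : EucSp N → ℝ → ℝ) (x₀ : EucSp N) (t₀ : ℝ) (p : EucSp N) (τ : ℝ)
    (A : EucSp N →L[ℝ] EucSp N) : Prop :=
  ∃ (b : EucSp N) (c : ℝ), ∀ᶠ z : EucSp N × ℝ in nhds (x₀, t₀),
    u z.1 z.2 ≤ u x₀ t₀ + ⟪p, z.1 - x₀⟫ + τ * (z.2 - t₀) + 1 / 2 * ⟪A (z.1 - x₀), z.1 - x₀⟫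
      + (z.2 - t₀) * ⟪b, z.1 - x₀⟫ + c * (z.2 - t₀) ^ 2

/-- The space-time operator restricted to space. -/
def spaceBlock (X : WithLp 2 (EucSp N × ℝ) →L[ℝ] WithLp 2 (EucSp N × ℝ)) :
    EucSp N →L[ℝ] EucSp N :=
  (ContinuousLinearMap.fst ℝ (EucSp N) ℝ).comp
    ((WithLp.prodContinuousLinearEquiv 2 ℝ (EucSp N) ℝ).toContinuousLinearMap.comp
      (X.comp ((WithLp.prodContinuousLinearEquiv 2 ℝ (EucSp N) ℝ).symm.toContinuousLinearMap.comp
        (ContinuousLinearMap.inl ℝ (EucSp N) ℝ))))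

lemma inner_spaceBlock (X : WithLp 2 (EucSp N × ℝ) →L[ℝ] WithLp 2 (EucSp N × ℝ)) (w : EucSp N) :
    ⟪spaceBlock X w, w⟫ = ⟪X (WithLp.toLp 2 (w, 0)), WithLp.toLp 2 (w, 0)⟫ := by
  rw [WithLp.prod_inner_apply]
  simp [spaceBlock]

lemma exists_inner_prod_expand (X : WithLp 2 (EucSp N × ℝ) →L[ℝ] WithLp 2 (EucSp N × ℝ)) :
    ∃ (b : EucSp N) (c : ℝ), ∀ (w : EucSp N) (s : ℝ),
      ⟪X (WithLp.toLp 2 (w, s)), WithLp.toLp 2 (w, s)⟫ =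
        ⟪spaceBlock X w, w⟫ + s * ⟪b, w⟫ + c * s ^ 2 := by
  set Z : WithLp 2 (EucSp N × ℝ) := WithLp.toLp 2 (0, 1)
  refine ⟨(X Z + X.adjoint Z).fst, ⟪X Z, Z⟫, fun w s => ?_⟩
  have h1 : (WithLp.toLp 2 (w, s) : WithLp 2 (EucSp N × ℝ)) = WithLp.toLp 2 (w, 0) + s • Z := by
    rw [← WithLp.toLp_smul, ← WithLp.toLp_add]
    simp
  have h2 : ⟪(X Z + X.adjoint Z).fst, w⟫ = ⟪X Z + X.adjoint Z, WithLp.toLp 2 (w, 0)⟫ := by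
    rw [WithLp.prod_inner_apply]
    simp
  rw [h1, h2, inner_spaceBlock, map_add, map_smul, inner_add_left, inner_add_right,
    inner_add_right, inner_smul_left, inner_smul_right, inner_smul_left, inner_smul_right,
    inner_add_left, ContinuousLinearMap.adjoint_inner_left, RCLike.conj_to_real,
    real_inner_comm Z]
  ring

lemma parabolicJet_of_prodJet {g : EucSp N → ℝ → ℝ} {x : EucSp N} {t σ : ℝ} (hσ : 0 < σ)
    {ξ p : WithLp 2 (EucSp N × ℝ)} {X : WithLp 2 (EucSp N × ℝ) →L[ℝ] WithLp 2 (EucSp N × ℝ)}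
    {G : ℝ}
    (h : ∀ᶠ z in nhds ξ, g (x + z.fst) (t + σ * z.snd) - G ≤ g (x + ξ.fst) (t + σ * ξ.snd) - G +
      ⟪p, z - ξ⟫ + 1 / 2 * ⟪X (z - ξ), z - ξ⟫) :
    ParabolicJet g (x + ξ.fst) (t + σ * ξ.snd) p.fst (p.snd / σ) (spaceBlock X) := by
  obtain ⟨b, c, hX⟩ := exists_inner_prod_expand X
  refine ⟨(1 / (2 * σ)) • b, c / (2 * σ ^ 2), ?_⟩
  have hcont : Tendsto (fun z : EucSp N × ℝ => (WithLp.toLp 2 (z.1 - x, (z.2 - t) / σ) :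
      WithLp 2 (EucSp N × ℝ))) (nhds (x + ξ.fst, t + σ * ξ.snd)) (nhds ξ) := by
    have hc : Continuous (fun z : EucSp N × ℝ => (WithLp.toLp 2 (z.1 - x, (z.2 - t) / σ) :
      WithLp 2 (EucSp N × ℝ))) := by fun_prop
    have := hc.tendsto (x + ξ.fst, t + σ * ξ.snd)
    convert this using 2
    simp only [add_sub_cancel_left, mul_div_cancel_left₀ _ hσ.ne']
    rfl
  filter_upwards [hcont.eventually h] with z hz
  have e1 : (WithLp.toLp 2 (z.1 - x, (z.2 - t) / σ) - ξ : WithLp 2 (EucSp N × ℝ)) =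
      WithLp.toLp 2 (z.1 - (x + ξ.fst), (z.2 - (t + σ * ξ.snd)) / σ) := by
    have : ξ = WithLp.toLp 2 (ξ.fst, ξ.snd) := rfl
    rw [this, ← WithLp.toLp_sub]
    congr 1
    ext1
    · simp [sub_sub]
    · simp
      field_simp
      ring
  rw [e1, hX, WithLp.prod_inner_apply] at hz
  simp only [inner_smul_left, RCLike.conj_to_real] at hz ⊢
  have e2 : ⟪p.snd, (z.2 - (t + σ * ξ.snd)) / σ⟫ = p.snd / σ * (z.2 - (t + σ * ξ.snd)) := by
    simp
    ring
  have e3 : (z.2 - (t + σ * ξ.snd)) / σ * ⟪b, z.1 - (x + ξ.fst)⟫ = 2 * ((z.2 - (t + σ * ξ.snd)) *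
      (1 / (2 * σ) * ⟪b, z.1 - (x + ξ.fst)⟫)) := by field_simp
  have e4 : c * ((z.2 - (t + σ * ξ.snd)) / σ) ^ 2 = 2 * (c / (2 * σ ^ 2) *
      (z.2 - (t + σ * ξ.snd)) ^ 2) := by field_simp
  have e5 : (WithLp.toLp 2 (z.1 - x, (z.2 - t) / σ) : WithLp 2 (EucSp N × ℝ)).snd
    = (z.2 - t) / σ := rfl
  have e6 : t + σ * ((z.2 - t) / σ) = z.2 := by field_simp; ring
  have e7 : x + (WithLp.toLp 2 (z.1 - x, (z.2 - t) / σ) : WithLp 2 (EucSp N × ℝ)).fst = z.1 :=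
    add_sub_cancel x z.1
  rw [e3, e4] at hz
  simp only [e5, e6, e7] at hz
  change _ ≤ _ + (⟪p.fst, _⟫ + ⟪p.snd, _⟫) + _ at hz
  rw [e2] at hz
  linarith

lemma exists_parabolic_jets {g k : EucSp N → ℝ → ℝ} {x y e : EucSp N} {t s R σ ζ c b : ℝ}
    (hR : 0 < R) (hσ : 0 < σ) (hσ1 : σ ≤ 1) (hζ : 1 ≤ ζ) (hc1 : 1 ≤ c) (hc : c ≤ 2)
    (hb0 : 0 ≤ b) (hb : b ≤ 1) (he : ‖e‖ = 1)
    (hg : ContinuousOn (fun z : EucSp N × ℝ => g z.1 z.2) (closedBall x R ×ˢ closedBall t R))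
    (hk : ContinuousOn (fun z : EucSp N × ℝ => k z.1 z.2) (closedBall y R ×ˢ closedBall s R))
    (hmax : ∀ x' ∈ closedBall x R, ∀ t' ∈ closedBall t R, ∀ y' ∈ closedBall y R,
      ∀ s' ∈ closedBall s R, g x' t' + k y' s' ≤ g x t + k y s +
        ζ / 2 * (c * ‖(x' - x) - (y' - y)‖ ^ 2 - (c + 2 * b) * ⟪e, (x' - x) - (y' - y)⟫ ^ 2) +
        1 / (2 * σ ^ 2) * ((t' - t) - (s' - s)) ^ 2) {ε : ℝ} (hε : 0 < ε) :
    ∃ (x' y' p q : EucSp N) (t' s' ρ κ : ℝ) (X Y : EucSp N →L[ℝ] EucSp N),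
      ‖x' - x‖ < ε ∧ ‖y' - y‖ < ε ∧ |t' - t| < ε ∧ |s' - s| < ε ∧ ‖p‖ < ε ∧ ‖q‖ < ε ∧
      |ρ| < ε ∧ |κ| < ε ∧ ParabolicJet g x' t' p ρ X ∧ ParabolicJet k y' s' q κ Y ∧
      (∀ v w, ⟪X v, v⟫ + ⟪Y w, w⟫ ≤
        ζ * (2 * c * ‖v - w‖ ^ 2 - (2 * c + b) * ⟪e, v - w⟫ ^ 2) + ε * (‖v‖ ^ 2 + ‖w‖ ^ 2)) ∧
      (∀ v, -(8 * ζ * ‖v‖ ^ 2) ≤ ⟪X v, v⟫) ∧ ∀ v, -(8 * ζ * ‖v‖ ^ 2) ≤ ⟪Y v, v⟫ := by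
  have hfst : ∀ z : WithLp 2 (EucSp N × ℝ), ‖z.fst‖ ≤ ‖z‖ := fun z => by
    have := WithLp.prod_norm_sq_eq_of_L2 z
    exact abs_le_of_sq_le_sq' (by nlinarith [sq_nonneg ‖z.snd‖]) (norm_nonneg _) |>.2
  have hsnd : ∀ z : WithLp 2 (EucSp N × ℝ), |z.snd| ≤ ‖z‖ := fun z => by
    have := WithLp.prod_norm_sq_eq_of_L2 z
    exact abs_le_of_sq_le_sq' (by
      rw [Real.norm_eq_abs] at this
      nlinarith [sq_nonneg ‖z.fst‖]) (norm_nonneg _) |>.2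
  have hσsnd : ∀ z : WithLp 2 (EucSp N × ℝ), |σ * z.snd| ≤ ‖z‖ := fun z => by
    rw [abs_mul, abs_of_pos hσ]
    exact (mul_le_of_le_one_left (abs_nonneg _) hσ1).trans (hsnd z)
  have hmem : ∀ z ∈ closedBall (0 : WithLp 2 (EucSp N × ℝ)) R, ∀ (x : EucSp N) (t : ℝ),
      x + z.fst ∈ closedBall x R ∧ t + σ * z.snd ∈ closedBall t R := by
    intro z hz x t
    rw [mem_closedBall_zero_iff] at hz
    refine ⟨?_, ?_⟩
    · rw [mem_closedBall_iff_norm, add_sub_cancel_left]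
      exact (hfst z).trans hz
    · rw [mem_closedBall_iff_norm, add_sub_cancel_left]
      exact (hσsnd z).trans hz
  have hcts : ∀ {g : EucSp N → ℝ → ℝ} {x : EucSp N} {t : ℝ},
      ContinuousOn (fun z : EucSp N × ℝ => g z.1 z.2) (closedBall x R ×ˢ closedBall t R) →
      ContinuousOn (fun z : WithLp 2 (EucSp N × ℝ) => g (x + z.fst) (t + σ * z.snd) - g x t)
        (closedBall 0 R) := by
    intro g x t hg
    refine ContinuousOn.sub ?_ continuousOn_const
    refine hg.comp (f := fun z : WithLp 2 (EucSp N × ℝ) => (x + z.fst, t + σ * z.snd))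
      ?_ fun z hz => ⟨(hmem z hz x t).1, (hmem z hz x t).2⟩
    have h1 : Continuous fun z : WithLp 2 (EucSp N × ℝ) => z.fst :=
      continuous_fst.comp (WithLp.prod_continuous_ofLp 2 _ _)
    have h2 : Continuous fun z : WithLp 2 (EucSp N × ℝ) => z.snd :=
      continuous_snd.comp (WithLp.prod_continuous_ofLp 2 _ _)
    exact ((continuous_const.add h1).prodMk
      (continuous_const.add (continuous_const.mul h2))).continuousOn
  set ê : WithLp 2 (EucSp N × ℝ) := WithLp.toLp 2 (e, 0)
  have hê : ‖ê‖ = 1 := by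
    have := WithLp.prod_norm_sq_eq_of_L2 ê
    have h1 : ê.fst = e := rfl
    have h2 : ê.snd = 0 := rfl
    rw [h1, h2, he] at this
    nlinarith [norm_nonneg ê, norm_zero (E := ℝ)]
  have hie : ∀ z : WithLp 2 (EucSp N × ℝ), ⟪ê, z⟫ = ⟪e, z.fst⟫ := by
    intro z
    rw [WithLp.prod_inner_apply]
    simp [ê]
  obtain ⟨ξ, η, p, q, X, Y, h1, h2, h3, h4, h5, h6, h7, h8, h9⟩ :=
    exists_jets_of_directional_max hR (by linarith : 0 < ζ) (by linarith : 0 ≤ c) hc hb0 hb hê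
      (hcts hg) (hcts hk) (by
        have : ∀ g : EucSp N → ℝ → ℝ, ∀ x t, g (x + (0 : WithLp 2 (EucSp N × ℝ)).fst)
          (t + σ * (0 : WithLp 2 (EucSp N × ℝ)).snd) - g x t = 0 := by simp
        exact this g x t) (by simp) (by
        intro ξ hξ η hη
        have := hmax _ (hmem ξ hξ x t).1 _ (hmem ξ hξ x t).2 _ (hmem η hη y s).1 _ (hmem η hη y s).2
        simp only [add_sub_cancel_left] at this
        rw [hie, WithLp.prod_norm_sq_eq_of_L2, WithLp.sub_fst, WithLp.sub_snd]
        have e1 : 1 / (2 * σ ^ 2) * (σ * ξ.snd - σ * η.snd) ^ 2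
          = 1 / 2 * (ξ.snd - η.snd) ^ 2 := by
          field_simp
        rw [e1] at this
        rw [Real.norm_eq_abs, sq_abs]
        have e2 : 1 ≤ ζ * c := by nlinarith
        have e3 := mul_le_mul_of_nonneg_right e2 (sq_nonneg (ξ.snd - η.snd))
        linarith) (mul_pos hε hσ)
  have hεσ : ε * σ ≤ ε := mul_le_of_le_one_right hε.le hσ1
  have hspace : ∀ w : EucSp N, ‖(WithLp.toLp 2 (w, 0) : WithLp 2 (EucSp N × ℝ))‖ ^ 2 = ‖w‖ ^ 2 := by
    intro w
    rw [WithLp.prod_norm_sq_eq_of_L2]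
    simp
  refine ⟨x + ξ.fst, y + η.fst, p.fst, q.fst, t + σ * ξ.snd, s + σ * η.snd, p.snd / σ, q.snd / σ,
    spaceBlock X, spaceBlock Y, ?_, ?_, ?_, ?_, ?_, ?_, ?_, ?_,
    parabolicJet_of_prodJet hσ h5, parabolicJet_of_prodJet hσ h6, fun v w => ?_, fun v => ?_,
    fun v => ?_⟩
  · rw [add_sub_cancel_left]
    exact ((hfst ξ).trans_lt h1).trans_le hεσ
  · rw [add_sub_cancel_left]
    exact ((hfst η).trans_lt h2).trans_le hεσ
  · rw [add_sub_cancel_left]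
    exact ((hσsnd ξ).trans_lt h1).trans_le hεσ
  · rw [add_sub_cancel_left]
    exact ((hσsnd η).trans_lt h2).trans_le hεσ
  · exact ((hfst p).trans_lt h3).trans_le hεσ
  · exact ((hfst q).trans_lt h4).trans_le hεσ
  · rw [abs_div, abs_of_pos hσ, div_lt_iff₀ hσ]
    exact (hsnd p).trans_lt h3
  · rw [abs_div, abs_of_pos hσ, div_lt_iff₀ hσ]
    exact (hsnd q).trans_lt h4
  · have := h7 (WithLp.toLp 2 (v, 0)) (WithLp.toLp 2 (w, 0))
    have e1 : (WithLp.toLp 2 (v, 0) - WithLp.toLp 2 (w, 0) : WithLp 2 (EucSp N × ℝ))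
      = WithLp.toLp 2 (v - w, 0) := by
      rw [← WithLp.toLp_sub]
      simp
    rw [← inner_spaceBlock, ← inner_spaceBlock, e1, hspace, hspace, hspace, hie] at this
    have e2 := mul_le_mul_of_nonneg_right hεσ (by positivity : 0 ≤ ‖v‖ ^ 2 + ‖w‖ ^ 2)
    exact this.trans (add_le_add le_rfl e2)
  · have := h8 (WithLp.toLp 2 (v, 0))
    rwa [hspace, ← inner_spaceBlock] at this
  · have := h9 (WithLp.toLp 2 (v, 0))
    rwa [hspace, ← inner_spaceBlock] at this

end ParabolicJets

section OperatorDifference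

variable {α a A : ℝ} {F : EucSp N → EucSp N → MatN N → ℝ}

lemma ParabolicJet.add_quadratic {u : EucSp N → ℝ → ℝ} {x x₀ y p v : EucSp N}
    {t t₀ s L μ τ : ℝ} {X : EucSp N →L[ℝ] EucSp N}
    (h : ParabolicJet (fun x t => u x t - L * ‖x - x₀‖ ^ 2 - L * (t - t₀) ^ 2 - ⟪v, x - y⟫
      - μ * (t - s)) x t p τ X) :
    ParabolicJet u x t (p + v + (2 * L) • (x - x₀)) (τ + μ + 2 * L * (t - t₀))
      (X + (2 * L) • ContinuousLinearMap.id ℝ (EucSp N)) := by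
  obtain ⟨b, c, h⟩ := h
  refine ⟨b, c + L, ?_⟩
  filter_upwards [h] with z hz
  have e1 : ‖z.1 - x₀‖ ^ 2 = ‖x - x₀‖ ^ 2 + 2 * ⟪x - x₀, z.1 - x⟫ + ‖z.1 - x‖ ^ 2 := by
    rw [← norm_add_sq_real]
    congr 2
    abel
  have e2 : ⟪v, z.1 - y⟫ = ⟪v, z.1 - x⟫ + ⟪v, x - y⟫ := by
    rw [← inner_add_right]
    congr 1
    abel
  rw [e1, e2] at hz
  rw [inner_add_smul_apply, inner_add_left, inner_add_left, inner_smul_left, RCLike.conj_to_real,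
    ContinuousLinearMap.id_apply, real_inner_self_eq_norm_sq]
  linarith

lemma F_add_smul_id_le (hF2 : H2 univ F α a A) (x : EucSp N) {p : EucSp N} (hp : p ≠ 0)
    {M : MatN N} (hM : M.IsSymm) {c : ℝ} (hc : 0 ≤ c) :
    F x p (M + c • 1) ≤ F x p M + A * ‖p‖ ^ α * (c * N) ∧ F x p M ≤ F x p (M + c • 1) := by
  have h1 : (c • (1 : MatN N)).PosSemidef := Matrix.PosSemidef.one.smul hc
  have h2 := hF2.2.2 x (mem_univ _) p hp M (c • 1) hM (Matrix.isSymm_one.smul c) h1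
  have h3 : (c • (1 : MatN N)).trace = c * N := by simp [Matrix.trace_smul]
  rw [h3] at h2
  refine ⟨by linarith [h2.2], ?_⟩
  have : 0 ≤ a * ‖p‖ ^ α * (c * N) := by
    have := hF2.1
    positivity
  linarith [h2.1]

lemma F_sub_le_of_directional (hF1 : H1 univ F α) (hF2 : H2 univ F α a A) {ω : ℝ → ℝ} (hω : IsModulusFor F ω)
    {x y e : EucSp N} (hxy : x ≠ y) (he : ‖e‖ = 1) {ζ c b : ℝ} (hζ : 0 < ζ) (hc0 : 0 ≤ c)
    (hc : c ≤ 2) (hb : 0 ≤ b) {X Y : EucSp N →L[ℝ] EucSp N}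
    (hX : ∀ w, -(10 * ζ * ‖w‖ ^ 2) ≤ ⟪X w, w⟫) (hY : ∀ w, -(10 * ζ * ‖w‖ ^ 2) ≤ ⟪Y w, w⟫)
    (hXY : ∀ v w, ⟪X v, v⟫ + ⟪Y w, w⟫ ≤
      ζ * (2 * c * ‖v - w‖ ^ 2 - (2 * c + b) * ⟪e, v - w⟫ ^ 2)) :
    F x (ζ • (x - y)) (symMat X) - F y (ζ • (x - y)) (-symMat Y) ≤
      (1 / 10) ^ α * ω (10 * ζ * ‖x - y‖ ^ 2) - 2 * a * b * ζ * ‖ζ • (x - y)‖ ^ α := by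
  set p := ζ • (x - y) with hpdef
  have hxy' : x - y ≠ 0 := sub_ne_zero.2 hxy
  have hp : p ≠ 0 := smul_ne_zero hζ.ne' hxy'
  set Z : EucSp N →L[ℝ] EucSp N := (-1 : ℝ) • X + (-1 : ℝ) • Y with hZ
  have hZq : ∀ w, ⟪Z w, w⟫ = -⟪X w, w⟫ - ⟪Y w, w⟫ := by
    intro w
    rw [hZ, inner_add_smul_apply, smul_apply, inner_smul_left, RCLike.conj_to_real]
    ring
  have hZ0 : ∀ w, 0 ≤ ⟪Z w, w⟫ := by
    intro w
    have := hXY w w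
    rw [sub_self] at this
    rw [hZq]
    simp only [norm_zero, inner_zero_right] at this
    nlinarith
  have htr : 4 * b * ζ ≤ (symMat Z).trace := by
    have h1 := inner_le_trace_symMat hZ0 e
    have h2 := hXY e (-e)
    rw [hZq, he] at h1
    have h3 : e - -e = (2 : ℝ) • e := by rw [two_smul, sub_neg_eq_add]
    rw [h3, norm_smul, inner_smul_right, real_inner_self_eq_norm_sq, he, map_neg, inner_neg_neg]
      at h2
    norm_num at h1 h2
    nlinarith
  set X' : EucSp N →L[ℝ] EucSp N := X + (1 / 2 : ℝ) • Z with hX'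
  have hX'q : ∀ w, ⟪X' w, w⟫ = 1 / 2 * (⟪X w, w⟫ - ⟪Y w, w⟫) := by
    intro w
    rw [hX', inner_add_smul_apply, hZq]
    ring
  have hYub : ∀ w, ⟪Y w, w⟫ ≤ 10 * ζ * ‖w‖ ^ 2 := by
    intro w
    linarith [hX w, hZ0 w, hZq w]
  have hX'lb : ∀ w, -(10 * ζ * ‖w‖ ^ 2) ≤ ⟪X' w, w⟫ := by
    intro w
    rw [hX'q]
    linarith [hX w, hYub w]
  have hsum : ∀ v w, ⟪X' v, v⟫ + ⟪Y w, w⟫ ≤ 4 * (10 * ζ) * ‖v - w‖ ^ 2 := by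
    intro v w
    have h1 := hXY v (v - (2 : ℝ) • (v - w))
    have h2 : v - (v - (2 : ℝ) • (v - w)) = (2 : ℝ) • (v - w) := by abel
    have h3 : w = v - (v - w) := by abel
    set d := v - w with hd
    have h4 : ⟪Y (v - (2 : ℝ) • d), v - (2 : ℝ) • d⟫
        = 2 * ⟪Y (v - d), v - d⟫ - ⟪Y v, v⟫ + 2 * ⟪Y d, d⟫ := by
      simp only [map_sub, map_smul, inner_sub_left, inner_sub_right, inner_smul_left,
        inner_smul_right, RCLike.conj_to_real]
      ring
    rw [h2, h4, ← h3, norm_smul, inner_smul_right] at h1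
    rw [hX'q]
    have h5 := hY d
    have h6 : 0 ≤ ζ * ((2 * c + b) * ⟪e, d⟫ ^ 2) := by positivity
    have h7 : ζ * c * ‖d‖ ^ 2 ≤ ζ * 2 * ‖d‖ ^ 2 := by gcongr
    have h8 : 0 ≤ ζ * ‖d‖ ^ 2 := by positivity
    norm_num at h1
    nlinarith
  have h3 := h3_of_forms hω (by positivity : 0 < 10 * ζ) hX'lb hY hsum hxy
  have hpe : p = (1 / 10 : ℝ) • ((10 * ζ) • (x - y)) := by
    rw [hpdef, smul_smul]
    congr 1
    ring
  have hp' : (10 * ζ) • (x - y) ≠ 0 := smul_ne_zero (by positivity) hxy'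
  have hsc : ∀ (z : EucSp N) (M : MatN N), M.IsSymm →
      F z p M = (1 / 10) ^ α * F z ((10 * ζ) • (x - y)) M := by
    intro z M hM
    have := hF1 z (mem_univ _) _ hp' M hM (1 / 10) (by norm_num) 1 zero_le_one
    rw [one_smul, mul_one, ← hpe, abs_of_pos (by norm_num)] at this
    exact this
  have h4 : F x p (symMat X') - F y p (-symMat Y) ≤ (1 / 10) ^ α * ω (10 * ζ * ‖x - y‖ ^ 2) := by
    rw [hsc _ _ (symMat_isSymm _), hsc _ _ (symMat_isSymm _).neg, ← mul_sub]
    gcongr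
  have h5 : symMat X' = symMat X + symMat ((1 / 2 : ℝ) • Z) := by rw [hX', symMat_add]
  have h6 := (hF2.2.2 x (mem_univ _) p hp (symMat X) (symMat ((1 / 2 : ℝ) • Z)) (symMat_isSymm _)
    (symMat_isSymm _) (symMat_posSemidef fun w => by
      rw [smul_apply, inner_smul_left]
      have := hZ0 w
      simp only [RCLike.conj_to_real]
      positivity)).1
  rw [← h5, symMat_smul, Matrix.trace_smul, smul_eq_mul] at h6
  have h7 : a * ‖p‖ ^ α * (1 / 2 * (4 * b * ζ)) ≤ a * ‖p‖ ^ α * (1 / 2 * (symMat Z).trace) := by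
    have := hF2.1
    gcongr
  linarith

lemma F_jets_sub_le (hF1 : H1 univ F α) (hF2 : H2 univ F α a A) {ω : ℝ → ℝ} (hω : IsModulusFor F ω)
    {C : ℝ} (hC : 0 < C) (hF6 : IsGradLipschitz F α C)
    {x y e : EucSp N} (hxy : x ≠ y) (he : ‖e‖ = 1) {ζ c b L ε K : ℝ} (hζ : 1 ≤ ζ) (hc0 : 0 ≤ c)
    (hc : c ≤ 2) (hb : 0 ≤ b) (hL : 0 ≤ L) (hε : 0 < ε) (hε1 : ε ≤ 1)
    {X Y : EucSp N →L[ℝ] EucSp N}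
    (hX : ∀ w, -(8 * ζ * ‖w‖ ^ 2) ≤ ⟪X w, w⟫) (hY : ∀ w, -(8 * ζ * ‖w‖ ^ 2) ≤ ⟪Y w, w⟫)
    (hXY : ∀ v w, ⟪X v, v⟫ + ⟪Y w, w⟫ ≤
      ζ * (2 * c * ‖v - w‖ ^ 2 - (2 * c + b) * ⟪e, v - w⟫ ^ 2) + ε * (‖v‖ ^ 2 + ‖w‖ ^ 2))
    {q q' : EucSp N} (hq : ‖q‖ ≤ K) (hq' : ‖q'‖ ≤ K) (hK : K < ‖ζ • (x - y)‖ / 2) :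
    F x (ζ • (x - y) + q) (symMat (X + L • ContinuousLinearMap.id ℝ (EucSp N)))
      - F y (ζ • (x - y) + q') (-symMat Y) ≤
      (1 / 10) ^ α * ω (10 * ζ * ‖x - y‖ ^ 2) - 2 * a * b * ζ * ‖ζ • (x - y)‖ ^ α
        + A * (L + 2) * N * ‖ζ • (x - y)‖ ^ α
        + 6 * C * N * K * (8 * ζ + L) * ‖ζ • (x - y)‖ ^ (α - 1) := by
  set p := ζ • (x - y) with hpdef
  have hζ0 : 0 < ζ := by linarith
  have hp : p ≠ 0 := smul_ne_zero hζ0.ne' (sub_ne_zero.2 hxy)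
  have hA : 0 < A := hF2.1.trans_le hF2.2.1
  have hK0 : 0 ≤ K := (norm_nonneg _).trans hq
  have hnonneg : ∀ w : EucSp N, 0 ≤ ‖w‖ ^ 2 := fun w => by positivity
  have hXub : ∀ w, ⟪X w, w⟫ ≤ 5 * ζ * ‖w‖ ^ 2 := by
    intro w
    have := hXY w 0
    simp only [map_zero, inner_zero_right, sub_zero, norm_zero] at this
    have h1 : 0 ≤ ζ * ((2 * c + b) * ⟪e, w⟫ ^ 2) := by positivity
    have h2 : ζ * c * ‖w‖ ^ 2 ≤ ζ * 2 * ‖w‖ ^ 2 := by gcongr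
    have h3 : ε * ‖w‖ ^ 2 ≤ ζ * ‖w‖ ^ 2 := by
      gcongr
      linarith
    linarith
  have hYub : ∀ w, ⟪Y w, w⟫ ≤ 5 * ζ * ‖w‖ ^ 2 := by
    intro w
    have := hXY 0 w
    simp only [map_zero, inner_zero_right, zero_sub, norm_neg, inner_neg_right, norm_zero] at this
    have h1 : 0 ≤ ζ * ((2 * c + b) * ⟪e, w⟫ ^ 2) := by positivity
    have h2 : ζ * c * ‖w‖ ^ 2 ≤ ζ * 2 * ‖w‖ ^ 2 := by gcongr
    have h3 : ε * ‖w‖ ^ 2 ≤ ζ * ‖w‖ ^ 2 := by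
      gcongr
      linarith
    linarith
  set I := ContinuousLinearMap.id ℝ (EucSp N)
  have hIq : ∀ w, ⟪I w, w⟫ = ‖w‖ ^ 2 := fun w => real_inner_self_eq_norm_sq w
  have hfX : frobNorm (symMat (X + L • I)) ≤ 3 * (8 * ζ + L) * N := by
    refine frobNorm_symMat_le (by positivity) fun w => ?_
    rw [inner_add_smul_apply, hIq, abs_le]
    have h1 : 0 ≤ L * ‖w‖ ^ 2 := by positivity
    have h2 : 0 ≤ ζ * ‖w‖ ^ 2 := by positivity
    constructor <;> linarith [hX w, hXub w]
  have hfY : frobNorm (-symMat Y) ≤ 3 * (8 * ζ + L) * N := by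
    rw [← symMat_neg]
    refine frobNorm_symMat_le (by positivity) fun w => ?_
    rw [neg_apply, inner_neg_left, abs_neg, abs_le]
    have h1 : 0 ≤ L * ‖w‖ ^ 2 := by positivity
    have h2 : 0 ≤ ζ * ‖w‖ ^ 2 := by positivity
    constructor <;> linarith [hY w, hYub w]
  have hpert : ∀ z : EucSp N, ∀ r : EucSp N, ‖r‖ ≤ K → ∀ M : MatN N, M.IsSymm →
      frobNorm M ≤ 3 * (8 * ζ + L) * N →
      |F z (p + r) M - F z p M| ≤ 3 * C * N * K * (8 * ζ + L) * ‖p‖ ^ (α - 1) := by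
    intro z r hr M hM hfM
    refine (hF6 z p hp r (hr.trans_lt hK) M hM).trans ?_
    calc C * ‖p‖ ^ (α - 1) * ‖r‖ * frobNorm M
        ≤ C * ‖p‖ ^ (α - 1) * K * (3 * (8 * ζ + L) * N) := by
          gcongr
          exact Real.sqrt_nonneg _
      _ = _ := by ring
  have h1 := (abs_le.1 (hpert x q hq _ (symMat_isSymm _) hfX)).2
  have h2 := (abs_le.1 (hpert y q' hq' _ (symMat_isSymm _).neg hfY)).1
  have h3 := F_sub_le_of_directional hF1 hF2 hω hxy he hζ0 hc0 hc hb
    (X := X + (-ε) • I) (Y := Y + (-ε) • I) (fun w => by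
      rw [inner_add_smul_apply, hIq]
      have h3 : ε * ‖w‖ ^ 2 ≤ ζ * ‖w‖ ^ 2 := by
        gcongr
        linarith
      have h2 : 0 ≤ ζ * ‖w‖ ^ 2 := by positivity
      linarith [hX w]) (fun w => by
      rw [inner_add_smul_apply, hIq]
      have h3 : ε * ‖w‖ ^ 2 ≤ ζ * ‖w‖ ^ 2 := by
        gcongr
        linarith
      have h2 : 0 ≤ ζ * ‖w‖ ^ 2 := by positivity
      linarith [hY w]) (fun v w => by
      rw [inner_add_smul_apply, inner_add_smul_apply, hIq, hIq]
      linarith [hXY v w])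
  rw [← hpdef] at h3
  have h4 := (F_add_smul_id_le hF2 x hp (symMat_isSymm (X + (-ε) • I))
    (by positivity : 0 ≤ L + ε)).1
  have e4 : symMat (X + (-ε) • I) + (L + ε) • 1 = symMat (X + L • I) := by
    rw [symMat_add, symMat_add, symMat_smul, symMat_smul, symMat_id, add_assoc, ← add_smul]
    congr 2
    ring
  rw [e4] at h4
  have h5 := (F_add_smul_id_le hF2 y hp (symMat_isSymm Y).neg hε.le).1
  have e5 : -symMat Y + ε • 1 = -symMat (Y + (-ε) • I) := by
    rw [symMat_add, symMat_smul, symMat_id, neg_add, neg_smul, neg_neg]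
  rw [e5] at h5
  have h6 : A * ‖p‖ ^ α * ((L + ε) * N) + A * ‖p‖ ^ α * (ε * N) ≤ A * (L + 2) * N * ‖p‖ ^ α := by
    have : A * ‖p‖ ^ α * N * (L + 2 * ε) ≤ A * ‖p‖ ^ α * N * (L + 2) := by
      gcongr
      linarith
    linarith
  linarith

end OperatorDifference

section PowerExpansion

lemma eventually_rpow_le_quadratic {β κ : ℝ} (h : β * (β - 1) / 2 < κ) :
    ∀ᶠ s in nhds (1 : ℝ), s ^ β ≤ 1 + β * (s - 1) + κ * (s - 1) ^ 2 := by
  set f : ℝ → ℝ := fun s => 1 + β * (s - 1) + κ * (s - 1) ^ 2 - s ^ β with hf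
  have hd : ∀ s : ℝ, 0 < s → HasDerivAt f (β + κ * (2 * (s - 1)) - β * s ^ (β - 1)) s := by
    intro s hs
    have h1 : HasDerivAt (fun s : ℝ => s - 1) 1 s := (hasDerivAt_id s).sub_const 1
    have h2 := Real.hasDerivAt_rpow_const (x := s) (p := β) (Or.inl hs.ne')
    have h3 := (((h1.const_mul β).const_add 1).add ((h1.pow 2).const_mul κ)).sub h2
    refine h3.congr_deriv ?_
    norm_num
  have hd' : HasDerivAt (deriv f) (κ * 2 - β * (β - 1)) 1 := by
    have h1 : HasDerivAt (fun s : ℝ => s - 1) 1 1 := (hasDerivAt_id (1 : ℝ)).sub_const 1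
    have h2 := Real.hasDerivAt_rpow_const (x := (1 : ℝ)) (p := β - 1) (Or.inl one_ne_zero)
    have h3 := (((h1.const_mul 2).const_mul κ).const_add β).sub (h2.const_mul β)
    have h4 : deriv f =ᶠ[nhds 1] fun s => β + κ * (2 * (s - 1)) - β * s ^ (β - 1) := by
      filter_upwards [lt_mem_nhds (zero_lt_one' ℝ)] with s hs using (hd s hs).deriv
    refine (h3.congr_of_eventuallyEq ?_).congr_deriv ?_
    · exact h4
    · simp
  have hmin : IsLocalMin f 1 := by
    refine isLocalMin_of_deriv_deriv_pos ?_ ?_ (hd 1 one_pos).continuousAt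
    · rw [hd'.deriv]
      linarith
    · rw [(hd 1 one_pos).deriv]
      simp
  filter_upwards [hmin] with s hs
  simp only [hf, sub_self, mul_zero, add_zero, Real.one_rpow] at hs
  norm_num at hs
  linarith

lemma eventually_norm_add_rpow_le {β κ : ℝ} (h : β * (β - 1) / 2 < κ) {x : EucSp N} (hx : x ≠ 0) :
    ∀ᶠ k in nhds (0 : EucSp N), ‖x + k‖ ^ (2 * β) ≤ ‖x‖ ^ (2 * β) *
      (1 + β * (2 * ⟪x, k⟫ / ‖x‖ ^ 2 + ‖k‖ ^ 2 / ‖x‖ ^ 2) +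
        κ * (2 * ⟪x, k⟫ / ‖x‖ ^ 2 + ‖k‖ ^ 2 / ‖x‖ ^ 2) ^ 2) := by
  have hr : 0 < ‖x‖ := norm_pos_iff.2 hx
  have hc : Tendsto (fun k : EucSp N => ‖x + k‖ ^ 2 / ‖x‖ ^ 2) (nhds 0) (nhds 1) := by
    have : Continuous (fun k : EucSp N => ‖x + k‖ ^ 2 / ‖x‖ ^ 2) := by fun_prop
    have h1 := this.tendsto 0
    rwa [add_zero, div_self (by positivity)] at h1
  filter_upwards [hc.eventually (eventually_rpow_le_quadratic h)] with k hk
  have e1 : ‖x + k‖ ^ 2 / ‖x‖ ^ 2 - 1 = 2 * ⟪x, k⟫ / ‖x‖ ^ 2 + ‖k‖ ^ 2 / ‖x‖ ^ 2 := by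
    rw [norm_add_sq_real]
    field_simp
    ring
  rw [e1, Real.div_rpow (by positivity) (by positivity), div_le_iff₀ (by positivity)] at hk
  have e2 : ∀ z : EucSp N, (‖z‖ ^ 2) ^ β = ‖z‖ ^ (2 * β) := fun z => by
    rw [← Real.rpow_natCast, ← Real.rpow_mul (norm_nonneg _)]
    norm_num
  rw [e2, e2] at hk
  linarith

lemma eventually_holder_norm_le {γ M : ℝ} (hγ0 : 0 < γ) (hγ1 : γ < 1) (hM : 0 ≤ M)
    {x : EucSp N} (hx : x ≠ 0) :
    ∀ᶠ k in nhds (0 : EucSp N), M * ‖x + k‖ ^ γ ≤ M * ‖x‖ ^ γ +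
      M * γ * ‖x‖ ^ (γ - 2) * ⟪x, k⟫ + M * γ * ‖x‖ ^ (γ - 2) / 2 *
        ((1 + (1 - γ) / 4) * ‖k‖ ^ 2 -
          ((1 + (1 - γ) / 4) + 2 * ((1 - γ) / 8)) * ⟪‖x‖⁻¹ • x, k⟫ ^ 2) := by
  have hr : 0 < ‖x‖ := norm_pos_iff.2 hx
  have h1 := eventually_norm_add_rpow_le (β := γ / 2) (κ := -(γ * (3 - γ) / 16))
    (by nlinarith) hx
  have h2 : ∀ᶠ k in nhds (0 : EucSp N), ‖k‖ < ‖x‖ * ((1 - γ) / 6) := by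
    have := continuous_norm.tendsto (0 : EucSp N)
    rw [norm_zero] at this
    exact this.eventually (gt_mem_nhds (mul_pos hr (by linarith)))
  filter_upwards [h1, h2] with k hk hk2
  rw [mul_div_cancel₀ γ (two_ne_zero' ℝ)] at hk
  have e1 : ‖x‖ ^ (γ - 2) = ‖x‖ ^ γ / ‖x‖ ^ 2 := by
    rw [Real.rpow_sub hr]
    norm_num
  rw [e1, inner_smul_left, RCLike.conj_to_real]
  set r := ‖x‖
  set w := ⟪x, k⟫ / r ^ 2 with hw
  set v := ‖k‖ ^ 2 / r ^ 2 with hv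
  have e2 : M * γ * (r ^ γ / r ^ 2) * ⟪x, k⟫ = M * r ^ γ * (γ * w) := by
    rw [hw]
    field_simp
  have e3 : M * γ * (r ^ γ / r ^ 2) / 2 * ((1 + (1 - γ) / 4) * ‖k‖ ^ 2 -
          ((1 + (1 - γ) / 4) + 2 * ((1 - γ) / 8)) * (r⁻¹ * ⟪x, k⟫) ^ 2) =
      M * r ^ γ * (γ / 2 * ((1 + (1 - γ) / 4) * v - (3 - γ) / 2 * w ^ 2)) := by
    rw [hw, hv]
    field_simp
    ring
  have e4 : 2 * ⟪x, k⟫ / r ^ 2 = 2 * w := by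
    rw [hw]
    ring
  rw [e2, e3]
  rw [e4] at hk
  have hw2 : |w| ≤ (1 - γ) / 6 := by
    rw [hw, abs_div, abs_of_pos (by positivity : 0 < r ^ 2), div_le_iff₀ (by positivity)]
    calc |⟪x, k⟫| ≤ r * ‖k‖ := abs_real_inner_le_norm _ _
      _ ≤ r * (r * ((1 - γ) / 6)) := by gcongr
      _ = _ := by ring
  have hv0 : 0 ≤ v := by positivity
  have h3 : 1 + γ / 2 * (2 * w + v) + -(γ * (3 - γ) / 16) * (2 * w + v) ^ 2 ≤
      1 + γ * w + γ / 2 * ((1 + (1 - γ) / 4) * v - (3 - γ) / 2 * w ^ 2) := by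
    have h4 : 0 ≤ γ * (3 - γ) / 16 := by
      have : 0 < 3 - γ := by linarith
      positivity
    have h5 := mul_nonneg h4 (sq_nonneg v)
    have h6 := (abs_le.1 hw2).1
    have h7 : -(4 * (γ * (3 - γ) / 16) * w * v) ≤ γ / 2 * ((1 - γ) / 4) * v := by
      have h8 : -(4 * (γ * (3 - γ) / 16) * w) ≤ γ / 2 * ((1 - γ) / 4) := by
        have h9 := mul_le_mul_of_nonneg_left h6 h4
        have h10 : 0 ≤ γ * (1 - γ) * γ := by
          have : 0 < 1 - γ := by linarith
          positivity
        nlinarith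
      have := mul_le_mul_of_nonneg_right h8 hv0
      linarith
    nlinarith
  have h4 := mul_le_mul_of_nonneg_left (hk.trans (mul_le_mul_of_nonneg_left h3 (by positivity))) hM
  linarith

lemma eventually_norm_sub_rpow_le {m : ℝ} (hm : 2 ≤ m) {x z : EucSp N} (hx : x ≠ z) :
    ∀ᶠ y in nhds x, ‖y - z‖ ^ m ≤ ‖x - z‖ ^ m + m * ‖x - z‖ ^ (m - 2) * ⟪x - z, y - x⟫ +
      3 * m ^ 2 * ‖x - z‖ ^ (m - 2) * ‖y - x‖ ^ 2 := by
  have hx' : x - z ≠ 0 := sub_ne_zero.2 hx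
  have hr : 0 < ‖x - z‖ := norm_pos_iff.2 hx'
  have h1 := eventually_norm_add_rpow_le (β := m / 2) (κ := m ^ 2 / 4) (by nlinarith) hx'
  have h2 : ∀ᶠ k in nhds (0 : EucSp N), ‖k‖ < ‖x - z‖ := by
    have := continuous_norm.tendsto (0 : EucSp N)
    rw [norm_zero] at this
    exact this.eventually (gt_mem_nhds hr)
  have h3 : Tendsto (fun y : EucSp N => y - x) (nhds x) (nhds 0) := by
    have : Continuous (fun y : EucSp N => y - x) := by fun_prop
    simpa using this.tendsto x
  filter_upwards [h3.eventually h1, h3.eventually h2] with y hk hk2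
  have e0 : x - z + (y - x) = y - z := by abel
  have e1 : ‖x - z‖ ^ (m - 2) = ‖x - z‖ ^ m / ‖x - z‖ ^ 2 := by
    rw [Real.rpow_sub hr]
    norm_num
  rw [mul_div_cancel₀ m (two_ne_zero' ℝ), e0] at hk
  rw [e1]
  set k := y - x
  set r := ‖x - z‖
  set w := ⟪x - z, k⟫ / r ^ 2 with hw
  set v := ‖k‖ ^ 2 / r ^ 2 with hv
  have e2 : m * (r ^ m / r ^ 2) * ⟪x - z, k⟫ = r ^ m * (m * w) := by
    rw [hw]
    field_simp
  have e3 : 3 * m ^ 2 * (r ^ m / r ^ 2) * ‖k‖ ^ 2 = r ^ m * (3 * m ^ 2 * v) := by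
    rw [hv]
    field_simp
  have e4 : 2 * ⟪x - z, k⟫ / r ^ 2 = 2 * w := by
    rw [hw]
    ring
  rw [e2, e3]
  rw [e4] at hk
  have hv0 : 0 ≤ v := by positivity
  have hv1 : v ≤ 1 := by
    rw [hv, div_le_one (by positivity)]
    gcongr
  have hw2 : w ^ 2 ≤ v := by
    have h5 := abs_real_inner_le_norm (x - z) k
    have h6 : ⟪x - z, k⟫ ^ 2 ≤ (r * ‖k‖) ^ 2 := by
      rw [← sq_abs]
      gcongr
    rw [hw, hv, div_pow, div_le_div_iff₀ (by positivity) (by positivity)]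
    nlinarith [sq_nonneg r]
  have h4 : 1 + m / 2 * (2 * w + v) + m ^ 2 / 4 * (2 * w + v) ^ 2 ≤ 1 + m * w + 3 * m ^ 2 * v := by
    have h5 : (2 * w + v) ^ 2 ≤ 9 * v := by
      nlinarith [sq_nonneg (w - v)]
    have h6 := mul_le_mul_of_nonneg_left h5 (by positivity : 0 ≤ m ^ 2 / 4)
    have h7 : m / 2 * v ≤ m ^ 2 / 4 * v :=
      mul_le_mul_of_nonneg_right (by nlinarith) hv0
    have h8 : 0 ≤ m ^ 2 * v := by positivity
    nlinarith
  have := hk.trans (mul_le_mul_of_nonneg_left h4 (by positivity))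
  linarith

end PowerExpansion

section SpaceDoubling

variable {T α a A : ℝ} {F : EucSp N → EucSp N → MatN N → ℝ} {h : EucSp N → ℝ → EucSp N}
  {f u : EucSp N → ℝ → ℝ}

/-- The operator satisfied by `-u` when `u` solves the equation for `F`. -/
def dualOp (F : EucSp N → EucSp N → MatN N → ℝ) (x p : EucSp N) (X : MatN N) : ℝ := -F x (-p) (-X)

lemma abs_gradTerm_le {Ch : ℝ} (hα : -1 < α) {x p : EucSp N} {t : ℝ} (hh : ‖h x t‖ ≤ Ch)
    (hp : p ≠ 0) {P : ℝ} (hP : ‖p‖ ≤ P) : |gradTerm h α x t p| ≤ Ch * P ^ (1 + α) := by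
  have hp0 : 0 < ‖p‖ := norm_pos_iff.2 hp
  have hCh : 0 ≤ Ch := (norm_nonneg _).trans hh
  rw [gradTerm, abs_mul, abs_of_nonneg (by positivity : 0 ≤ ‖p‖ ^ α)]
  calc |⟪h x t, p⟫| * ‖p‖ ^ α ≤ (Ch * ‖p‖) * ‖p‖ ^ α := by
        gcongr
        exact (abs_real_inner_le_norm _ _).trans (by gcongr)
    _ = Ch * ‖p‖ ^ (1 + α) := by rw [Real.rpow_add hp0, Real.rpow_one, mul_assoc]
    _ ≤ Ch * P ^ (1 + α) := by
        gcongr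
        linarith

set_option maxHeartbeats 800000 in
lemma doubling_inequality (hα : -1 < α) (hF1 : H1 univ F α) (hF2 : H2 univ F α a A) {ω : ℝ → ℝ}
    (hω : IsModulusFor F ω) {C : ℝ} (hC : 0 < C) (hF6 : IsGradLipschitz F α C) {Ch Mf : ℝ}
    (hCh : ∀ x, ∀ t ∈ Ioo (0 : ℝ) T, ‖h x t‖ ≤ Ch) (hMf : ∀ x, ∀ t ∈ Ioo (0 : ℝ) T, |f x t| ≤ Mf)
    (hu : ContinuousOn (fun p : EucSp N × ℝ => u p.1 p.2) (univ ×ˢ Ioo 0 T))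
    (hsub : HasSubJets T F h α f u)
    (hsup : HasSubJets T (dualOp F) h α (fun x t => -f x t) (fun x t => -u x t))
    {γ M L σ R t₀ t s : ℝ} (hγ0 : 0 < γ) (hγ1 : γ < 1) (hM : 0 ≤ M) (hL : 0 ≤ L)
    (hσ : 0 < σ) (hσ1 : σ ≤ 1) (hR : 0 < R) {x₀ x y : EucSp N} (hxy : x ≠ y)
    (hζ : 1 ≤ M * γ * ‖x - y‖ ^ (γ - 2))
    (hK : 4 * L + 2 < M * γ * ‖x - y‖ ^ (γ - 2) * ‖x - y‖ / 4)
    (hxx₀ : ‖x - x₀‖ ≤ 1) (htt₀ : |t - t₀| ≤ 1) (ht : closedBall t R ⊆ Ioo 0 T)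
    (hs : closedBall s R ⊆ Ioo 0 T)
    (hmax : ∀ x' ∈ closedBall x R, ∀ t' ∈ closedBall t R, ∀ y' ∈ closedBall y R,
      ∀ s' ∈ closedBall s R,
      u x' t' - u y' s' - M * ‖x' - y'‖ ^ γ - L * ‖x' - x₀‖ ^ 2 - L * (t' - t₀) ^ 2
        - 1 / (2 * σ ^ 2) * (t' - s') ^ 2 ≤
      u x t - u y s - M * ‖x - y‖ ^ γ - L * ‖x - x₀‖ ^ 2 - L * (t - t₀) ^ 2
        - 1 / (2 * σ ^ 2) * (t - s) ^ 2) :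
    ∃ r, ‖x - y‖ / 2 ≤ r ∧ r ≤ 2 * ‖x - y‖ ∧ ∀ ζ P, ζ = M * γ * ‖x - y‖ ^ (γ - 2) → P = ζ * r →
      -(2 + 4 * L + 2 * Mf) ≤ 2 * Ch * (2 * P) ^ (1 + α) + (1 / 10) ^ α * ω (10 * ζ * r ^ 2)
        - 2 * a * ((1 - γ) / 8) * ζ * P ^ α + A * (2 * L + 2) * N * P ^ α
        + 6 * C * N * (4 * L + 2) * (8 * ζ + 2 * L) * P ^ (α - 1) := by
  have hxy' : x - y ≠ 0 := sub_ne_zero.2 hxy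
  set r₀ := ‖x - y‖ with hr₀
  have hr₀0 : 0 < r₀ := norm_pos_iff.2 hxy'
  set ζ := M * γ * r₀ ^ (γ - 2) with hζdef
  have hζ0 : 0 < ζ := by linarith
  obtain ⟨δ, hδ, hδball⟩ := Metric.eventually_nhds_iff_ball.1
    (eventually_holder_norm_le hγ0 hγ1 hM hxy')
  set e : EucSp N := r₀⁻¹ • (x - y) with he_def
  have he : ‖e‖ = 1 := by
    rw [he_def, norm_smul, norm_inv, norm_norm, ← hr₀, inv_mul_cancel₀ hr₀0.ne']
  set R' := min R (δ / 3) with hR'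
  have hR'0 : 0 < R' := lt_min hR (by positivity)
  have hR'R : R' ≤ R := min_le_left _ _
  have hR'δ : R' ≤ δ / 3 := min_le_right _ _
  set μ := (t - s) / σ ^ 2 with hμ
  set pc := ζ • (x - y) with hpc
  set g : EucSp N → ℝ → ℝ := fun z τ => u z τ - L * ‖z - x₀‖ ^ 2 - L * (τ - t₀) ^ 2
    - ⟪pc, z - x⟫ - μ * (τ - t) with hg
  set k : EucSp N → ℝ → ℝ := fun z τ => -u z τ - 0 * ‖z - x₀‖ ^ 2 - 0 * (τ - t₀) ^ 2
    - ⟪-pc, z - y⟫ - (-μ) * (τ - s) with hk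
  have hcont : ∀ {z : EucSp N} {τ : ℝ}, closedBall τ R ⊆ Ioo 0 T →
      ContinuousOn (fun p : EucSp N × ℝ => u p.1 p.2) (closedBall z R' ×ˢ closedBall τ R') :=
    fun hτ => hu.mono (prod_mono (subset_univ _) ((closedBall_subset_closedBall hR'R).trans hτ))
  have hgc : ContinuousOn (fun z : EucSp N × ℝ => g z.1 z.2)
      (closedBall x R' ×ˢ closedBall t R') := by
    have := hcont (z := x) ht
    simp only [hg]
    fun_prop
  have hkc : ContinuousOn (fun z : EucSp N × ℝ => k z.1 z.2)
      (closedBall y R' ×ˢ closedBall s R') := by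
    have := hcont (z := y) hs
    simp only [hk]
    fun_prop
  set ε := min (min 1 R) (min (1 / (4 * ζ)) (r₀ / 4)) with hεdef
  have hε0 : 0 < ε := lt_min (lt_min one_pos hR) (lt_min (by positivity) (by positivity))
  have hε1 : ε ≤ 1 := (min_le_left _ _).trans (min_le_left _ _)
  have hεR : ε ≤ R := (min_le_left _ _).trans (min_le_right _ _)
  have hεζ : ζ * ε ≤ 1 / 4 := by
    have : ε ≤ 1 / (4 * ζ) := (min_le_right _ _).trans (min_le_left _ _)
    calc ζ * ε ≤ ζ * (1 / (4 * ζ)) := by gcongr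
      _ = 1 / 4 := by field_simp
  have hεr : ε ≤ r₀ / 4 := (min_le_right _ _).trans (min_le_right _ _)
  obtain ⟨x', y', p, q, t', s', ρ, κ, X, Y, hx', hy', ht', hs', hp, hq, hρ, hκ, hjg, hjk,
      hXY, hX, hY⟩ :=
    exists_parabolic_jets (ζ := ζ) (c := 1 + (1 - γ) / 4) (b := (1 - γ) / 8) hR'0 hσ hσ1 hζ
      (by linarith) (by linarith) (by linarith) (by linarith) he hgc hkc (by
        intro x' hx' t' ht' y' hy' s' hs'
        have h1 := hmax x' (closedBall_subset_closedBall hR'R hx') t'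
          (closedBall_subset_closedBall hR'R ht') y' (closedBall_subset_closedBall hR'R hy') s'
          (closedBall_subset_closedBall hR'R hs')
        rw [mem_closedBall_iff_norm] at hx' hy'
        have h2 := hδball ((x' - x) - (y' - y)) (by
          rw [mem_ball_zero_iff]
          exact (norm_sub_le _ _).trans_lt (by linarith))
        have e1 : x - y + ((x' - x) - (y' - y)) = x' - y' := by abel
        rw [e1] at h2
        have e2 : 1 / (2 * σ ^ 2) * (t' - s') ^ 2 = 1 / (2 * σ ^ 2) * (t - s) ^ 2
            + μ * ((t' - t) - (s' - s)) + 1 / (2 * σ ^ 2) * ((t' - t) - (s' - s)) ^ 2 := by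
          rw [hμ]
          field_simp
          ring
        have e3 : ζ * ⟪x - y, (x' - x) - (y' - y)⟫ = ⟪pc, x' - x⟫ - ⟪pc, y' - y⟫ := by
          rw [hpc, inner_smul_left, inner_smul_left, inner_sub_right, RCLike.conj_to_real]
          ring
        rw [e2] at h1
        simp only [hg, hk, sub_self, inner_zero_right, inner_neg_left]
        linarith only [h1, h2, e3]) hε0
  have hjg' := hjg.add_quadratic
  have hjk' := hjk.add_quadratic
  have ht'm : t' ∈ Ioo 0 T := ht (by rw [mem_closedBall_iff_norm]; exact ht'.le.trans hεR)
  have hs'm : s' ∈ Ioo 0 T := hs (by rw [mem_closedBall_iff_norm]; exact hs'.le.trans hεR)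
  set v := (x - y) - (x' - y') with hv
  have hvn : ‖v‖ ≤ 2 * ε := by
    have : v = (y' - y) - (x' - x) := by rw [hv]; abel
    rw [this]
    exact (norm_sub_le _ _).trans (by linarith)
  have hζv : ‖ζ • v‖ ≤ 1 / 2 := by
    rw [norm_smul, Real.norm_of_nonneg hζ0.le]
    calc ζ * ‖v‖ ≤ ζ * (2 * ε) := by gcongr
      _ ≤ 1 / 2 := by linarith
  have hxyv : x' - y' = (x - y) - v := by rw [hv]; abel
  have hyxv : x - y = (x' - y') + v := by rw [hv]; abel
  have hr1 : r₀ / 2 ≤ ‖x' - y'‖ := by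
    have := norm_add_le (x' - y') v
    rw [← hyxv] at this
    linarith
  have hr2 : ‖x' - y'‖ ≤ 2 * r₀ := by
    rw [hxyv]
    exact (norm_sub_le _ _).trans (by linarith)
  have hxy1 : x' ≠ y' := by
    rintro heq
    rw [heq, sub_self, norm_zero] at hr1
    linarith
  have hxx₀' : ‖x' - x₀‖ ≤ 2 := by
    have : x' - x₀ = (x' - x) + (x - x₀) := by abel
    rw [this]
    exact (norm_add_le _ _).trans (by linarith)
  set w := p + ζ • v + (2 * L) • (x' - x₀) with hw
  set w' := ζ • v - q with hw'
  have hwn : ‖w‖ ≤ 4 * L + 2 := by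
    have h1 : ‖(2 * L) • (x' - x₀)‖ ≤ 4 * L := by
      rw [norm_smul, Real.norm_of_nonneg (by positivity)]
      nlinarith
    have := norm_add₃_le (a := p) (b := ζ • v) (c := (2 * L) • (x' - x₀))
    linarith only [this, h1, hp, hε1, hζv]
  have hwn' : ‖w'‖ ≤ 4 * L + 2 := by
    have := norm_sub_le (ζ • v) q
    linarith only [this, hq, hε1, hζv, hL]
  have hP : ‖ζ • (x' - y')‖ = ζ * ‖x' - y'‖ := by rw [norm_smul, Real.norm_of_nonneg hζ0.le]
  have hKP : 4 * L + 2 < ‖ζ • (x' - y')‖ / 2 := by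
    rw [hP]
    linarith only [hK, mul_le_mul_of_nonneg_left hr1 hζ0.le]
  have hepu : p + pc + (2 * L) • (x' - x₀) = ζ • (x' - y') + w := by
    rw [hw, hpc, hyxv, smul_add]
    abel
  have hepv : q + -pc + (2 * (0 : ℝ)) • (y' - x₀) = -(ζ • (x' - y') + w') := by
    rw [hw', hpc, hyxv, smul_add, mul_zero, zero_smul]
    abel
  have hne : ∀ z : EucSp N, ‖z‖ ≤ 4 * L + 2 → ζ • (x' - y') + z ≠ 0 := by
    intro z hz h0
    rw [eq_neg_of_add_eq_zero_left h0, norm_neg] at hKP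
    linarith only [norm_nonneg z, hz, hKP]
  have hle : ∀ z : EucSp N, ‖z‖ ≤ 4 * L + 2 →
      ‖ζ • (x' - y') + z‖ ≤ 2 * ‖ζ • (x' - y')‖ := by
    intro z hz
    refine (norm_add_le _ _).trans ?_
    linarith only [norm_nonneg z, hz, hKP]
  have heY : Y + (2 * (0 : ℝ)) • ContinuousLinearMap.id ℝ (EucSp N) = Y := by
    rw [mul_zero]
    exact (congrArg (Y + ·) (zero_smul ℝ (ContinuousLinearMap.id ℝ (EucSp N)))).trans
      (add_zero Y)
  rw [hepu] at hjg'
  rw [hepv, heY] at hjk'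
  obtain ⟨b₁, c₁, hj1⟩ := hjg'
  obtain ⟨b₂, c₂, hj2⟩ := hjk'
  have v1 := (hsub x' t' ht'm).1 _ _ _ b₁ c₁ (hne w hwn) hj1
  have v2 := (hsup y' s' hs'm).1 _ _ _ b₂ c₂ (neg_ne_zero.2 (hne w' hwn')) hj2
  have g1 := abs_le.1 (abs_gradTerm_le hα (hCh x' t' ht'm) (hne w hwn) (hle w hwn))
  have g2 := abs_le.1 (abs_gradTerm_le (P := 2 * ‖ζ • (x' - y')‖) hα (hCh y' s' hs'm)
    (neg_ne_zero.2 (hne w' hwn')) (by rw [norm_neg]; exact hle w' hwn'))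
  have hFd := F_jets_sub_le hF1 hF2 hω hC hF6 hxy1 he hζ (by linarith : 0 ≤ 1 + (1 - γ) / 4)
    (by linarith) (by linarith : 0 ≤ (1 - γ) / 8) (by positivity : 0 ≤ 2 * L) hε0 hε1 hX hY hXY
    hwn hwn' hKP
  rw [dualOp, neg_neg] at v2
  have f1 := abs_le.1 (hMf x' t' ht'm)
  have f2 := abs_le.1 (hMf y' s' hs'm)
  have hT1 : -(4 * L) ≤ 2 * L * (t' - t₀) := by
    have h1 := (abs_lt.1 ht').1
    have h2 := (abs_le.1 htt₀).1
    linarith only [mul_le_mul_of_nonneg_left (by linarith only [h1, h2, hε1] : -2 ≤ t' - t₀) hL]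
  have hρ' := (abs_lt.1 hρ).1
  have hκ' := (abs_lt.1 hκ).1
  refine ⟨‖x' - y'‖, hr1, hr2, fun ζ' P hζ' hP' => ?_⟩
  rw [hζ'] at hP' ⊢
  rw [hP, ← hP'] at hFd g1 g2
  linarith only [v1, v2, hFd, g1.1, g1.2, g2.1, g2.2, f1.2, f2.1, hT1, hρ', hκ', hε1]

end SpaceDoubling

section AbsorbingConstants

set_option maxHeartbeats 400000 in
lemma eventually_doubling_contradiction {α γ a A C Ch L D U n : ℝ} (hα : -1 < α) (hγ0 : 0 < γ)
    (hγ1 : γ < 1) (ha : 0 < a) (hC : 0 ≤ C) (hCh : 0 ≤ Ch) (hL : 0 ≤ L) (hU : 0 ≤ U)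
    (hn : 0 ≤ n) : ∀ᶠ M : ℝ in atTop, ∀ r₀ : ℝ, 0 < r₀ → M * r₀ ^ γ ≤ 2 * U →
      r₀ < 1 ∧ 1 ≤ M * γ * r₀ ^ (γ - 2) ∧ 4 * L + 2 < M * γ * r₀ ^ (γ - 2) * r₀ / 4 ∧
      ∀ r, r₀ / 2 ≤ r → r ≤ 2 * r₀ → ∀ ζ P, ζ = M * γ * r₀ ^ (γ - 2) → P = ζ * r →
        2 * Ch * (2 * P) ^ (1 + α) + D - 2 * a * ((1 - γ) / 8) * ζ * P ^ α
          + A * (2 * L + 2) * n * P ^ α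
          + 6 * C * n * (4 * L + 2) * (8 * ζ + 2 * L) * P ^ (α - 1) < 0 := by
  set k := a * (1 - γ) / 4 with hk
  have hk0 : 0 < k := by
    have : 0 < 1 - γ := by linarith
    positivity
  have t1 : Tendsto (fun M : ℝ => M * γ) atTop atTop := tendsto_id.atTop_mul_const hγ0
  have t2 : Tendsto (fun M : ℝ => (M * γ / 2) ^ (1 + α)) atTop atTop :=
    (tendsto_rpow_atTop (by linarith)).comp (t1.atTop_div_const two_pos)
  have t3 : Tendsto (fun M : ℝ => (2 * U / M) ^ (1 / γ)) atTop (nhds 0) := by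
    have := (tendsto_const_nhds (x := 2 * U)).div_atTop tendsto_id (α := ℝ) (l := atTop)
    have h0 := this.rpow_const (p := 1 / γ) (Or.inr (by positivity))
    rwa [Real.zero_rpow (by positivity)] at h0
  have t4 : Tendsto (fun M : ℝ => 2 * Ch * 2 ^ (1 + α) * 2 * (2 * U / M) ^ (1 / γ)) atTop
      (nhds 0) := by
    simpa using t3.const_mul (2 * Ch * 2 ^ (1 + α) * 2)
  filter_upwards [eventually_gt_atTop (2 * U), t1.eventually_ge_atTop 1,
    t1.eventually_ge_atTop (8 * (A * (2 * L + 2) * n) / k),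
    t1.eventually_gt_atTop (4 * (4 * L + 2)),
    t1.eventually_ge_atTop (2 * (8 * (6 * C * n * (4 * L + 2) * (8 + 2 * L)) / k)),
    t2.eventually_gt_atTop (16 * D / k), t4.eventually (gt_mem_nhds (by positivity : 0 < k / 8))]
    with M h1 h2 h3 h4 h5 h6 h7 r₀ hr₀ hMr
  have hM0 : 0 < M := by linarith
  have hrγ : r₀ ^ γ ≤ 2 * U / M := by rw [le_div_iff₀ hM0]; linarith
  have hrU : r₀ ≤ (2 * U / M) ^ (1 / γ) := by
    have := Real.rpow_le_rpow (by positivity) hrγ (by positivity : 0 ≤ 1 / γ)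
    rwa [← Real.rpow_mul hr₀.le, mul_one_div_cancel hγ0.ne', Real.rpow_one] at this
  have hr1 : r₀ < 1 := by
    have : r₀ ^ γ < 1 := hrγ.trans_lt (by rw [div_lt_one hM0]; exact h1)
    by_contra! h
    exact absurd (Real.one_le_rpow h hγ0.le) (not_le.2 this)
  have e1 : 1 ≤ r₀ ^ (γ - 2) :=
    Real.one_le_rpow_of_pos_of_le_one_of_nonpos hr₀ hr1.le (by linarith)
  have e2 : 1 ≤ r₀ ^ (γ - 2) * r₀ := by
    have : r₀ ^ (γ - 2) * r₀ = r₀ ^ (γ - 1) := by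
      rw [← Real.rpow_add_one hr₀.ne']
      congr 1
      ring
    rw [this]
    exact Real.one_le_rpow_of_pos_of_le_one_of_nonpos hr₀ hr1.le (by linarith)
  have hζM : M * γ ≤ M * γ * r₀ ^ (γ - 2) := le_mul_of_one_le_right (by positivity) e1
  have hζr : M * γ ≤ M * γ * r₀ ^ (γ - 2) * r₀ := by
    rw [mul_assoc]
    exact le_mul_of_one_le_right (by positivity) e2
  refine ⟨hr1, by linarith, by linarith, ?_⟩
  rintro r hrl hru ζ P hζ hP
  rw [← hζ] at hζM hζr
  have hζ1 : 1 ≤ ζ := h2.trans hζM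
  have hζ0 : 0 < ζ := one_pos.trans_le hζ1
  have hr0 : 0 < r := by linarith
  have hPM : M * γ / 2 ≤ P := by
    rw [hP]
    have := mul_le_mul_of_nonneg_left hrl hζ0.le
    linarith
  have hP0 : 0 < P := by linarith
  have hPα : 0 < P ^ α := Real.rpow_pos_of_pos hP0 α
  have hPP : P ^ (1 + α) = P * P ^ α := by rw [Real.rpow_add hP0, Real.rpow_one]
  set Q := ζ * P ^ α with hQ
  have hQ0 : 0 < Q := by positivity
  have a1 : 2 * Ch * (2 * P) ^ (1 + α) ≤ k / 8 * Q := by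
    rw [Real.mul_rpow zero_le_two hP0.le, hPP]
    calc 2 * Ch * (2 ^ (1 + α) * (P * P ^ α)) = 2 * Ch * 2 ^ (1 + α) * r * Q := by
          rw [hQ, hP]
          ring
      _ ≤ 2 * Ch * 2 ^ (1 + α) * (2 * (2 * U / M) ^ (1 / γ)) * Q := by
          gcongr
          linarith
      _ ≤ k / 8 * Q := by
          gcongr
          linarith
  have a2 : A * (2 * L + 2) * n * P ^ α ≤ k / 8 * Q := by
    rw [hQ, ← mul_assoc]
    refine mul_le_mul_of_nonneg_right ?_ hPα.le
    rw [div_le_iff₀ hk0] at h3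
    linarith only [h3, mul_le_mul_of_nonneg_left hζM hk0.le]
  have a3 : 6 * C * n * (4 * L + 2) * (8 * ζ + 2 * L) * P ^ (α - 1) ≤ k / 8 * Q := by
    have hs : P ^ (α - 1) = P ^ α / P := by rw [Real.rpow_sub_one hP0.ne']
    rw [hs, mul_div_assoc', div_le_iff₀ hP0]
    have hb : 6 * C * n * (4 * L + 2) * (8 + 2 * L) ≤ k / 8 * P := by
      rw [mul_div_assoc', div_le_iff₀ hk0] at h5
      linarith only [h5, mul_le_mul_of_nonneg_left hPM hk0.le]
    calc 6 * C * n * (4 * L + 2) * (8 * ζ + 2 * L) * P ^ α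
        ≤ 6 * C * n * (4 * L + 2) * ((8 + 2 * L) * ζ) * P ^ α := by
          gcongr
          linarith only [mul_le_mul_of_nonneg_left hζ1 hL]
      _ = 6 * C * n * (4 * L + 2) * (8 + 2 * L) * Q := by rw [hQ]; ring
      _ ≤ k / 8 * P * Q := by gcongr
      _ = k / 8 * Q * P := by ring
  have a4 : D < k / 8 * Q := by
    have hQP : (M * γ / 2) ^ (1 + α) ≤ 2 * Q := by
      calc (M * γ / 2) ^ (1 + α) ≤ P ^ (1 + α) := by gcongr; linarith only [hα]
        _ = r * Q := by rw [hPP, hQ, hP]; ring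
        _ ≤ 2 * Q := by gcongr; linarith
    rw [div_lt_iff₀ hk0] at h6
    linarith only [h6, mul_le_mul_of_nonneg_left hQP hk0.le]
  have a5 : 2 * a * ((1 - γ) / 8) * ζ * P ^ α = k * Q := by rw [hQ, hk]; ring
  rw [a5]
  have : 0 < k * Q := by positivity
  linarith

end AbsorbingConstants

section SpaceHolder

variable {T α a A : ℝ} {F : EucSp N → EucSp N → MatN N → ℝ} {h : EucSp N → ℝ → EucSp N}
  {f u : EucSp N → ℝ → ℝ}

lemma exists_doubling_max {T U M L σ γ τ m δ : ℝ} {u : EucSp N → ℝ → ℝ}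
    (hu : ContinuousOn (fun p : EucSp N × ℝ => u p.1 p.2) (univ ×ˢ Ioo 0 T))
    (hU : ∀ x, ∀ t ∈ Ioo (0 : ℝ) T, |u x t| ≤ U) (hγ : 0 < γ) (hM : 0 ≤ M) (hτ : 0 < τ)
    (hτ1 : τ ≤ 1) (hL : L = 8 * U / τ ^ 2) (hδτ : δ ≤ τ / 4) (hδ : 0 < δ) (hσ : 0 < σ)
    (hσδ : 4 * U * σ ^ 2 ≤ δ ^ 2) {t₀ : ℝ} (ht₀ : closedBall t₀ τ ⊆ Ioo 0 T) {x₀ y₀ : EucSp N}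
    (hm : 0 < m) (hm' : m = u x₀ t₀ - u y₀ t₀ - M * ‖x₀ - y₀‖ ^ γ)
    (hsmall : ∀ x y : EucSp N, M * ‖x - y‖ ^ γ ≤ 2 * U → ‖x - y‖ < 1)
    (huc : ∀ x ∈ closedBall x₀ 3, ∀ t ∈ closedBall t₀ τ, ∀ s ∈ closedBall t₀ τ,
      |t - s| < δ → |u x t - u x s| < m) :
    ∃ x y t s, x ≠ y ∧ M * ‖x - y‖ ^ γ ≤ 2 * U ∧ ‖x - x₀‖ ≤ 1 ∧ |t - t₀| ≤ 1 ∧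
      closedBall t (τ / 4) ⊆ Ioo 0 T ∧ closedBall s (τ / 4) ⊆ Ioo 0 T ∧
      ∀ x' ∈ closedBall x (τ / 4), ∀ t' ∈ closedBall t (τ / 4), ∀ y' ∈ closedBall y (τ / 4),
      ∀ s' ∈ closedBall s (τ / 4),
      u x' t' - u y' s' - M * ‖x' - y'‖ ^ γ - L * ‖x' - x₀‖ ^ 2 - L * (t' - t₀) ^ 2
        - 1 / (2 * σ ^ 2) * (t' - s') ^ 2 ≤
      u x t - u y s - M * ‖x - y‖ ^ γ - L * ‖x - x₀‖ ^ 2 - L * (t - t₀) ^ 2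
        - 1 / (2 * σ ^ 2) * (t - s) ^ 2 := by
  have ht₀m : t₀ ∈ closedBall t₀ τ := mem_closedBall_self hτ.le
  have hU0 : 0 ≤ U := (abs_nonneg _).trans (hU x₀ t₀ (ht₀ ht₀m))
  have hL0 : 0 ≤ L := by rw [hL]; positivity
  have hLτ : L * τ ^ 2 = 8 * U := by rw [hL]; field_simp
  have hUU : ∀ x, ∀ t ∈ closedBall t₀ τ, ∀ y, ∀ s ∈ closedBall t₀ τ, u x t - u y s ≤ 2 * U := by
    intro x t ht y s hs
    have h1 := abs_le.1 (hU x t (ht₀ ht))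
    have h2 := abs_le.1 (hU y s (ht₀ hs))
    linarith only [h1.2, h2.1]
  set S := closedBall x₀ 2 ×ˢ (closedBall t₀ τ ×ˢ (closedBall x₀ 3 ×ˢ closedBall t₀ τ)) with hS
  have hSc : IsCompact S := (isCompact_closedBall _ _).prod ((isCompact_closedBall _ _).prod
    ((isCompact_closedBall _ _).prod (isCompact_closedBall _ _)))
  set Φ : EucSp N × ℝ × EucSp N × ℝ → ℝ := fun z =>
    u z.1 z.2.1 - u z.2.2.1 z.2.2.2 - M * ‖z.1 - z.2.2.1‖ ^ γ - L * ‖z.1 - x₀‖ ^ 2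
      - L * (z.2.1 - t₀) ^ 2 - 1 / (2 * σ ^ 2) * (z.2.1 - z.2.2.2) ^ 2 with hΦ
  have hΦc : ContinuousOn Φ S := by
    have c1 : ContinuousOn (fun z : EucSp N × ℝ × EucSp N × ℝ => u z.1 z.2.1) S :=
      hu.comp (f := fun z : EucSp N × ℝ × EucSp N × ℝ => (z.1, z.2.1)) (by fun_prop)
        fun z hz => ⟨mem_univ _, ht₀ hz.2.1⟩
    have c2 : ContinuousOn (fun z : EucSp N × ℝ × EucSp N × ℝ => u z.2.2.1 z.2.2.2) S :=
      hu.comp (f := fun z : EucSp N × ℝ × EucSp N × ℝ => (z.2.2.1, z.2.2.2)) (by fun_prop)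
        fun z hz => ⟨mem_univ _, ht₀ hz.2.2.2⟩
    have c3 : ContinuousOn (fun z : EucSp N × ℝ × EucSp N × ℝ => ‖z.1 - z.2.2.1‖ ^ γ) S :=
      ContinuousOn.rpow_const (by fun_prop) fun _ _ => Or.inr hγ.le
    exact ((((c1.sub c2).sub (continuousOn_const.mul c3)).sub (by fun_prop)).sub
      (by fun_prop)).sub (by fun_prop)
  have hy₀ : y₀ ∈ closedBall x₀ 3 := by
    have := hsmall x₀ y₀ (by linarith only [hm, hm', hUU x₀ t₀ ht₀m y₀ t₀ ht₀m])
    rw [mem_closedBall, dist_comm, dist_eq_norm]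
    linarith
  have hz₀ : (x₀, t₀, y₀, t₀) ∈ S := ⟨mem_closedBall_self zero_le_two, ht₀m, hy₀, ht₀m⟩
  obtain ⟨⟨x, t, y, s⟩, hzS, hzmax⟩ := hSc.exists_isMaxOn ⟨_, hz₀⟩ hΦc
  obtain ⟨hx, ht, hy, hs⟩ := hzS
  simp only at hx ht hy hs
  have hΦm : m ≤ Φ (x, t, y, s) := by
    have := hzmax hz₀
    simp only [mem_ofPred_eq, hΦ, sub_self, norm_zero] at this
    simp only [hΦ]
    linarith only [this, hm']
  simp only [hΦ] at hΦm
  have p1 : 0 ≤ M * ‖x - y‖ ^ γ := by positivity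
  have p2 : 0 ≤ L * ‖x - x₀‖ ^ 2 := by positivity
  have p3 : 0 ≤ L * (t - t₀) ^ 2 := by positivity
  have p4 : 0 ≤ 1 / (2 * σ ^ 2) * (t - s) ^ 2 := by positivity
  have hd := hUU x t ht y s hs
  have q1 : M * ‖x - y‖ ^ γ ≤ 2 * U := by linarith only [hd, hΦm, hm, p2, p3, p4]
  have q2 : L * ‖x - x₀‖ ^ 2 < 2 * U := by linarith only [hd, hΦm, hm, p1, p3, p4]
  have q3 : L * (t - t₀) ^ 2 < 2 * U := by linarith only [hd, hΦm, hm, p2, p1, p4]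
  have q4 : 1 / (2 * σ ^ 2) * (t - s) ^ 2 < 2 * U := by linarith only [hd, hΦm, hm, p2, p3, p1]
  have hxx₀ : ‖x - x₀‖ < 1 := by
    by_contra! hcon
    have h1 : L * τ ^ 2 ≤ L * 1 := by
      have : τ ^ 2 ≤ 1 := pow_le_one₀ hτ.le hτ1
      gcongr
    have h2 : L * 1 ≤ L * ‖x - x₀‖ ^ 2 := by
      have : 1 ≤ ‖x - x₀‖ ^ 2 := one_le_pow₀ hcon
      gcongr
    linarith only [h1, h2, hLτ, q2, hU0]
  have htt₀ : |t - t₀| < τ / 2 := by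
    by_contra! hcon
    have h1 : L * (τ / 2) ^ 2 ≤ L * (t - t₀) ^ 2 := by
      rw [← sq_abs (t - t₀)]
      gcongr
    linarith only [h1, hLτ, q3]
  have hts : |t - s| < δ := by
    refine abs_lt_of_sq_lt_sq ?_ hδ.le
    rw [one_div_mul_eq_div, div_lt_iff₀ (by positivity)] at q4
    linarith only [q4, hσδ]
  have hst₀ : |s - t₀| < 3 * τ / 4 := by
    rw [abs_lt] at *
    constructor <;> linarith only [htt₀.1, htt₀.2, hts.1, hts.2, hδτ]
  have hyx := hsmall x y q1
  have hyx₀ : ‖y - x₀‖ < 2 := by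
    have : y - x₀ = (x - x₀) - (x - y) := by abel
    rw [this]
    exact (norm_sub_le _ _).trans_lt (by linarith only [hxx₀, hyx])
  have hbt : closedBall t (τ / 4) ⊆ closedBall t₀ τ :=
    closedBall_subset_closedBall' (by rw [Real.dist_eq]; linarith only [htt₀, hτ])
  have hbs : closedBall s (τ / 4) ⊆ closedBall t₀ τ :=
    closedBall_subset_closedBall' (by rw [Real.dist_eq]; linarith only [hst₀, hτ])
  refine ⟨x, y, t, s, ?_, q1, hxx₀.le, by linarith only [htt₀, hτ1], hbt.trans ht₀,
    hbs.trans ht₀, ?_⟩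
  · rintro rfl
    have := (abs_lt.1 (huc x hy t ht s hs hts)).2
    linarith only [this, hΦm, p1, p2, p3, p4]
  · intro x' hx' t' ht' y' hy' s' hs'
    have hx'2 : x' ∈ closedBall x₀ 2 := closedBall_subset_closedBall' (by
      rw [dist_eq_norm]; linarith only [hxx₀, hτ1]) hx'
    have hy'2 : y' ∈ closedBall x₀ 3 := closedBall_subset_closedBall' (by
      rw [dist_eq_norm]; linarith only [hyx₀, hτ1]) hy'
    have hz' : (x', t', y', s') ∈ S := ⟨hx'2, hbt ht', hy'2, hbs hs'⟩
    exact hzmax hz'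

lemma exists_space_holder (hα : -1 < α) (hF1 : H1 univ F α) (hF2 : H2 univ F α a A) {ω : ℝ → ℝ}
    (hωc : Continuous ω) (hω : IsModulusFor F ω) {C : ℝ} (hC : 0 < C)
    (hF6 : IsGradLipschitz F α C) {Ch Mf : ℝ}
    (hCh : ∀ x, ∀ t ∈ Ioo (0 : ℝ) T, ‖h x t‖ ≤ Ch) (hMf : ∀ x, ∀ t ∈ Ioo (0 : ℝ) T, |f x t| ≤ Mf)
    (hu : ContinuousOn (fun p : EucSp N × ℝ => u p.1 p.2) (univ ×ˢ Ioo 0 T))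
    (hsub : HasSubJets T F h α f u)
    (hsup : HasSubJets T (dualOp F) h α (fun x t => -f x t) (fun x t => -u x t)) {U : ℝ}
    (hU : ∀ x, ∀ t ∈ Ioo (0 : ℝ) T, |u x t| ≤ U) {γ τ : ℝ} (hγ0 : 0 < γ) (hγ1 : γ < 1)
    (hτ : 0 < τ) (hτ1 : τ ≤ 1) :
    ∃ M, 0 ≤ M ∧ ∀ t₀, closedBall t₀ τ ⊆ Ioo 0 T → ∀ x y, u x t₀ - u y t₀ ≤ M * ‖x - y‖ ^ γ := by
  by_cases hne : ∃ t₀, closedBall t₀ τ ⊆ Ioo 0 T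
  swap
  · push Not at hne
    exact ⟨0, le_rfl, fun t₀ ht₀ => absurd ht₀ (hne t₀)⟩
  obtain ⟨t₁, ht₁⟩ := hne
  have ht₁m := ht₁ (mem_closedBall_self hτ.le)
  have hU0 : 0 ≤ U := (abs_nonneg _).trans (hU 0 t₁ ht₁m)
  have hCh0 : 0 ≤ Ch := (norm_nonneg _).trans (hCh 0 t₁ ht₁m)
  set L := 8 * U / τ ^ 2 with hL
  have hL0 : 0 ≤ L := by positivity
  obtain ⟨Ω, hΩ⟩ := (isCompact_Icc (a := (0 : ℝ)) (b := 80 * U)).bddAbove_image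
    hωc.continuousOn
  obtain ⟨M, hM0, hM⟩ := ((eventually_ge_atTop (0 : ℝ)).and (eventually_doubling_contradiction
    (A := A) (D := (1 / 10) ^ α * Ω + (2 + 4 * L + 2 * Mf)) hα hγ0 hγ1 hF2.1 hC.le hCh0 hL0 hU0
    (Nat.cast_nonneg N))).exists
  refine ⟨M, hM0, fun t₀ ht₀ x₀ y₀ => ?_⟩
  by_contra! hcon
  obtain ⟨m, hm'⟩ : ∃ m, m = u x₀ t₀ - u y₀ t₀ - M * ‖x₀ - y₀‖ ^ γ := ⟨_, rfl⟩
  have hm : 0 < m := by linarith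
  have hsmall : ∀ x y : EucSp N, M * ‖x - y‖ ^ γ ≤ 2 * U → ‖x - y‖ < 1 := by
    intro x y hxy
    rcases (norm_nonneg (x - y)).eq_or_lt with h0 | h0
    · rw [← h0]
      exact one_pos
    · exact (hM _ h0 hxy).1
  have hcpt : IsCompact (closedBall x₀ 3 ×ˢ closedBall t₀ τ) :=
    (isCompact_closedBall _ _).prod (isCompact_closedBall _ _)
  obtain ⟨δ', hδ', hunif⟩ := Metric.uniformContinuousOn_iff.1 (hcpt.uniformContinuousOn_of_continuous
    (hu.mono (prod_mono (subset_univ _) ht₀))) m hm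
  set δ := min δ' (τ / 4) with hδ
  have hδ0 : 0 < δ := lt_min hδ' (by positivity)
  set σ := min 1 (δ / (2 * (U + 1))) with hσ
  have hσ0 : 0 < σ := lt_min one_pos (by positivity)
  have hσδ : 4 * U * σ ^ 2 ≤ δ ^ 2 := by
    have h1 : σ * (2 * (U + 1)) ≤ δ := by
      rw [← le_div_iff₀ (by positivity)]
      exact min_le_right _ _
    calc 4 * U * σ ^ 2 ≤ (σ * (2 * (U + 1))) ^ 2 := by
          nlinarith [sq_nonneg σ, mul_nonneg hU0 (sq_nonneg σ),
            mul_nonneg (sq_nonneg U) (sq_nonneg σ)]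
      _ ≤ δ ^ 2 := by gcongr
  obtain ⟨x, y, t, s, hxy, hMxy, hxx₀, htt₀, hbt, hbs, hmax⟩ :=
    exists_doubling_max (m := m) hu hU hγ0 hM0 hτ hτ1 hL (min_le_right _ _) hδ0 hσ0 hσδ ht₀ hm hm'
      hsmall (by
        intro x hx t ht s hs hts
        have := hunif (x, t) ⟨hx, ht⟩ (x, s) ⟨hx, hs⟩ (by
          rw [Prod.dist_eq, dist_self, Real.dist_eq]
          exact max_lt hδ' (hts.trans_le (min_le_left _ _)))
        rwa [Real.dist_eq] at this)
  have hr₀ : 0 < ‖x - y‖ := norm_pos_iff.2 (sub_ne_zero.2 hxy)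
  obtain ⟨-, hζ, hK, hfin⟩ := hM _ hr₀ hMxy
  obtain ⟨r, hr1, hr2, hineq⟩ := doubling_inequality hα hF1 hF2 hω hC hF6 hCh hMf hu hsub hsup hγ0
    hγ1 hM0 hL0 hσ0 (min_le_left _ _) (by positivity : 0 < τ / 4) hxy hζ hK hxx₀ htt₀ hbt hbs hmax
  have i1 := hineq _ _ rfl rfl
  have i2 := hfin r hr1 hr2 _ _ rfl rfl
  have hωr : ω (10 * (M * γ * ‖x - y‖ ^ (γ - 2)) * r ^ 2) ≤ Ω := by
    refine hΩ (mem_image_of_mem _ ⟨by positivity, ?_⟩)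
    have e1 : ‖x - y‖ ^ (γ - 2) * ‖x - y‖ ^ 2 = ‖x - y‖ ^ γ := by
      rw [← Real.rpow_natCast, ← Real.rpow_add hr₀]
      norm_num
    calc 10 * (M * γ * ‖x - y‖ ^ (γ - 2)) * r ^ 2
        ≤ 10 * (M * 1 * ‖x - y‖ ^ (γ - 2)) * (2 * ‖x - y‖) ^ 2 := by
          have : 0 ≤ r := by linarith
          gcongr
      _ = 40 * (M * (‖x - y‖ ^ (γ - 2) * ‖x - y‖ ^ 2)) := by ring
      _ ≤ 80 * U := by rw [e1]; linarith
  have i3 := mul_le_mul_of_nonneg_left hωr (by positivity : (0 : ℝ) ≤ (1 / 10) ^ α)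
  linarith only [i1, i2, i3]

end SpaceHolder

section TimeBarrier

variable {T α A : ℝ} {G : EucSp N → EucSp N → MatN N → ℝ} {h : EucSp N → ℝ → EucSp N}
  {f u : EucSp N → ℝ → ℝ}

/-- Growth bound of an operator along nonnegative multiples of the identity matrix. -/
def IsBoundedOnIdentity (G : EucSp N → EucSp N → MatN N → ℝ) (α A : ℝ) : Prop :=
  ∀ x p : EucSp N, p ≠ 0 → ∀ c : ℝ, 0 ≤ c → G x p (c • 1) ≤ A * ‖p‖ ^ α * (c * N)

lemma H1.apply_zero {F : EucSp N → EucSp N → MatN N → ℝ} (hF1 : H1 univ F α) (x : EucSp N)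
    {p : EucSp N} (hp : p ≠ 0) : F x p 0 = 0 := by
  have := hF1 x (mem_univ _) p hp 0 Matrix.isSymm_zero 1 one_ne_zero 0 le_rfl
  simpa using this

lemma isBoundedOnIdentity_of_H1_H2 {F : EucSp N → EucSp N → MatN N → ℝ} {a : ℝ}
    (hF1 : H1 univ F α) (hF2 : H2 univ F α a A) : IsBoundedOnIdentity F α A := by
  intro x p hp c hc
  have := (F_add_smul_id_le hF2 x hp Matrix.isSymm_zero hc).1
  rwa [zero_add, hF1.apply_zero x hp, zero_add] at this

lemma isBoundedOnIdentity_dualOp {F : EucSp N → EucSp N → MatN N → ℝ} {a : ℝ}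
    (hF1 : H1 univ F α) (hF2 : H2 univ F α a A) : IsBoundedOnIdentity (dualOp F) α A := by
  intro x p hp c hc
  have := (F_add_smul_id_le hF2 x (neg_ne_zero.2 hp) (Matrix.isSymm_one.smul c).neg hc).1
  rw [neg_add_cancel, hF1.apply_zero x (neg_ne_zero.2 hp), norm_neg] at this
  rw [dualOp]
  linarith

lemma time_slope_le_of_touch (hα : -1 < α) (hA : 0 ≤ A) (hG : IsBoundedOnIdentity G α A)
    {Ch Mf : ℝ} (hCh : ∀ x, ∀ t ∈ Ioo (0 : ℝ) T, ‖h x t‖ ≤ Ch)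
    (hMf : ∀ x, ∀ t ∈ Ioo (0 : ℝ) T, |f x t| ≤ Mf) (hsub : HasSubJets T G h α f u)
    {m D K κ t : ℝ} (hm2 : 2 ≤ m) (hm : 1 ≤ (m - 1) * (1 + α)) (hD : 0 < D) {x z : EucSp N}
    (hxz : x ≠ z) (hr : ‖x - z‖ ≤ 1) (ht : t ∈ Ioo 0 T)
    (hloc : ∀ᶠ w : EucSp N × ℝ in nhds (x, t), u w.1 w.2 ≤
      u x t + D * (‖w.1 - z‖ ^ m - ‖x - z‖ ^ m) + K * (w.2 - t) + κ * (w.2 - t) ^ 2) :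
    K ≤ Mf + (6 * A * N * m + Ch) * (D * m) ^ (1 + α) := by
  set r := ‖x - z‖ with hrdef
  have hxz' : x - z ≠ 0 := sub_ne_zero.2 hxz
  have hr0 : 0 < r := norm_pos_iff.2 hxz'
  have hm0 : 0 < m := by linarith
  have hCh0 : 0 ≤ Ch := (norm_nonneg _).trans (hCh x t ht)
  have hrm : 0 < r ^ (m - 2) := Real.rpow_pos_of_pos hr0 _
  set p := (D * m * r ^ (m - 2)) • (x - z) with hpdef
  have hp0 : p ≠ 0 := smul_ne_zero (by positivity) hxz'
  have hpn' : ‖p‖ = D * m * r ^ (m - 2) * r := by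
    rw [hpdef, norm_smul, Real.norm_of_nonneg (by positivity)]
  have hpn : ‖p‖ = D * m * r ^ (m - 1) := by
    rw [hpn', mul_assoc, ← Real.rpow_add_one hr0.ne']
    congr 2
    ring
  have hppos : 0 < ‖p‖ := norm_pos_iff.2 hp0
  have hple : ‖p‖ ≤ D * m := by
    rw [hpn]
    exact mul_le_of_le_one_right (by positivity) (Real.rpow_le_one hr0.le hr (by linarith))
  have hpr : ‖p‖ ^ (1 + α) ≤ (D * m) ^ (1 + α) * r := by
    rw [hpn, Real.mul_rpow (by positivity) (by positivity), ← Real.rpow_mul hr0.le]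
    gcongr
    calc r ^ ((m - 1) * (1 + α)) ≤ r ^ (1 : ℝ) := Real.rpow_le_rpow_of_exponent_ge hr0 hr hm
      _ = r := Real.rpow_one r
  set c := 6 * m ^ 2 * D * r ^ (m - 2) with hc
  have hc0 : 0 ≤ c := by positivity
  have hjet := (hsub x t ht).1 p K (c • ContinuousLinearMap.id ℝ (EucSp N)) 0 κ hp0 (by
    have h1 := (continuous_fst.tendsto (x, t)).eventually (eventually_norm_sub_rpow_le hm2 hxz)
    filter_upwards [hloc, h1] with w hw hw1
    have h2 := mul_le_mul_of_nonneg_left hw1 hD.le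
    rw [inner_zero_left, mul_zero, add_zero, smul_apply, ContinuousLinearMap.id_apply, hpdef,
      inner_smul_left, inner_smul_left, real_inner_self_eq_norm_sq, RCLike.conj_to_real,
      RCLike.conj_to_real, hc]
    rw [← hrdef] at h2
    linarith only [hw, h2])
  rw [symMat_smul, symMat_id] at hjet
  have h1 := hG x p hp0 c hc0
  have h2 := (abs_le.1 (abs_gradTerm_le hα (hCh x t ht) hp0 hple)).2
  have h3 := (abs_le.1 (hMf x t ht)).2
  have h4 : A * ‖p‖ ^ α * (c * N) ≤ 6 * A * N * m * (D * m) ^ (1 + α) := by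
    have e1 : ‖p‖ ^ α * c * r = 6 * m * ‖p‖ ^ (1 + α) := by
      rw [Real.rpow_add hppos, Real.rpow_one]
      nth_rw 2 [hpn']
      rw [hc]
      ring
    have e2 : ‖p‖ ^ α * c ≤ 6 * m * (D * m) ^ (1 + α) := by
      refine le_of_mul_le_mul_right ?_ hr0
      rw [e1, mul_assoc (6 * m)]
      gcongr
    calc A * ‖p‖ ^ α * (c * N) = A * N * (‖p‖ ^ α * c) := by ring
      _ ≤ A * N * (6 * m * (D * m) ^ (1 + α)) := by gcongr
      _ = _ := by ring
  linarith only [hjet, h1, h2, h3, h4]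

end TimeBarrier

section VertexTest

variable {T α A : ℝ} {G : EucSp N → EucSp N → MatN N → ℝ} {h : EucSp N → ℝ → EucSp N}
  {f u : EucSp N → ℝ → ℝ}

lemma eq_of_sub_le_rpow {S : EucSp N → ℝ} {x₀ : EucSp N} {ρ c m : ℝ} (hρ1 : ρ ≤ 1 / 2)
    (hc : 0 ≤ c) (hm : 2 ≤ m)
    (hS : ∀ x ∈ ball x₀ ρ, ∀ y ∈ ball x₀ ρ, S x ≤ S y + c * ‖x - y‖ ^ m) {x : EucSp N}
    (hx : x ∈ ball x₀ ρ) : S x = S x₀ := by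
  have hρ : 0 < ρ := pos_of_mem_ball hx
  have hS2 : ∀ x ∈ ball x₀ ρ, ∀ y ∈ ball x₀ ρ, |S x - S y| ≤ c * ‖x - y‖ ^ 2 := by
    have key : ∀ x ∈ ball x₀ ρ, ∀ y ∈ ball x₀ ρ, S x - S y ≤ c * ‖x - y‖ ^ 2 := by
      intro x hx y hy
      have h1 : ‖x - y‖ ≤ 1 := by
        rw [mem_ball] at hx hy
        rw [← dist_eq_norm]
        linarith [dist_triangle_right x y x₀]
      have h2 : ‖x - y‖ ^ m ≤ ‖x - y‖ ^ 2 := by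
        rw [← Real.rpow_natCast]
        exact Real.rpow_le_rpow_of_exponent_ge' (norm_nonneg _) h1 (by norm_num)
          (by exact_mod_cast hm)
      have h3 := hS x hx y hy
      have h4 := mul_le_mul_of_nonneg_left h2 hc
      linarith
    intro x hx y hy
    rw [abs_le]
    have h1 := key y hy x hx
    rw [norm_sub_rev] at h1
    exact ⟨by linarith, key x hx y hy⟩
  have hder : ∀ y ∈ ball x₀ ρ, HasFDerivWithinAt S (0 : EucSp N →L[ℝ] ℝ) (ball x₀ ρ) y := by
    intro y hy
    have hO : (fun z => S z - S y) =O[nhds y] fun z => ‖z - y‖ ^ 2 := by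
      refine Asymptotics.IsBigO.of_bound c ?_
      filter_upwards [isOpen_ball.mem_nhds hy] with z hz
      rw [Real.norm_eq_abs, norm_pow, norm_norm]
      exact hS2 z hz y hy
    have := (hO.hasFDerivAt (𝕜 := ℝ) one_lt_two).add_const (S y)
    simp only [sub_add_cancel] at this
    exact this.hasFDerivWithinAt
  have := (convex_ball x₀ ρ).norm_image_sub_le_of_norm_hasFDerivWithin_le (C := 0) hder
    (fun y _ => by simp) (mem_ball_self hρ) hx
  rw [zero_mul, norm_le_zero_iff] at this
  linarith

lemma eventually_exists_time_max (hα : -1 < α) (hA : 0 ≤ A) (hG : IsBoundedOnIdentity G α A)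
    {Ch Mf : ℝ} (hCh : ∀ x, ∀ t ∈ Ioo (0 : ℝ) T, ‖h x t‖ ≤ Ch)
    (hMf : ∀ x, ∀ t ∈ Ioo (0 : ℝ) T, |f x t| ≤ Mf)
    (hu : ContinuousOn (fun p : EucSp N × ℝ => u p.1 p.2) (univ ×ˢ Ioo 0 T))
    (hsub : HasSubJets T G h α f u) {m D K t₀ ρ : ℝ} (hm2 : 2 ≤ m)
    (hm : 1 ≤ (m - 1) * (1 + α)) (hD : 0 < D) {x₀ : EucSp N} (hρ : 0 < ρ) (hρ1 : ρ ≤ 1 / 2)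
    (ht₀ : closedBall t₀ ρ ⊆ Ioo 0 T)
    (hloc : ∀ x ∈ closedBall x₀ ρ, ∀ t ∈ closedBall t₀ ρ,
      u x t ≤ u x₀ t₀ + D * ‖x - x₀‖ ^ m + K * (t - t₀))
    (hK : Mf + 2 + (6 * A * N * m + Ch) * (2 * D * m) ^ (1 + α) < K) :
    ∀ᶠ y in nhds x₀, ∃ s ∈ ball t₀ ρ, ∀ x ∈ closedBall x₀ ρ, ∀ t ∈ closedBall t₀ ρ,
      u x t - (K * (t - t₀) + 1 * (t - t₀) ^ 2) ≤
        u y s - (K * (s - t₀) + 1 * (s - t₀) ^ 2) + 2 * D * ‖x - y‖ ^ m := by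
  have hm0 : 0 < m := by linarith
  set S := closedBall x₀ ρ ×ˢ closedBall t₀ ρ with hS
  have hSc : IsCompact S := (isCompact_closedBall _ _).prod (isCompact_closedBall _ _)
  have hbd : IsCompact (S \ (ball x₀ ρ ×ˢ ball t₀ ρ)) := hSc.diff (isOpen_ball.prod isOpen_ball)
  have hrpow : Continuous fun r : EucSp N => ‖r‖ ^ m :=
    continuous_norm.rpow_const fun _ => Or.inr hm0.le
  have hev := hbd.eventually_forall_of_forall_eventually (x₀ := x₀)
    (P := fun y z => u x₀ t₀ + D * ‖z.1 - x₀‖ ^ m - (z.2 - t₀) ^ 2 - 2 * D * ‖z.1 - y‖ ^ m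
      < u y t₀) (by
    rintro ⟨x, t⟩ ⟨⟨hx, ht⟩, hxt⟩
    have c1 : ContinuousAt (fun w : EucSp N × EucSp N × ℝ => u w.1 t₀) (x₀, x, t) := by
      have := continuousAt_of_mem hu x₀ (ht₀ (mem_closedBall_self hρ.le))
      exact ContinuousAt.comp (f := fun w : EucSp N × EucSp N × ℝ => (w.1, t₀)) (x := (x₀, x, t))
        this (by fun_prop)
    have c2 : ContinuousAt (fun w : EucSp N × EucSp N × ℝ => u x₀ t₀ + D * ‖w.2.1 - x₀‖ ^ m
        - (w.2.2 - t₀) ^ 2 - 2 * D * ‖w.2.1 - w.1‖ ^ m) (x₀, x, t) := by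
      have d1 : Continuous fun w : EucSp N × EucSp N × ℝ => ‖w.2.1 - x₀‖ ^ m :=
        hrpow.comp (by fun_prop)
      have d2 : Continuous fun w : EucSp N × EucSp N × ℝ => ‖w.2.1 - w.1‖ ^ m :=
        hrpow.comp (by fun_prop)
      fun_prop
    refine c2.eventually_lt c1 ?_
    simp only
    have h1 : 0 ≤ D * ‖x - x₀‖ ^ m := by positivity
    have h2 : 0 ≤ (t - t₀) ^ 2 := sq_nonneg _
    rcases eq_or_ne x x₀ with rfl | hne
    · have : t ≠ t₀ := by
        rintro rfl
        exact hxt ⟨mem_ball_self hρ, mem_ball_self hρ⟩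
      have : 0 < (t - t₀) ^ 2 := by
        have := sub_ne_zero.2 this
        positivity
      linarith
    · have : 0 < D * ‖x - x₀‖ ^ m := by
        have := norm_pos_iff.2 (sub_ne_zero.2 hne)
        positivity
      linarith)
  filter_upwards [hev, isOpen_ball.mem_nhds (mem_ball_self hρ)] with y hy hyb
  set Ψ : EucSp N × ℝ → ℝ := fun z =>
    u z.1 z.2 - (K * (z.2 - t₀) + 1 * (z.2 - t₀) ^ 2) - 2 * D * ‖z.1 - y‖ ^ m with hΨ
  have hΨc : ContinuousOn Ψ S := by
    have c1 : ContinuousOn (fun p : EucSp N × ℝ => u p.1 p.2) S :=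
      hu.mono (prod_mono (subset_univ _) ht₀)
    have c2 : Continuous fun z : EucSp N × ℝ => ‖z.1 - y‖ ^ m := hrpow.comp (by fun_prop)
    exact (c1.sub (by fun_prop)).sub (continuousOn_const.mul c2.continuousOn)
  have hyS : (y, t₀) ∈ S := ⟨ball_subset_closedBall hyb, mem_closedBall_self hρ.le⟩
  obtain ⟨⟨x', t'⟩, hxt', hmax⟩ := hSc.exists_isMaxOn ⟨_, hyS⟩ hΨc
  have h_mem : (x', t') ∈ ball x₀ ρ ×ˢ ball t₀ ρ := by
    by_contra hcon
    have h1 := hy _ ⟨hxt', hcon⟩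
    have h2 := hmax hyS
    have h3 := hloc x' hxt'.1 t' hxt'.2
    simp only [mem_ofPred_eq, hΨ, sub_self, norm_zero, Real.zero_rpow hm0.ne'] at h1 h2 h3
    linarith only [h1, h2, h3]
  have hx'y : x' = y := by
    by_contra hne
    have ht'b := abs_lt.1 (by simpa [Real.dist_eq] using h_mem.2 : |t' - t₀| < ρ)
    have hr : ‖x' - y‖ ≤ 1 := by
      have h1 := mem_ball.1 h_mem.1
      have h2 := mem_ball.1 hyb
      rw [← dist_eq_norm]
      simp only at h1
      linarith [dist_triangle_right x' y x₀]
    have := time_slope_le_of_touch (K := K + 2 * (t' - t₀)) (κ := 1) hα hA hG hCh hMf hsub hm2 hm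
      (by positivity : 0 < 2 * D) hne hr (ht₀ hxt'.2) (by
        filter_upwards [(isOpen_ball.prod isOpen_ball).mem_nhds h_mem] with w hw
        have h1 := hmax (prod_mono ball_subset_closedBall ball_subset_closedBall hw)
        simp only [mem_ofPred_eq, hΨ] at h1
        linarith only [h1])
    linarith only [this, hK, ht'b.1, hρ1]
  subst hx'y
  refine ⟨t', h_mem.2, fun x hx t ht => ?_⟩
  have h1 := hmax (show (x, t) ∈ S from ⟨hx, ht⟩)
  simp only [mem_ofPred_eq, hΨ, sub_self, norm_zero, Real.zero_rpow hm0.ne'] at h1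
  linarith only [h1]

lemma time_slope_le_of_vertex (hα : -1 < α) (hA : 0 ≤ A) (hG : IsBoundedOnIdentity G α A)
    {Ch Mf : ℝ} (hCh : ∀ x, ∀ t ∈ Ioo (0 : ℝ) T, ‖h x t‖ ≤ Ch)
    (hMf : ∀ x, ∀ t ∈ Ioo (0 : ℝ) T, |f x t| ≤ Mf)
    (hu : ContinuousOn (fun p : EucSp N × ℝ => u p.1 p.2) (univ ×ˢ Ioo 0 T))
    (hsub : HasSubJets T G h α f u) {m D K t₀ : ℝ} (hm2 : 2 ≤ m)
    (hm : 1 ≤ (m - 1) * (1 + α)) (hD : 0 < D) {x₀ : EucSp N} (ht₀ : t₀ ∈ Ioo 0 T)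
    (hloc : ∀ᶠ w : EucSp N × ℝ in nhds (x₀, t₀),
      u w.1 w.2 ≤ u x₀ t₀ + D * ‖w.1 - x₀‖ ^ m + K * (w.2 - t₀)) :
    K ≤ Mf + 2 + (6 * A * N * m + Ch) * (2 * D * m) ^ (1 + α) := by
  by_contra! hK
  have hCh0 : 0 ≤ Ch := (norm_nonneg _).trans (hCh x₀ t₀ ht₀)
  have hm0 : 0 < m := by linarith
  obtain ⟨ρ', hρ', hball⟩ := Metric.nhds_basis_closedBall.eventually_iff.1
    (hloc.and (eventually_mem_Ioo x₀ ht₀))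
  set ρ := min ρ' (1 / 2) with hρdef
  have hρ : 0 < ρ := lt_min hρ' (by norm_num)
  have hmem : ∀ x ∈ closedBall x₀ ρ, ∀ t ∈ closedBall t₀ ρ,
      (x, t) ∈ closedBall (x₀, t₀) ρ' := by
    intro x hx t ht
    rw [← closedBall_prod_same]
    exact ⟨closedBall_subset_closedBall (min_le_left _ _) hx,
      closedBall_subset_closedBall (min_le_left _ _) ht⟩
  have hT : closedBall t₀ ρ ⊆ Ioo 0 T := fun t ht =>
    (hball (hmem x₀ (mem_closedBall_self hρ.le) t ht)).2
  have hloc' : ∀ x ∈ closedBall x₀ ρ, ∀ t ∈ closedBall t₀ ρ,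
      u x t ≤ u x₀ t₀ + D * ‖x - x₀‖ ^ m + K * (t - t₀) :=
    fun x hx t ht => (hball (hmem x hx t ht)).1
  obtain ⟨η, hη, hηball⟩ := Metric.eventually_nhds_iff_ball.1
    (eventually_exists_time_max hα hA hG hCh hMf hu hsub hm2 hm hD hρ (min_le_right _ _) hT hloc'
      hK)
  have hIoo : Ioo (t₀ - ρ) (t₀ + ρ) = ball t₀ ρ := (Real.ball_eq_Ioo t₀ ρ).symm
  set S : EucSp N → ℝ := fun x =>
    sSup ((fun t => u x t - (K * (t - t₀) + 1 * (t - t₀) ^ 2)) '' ball t₀ ρ) with hS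
  set ν := min η ρ with hν
  have hSle : ∀ x ∈ ball x₀ ν, ∀ y ∈ ball x₀ ν, S x ≤ S y + 2 * D * ‖x - y‖ ^ m := by
    intro x hx y hy
    obtain ⟨s, hs, hsmax⟩ := hηball y (ball_subset_ball (min_le_left _ _) hy)
    have hbdd : BddAbove ((fun t => u y t - (K * (t - t₀) + 1 * (t - t₀) ^ 2)) '' ball t₀ ρ) := by
      refine ⟨u y s - (K * (s - t₀) + 1 * (s - t₀) ^ 2), ?_⟩
      rintro _ ⟨t, ht, rfl⟩
      have := hsmax y (ball_subset_closedBall (ball_subset_ball (min_le_right _ _) hy)) t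
        (ball_subset_closedBall ht)
      rwa [sub_self, norm_zero, Real.zero_rpow hm0.ne', mul_zero, add_zero] at this
    refine csSup_le ((nonempty_ball.2 hρ).image _) ?_
    rintro _ ⟨t, ht, rfl⟩
    refine (hsmax x (ball_subset_closedBall (ball_subset_ball (min_le_right _ _) hx)) t
      (ball_subset_closedBall ht)).trans ?_
    gcongr
    exact le_csSup hbdd ⟨s, hs, rfl⟩
  have hν0 : 0 < ν := lt_min hη hρ
  have hν1 : ν ≤ 1 / 2 := (min_le_right _ _).trans (min_le_right _ _)
  have hconst : ∀ᶠ x in nhds x₀, S x = S x₀ := by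
    filter_upwards [isOpen_ball.mem_nhds (mem_ball_self hν0)] with x hx
    exact eq_of_sub_le_rpow hν1 (by positivity) hm2 hSle hx
  have hfin := (hsub x₀ t₀ ht₀).2 ρ hρ (by
    rw [hIoo]
    exact ball_subset_closedBall.trans hT) K 1 (by
    intro t ht
    rw [hIoo] at ht
    have h1 := hloc' x₀ (mem_closedBall_self hρ.le) t (ball_subset_closedBall ht)
    rw [sub_self, norm_zero, Real.zero_rpow hm0.ne'] at h1
    linarith only [h1, sq_nonneg (t - t₀)]) (by rwa [hIoo])
  have h1 := (abs_le.1 (hMf x₀ t₀ ht₀)).2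
  have h2 : 0 ≤ (6 * A * N * m + Ch) * (2 * D * m) ^ (1 + α) := by positivity
  linarith only [h1, h2, hfin, hK]

end VertexTest

section TimeHolder

variable {T α A : ℝ} {G : EucSp N → EucSp N → MatN N → ℝ} {h : EucSp N → ℝ → EucSp N}
  {f u : EucSp N → ℝ → ℝ}

lemma le_power_barrier (hα : -1 < α) (hA : 0 ≤ A) (hG : IsBoundedOnIdentity G α A)
    {Ch Mf U : ℝ} (hCh : ∀ x, ∀ t ∈ Ioo (0 : ℝ) T, ‖h x t‖ ≤ Ch)
    (hMf : ∀ x, ∀ t ∈ Ioo (0 : ℝ) T, |f x t| ≤ Mf)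
    (hU : ∀ x, ∀ t ∈ Ioo (0 : ℝ) T, |u x t| ≤ U)
    (hu : ContinuousOn (fun p : EucSp N × ℝ => u p.1 p.2) (univ ×ˢ Ioo 0 T))
    (hsub : HasSubJets T G h α f u) {m C K ε t₀ τ : ℝ} (hm2 : 2 ≤ m)
    (hm : 1 ≤ (m - 1) * (1 + α)) (hC : 0 < C) (hCU : 2 * U ≤ C) (hε : 0 ≤ ε) (hτ : 0 ≤ τ)
    (hT : Icc t₀ (t₀ + τ) ⊆ Ioo 0 T) (hKτ : 2 * U ≤ K * τ)
    (hK : Mf + 2 + (6 * A * N * m + Ch) * (2 * C * m) ^ (1 + α) < K) {x₀ : EucSp N}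
    (hinit : ∀ x ∈ closedBall x₀ 1, u x t₀ ≤ u x₀ t₀ + ε + C * ‖x - x₀‖ ^ m) :
    ∀ s ∈ Icc t₀ (t₀ + τ), u x₀ s ≤ u x₀ t₀ + ε + K * (s - t₀) := by
  intro s hs
  by_contra! hcon
  have hm0 : 0 < m := by linarith
  have ht₀ : t₀ ∈ Icc t₀ (t₀ + τ) := left_mem_Icc.2 (by linarith)
  have hCh0 : 0 ≤ Ch := (norm_nonneg _).trans (hCh x₀ t₀ (hT ht₀))
  have hMf0 : 0 ≤ Mf := (abs_nonneg _).trans (hMf x₀ t₀ (hT ht₀))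
  have hB0 : 0 ≤ 6 * A * N * m + Ch := by positivity
  have hK0 : 0 ≤ K := by
    have : 0 ≤ (6 * A * N * m + Ch) * (2 * C * m) ^ (1 + α) := by positivity
    linarith
  set S := closedBall x₀ 1 ×ˢ Icc t₀ (t₀ + τ) with hS
  have hSc : IsCompact S := (isCompact_closedBall _ _).prod isCompact_Icc
  have hrpow : Continuous fun z : EucSp N × ℝ => ‖z.1 - x₀‖ ^ m :=
    (by fun_prop : Continuous fun z : EucSp N × ℝ => ‖z.1 - x₀‖).rpow_const
      fun _ => Or.inr hm0.le
  set Φ : EucSp N × ℝ → ℝ := fun z => u z.1 z.2 - C * ‖z.1 - x₀‖ ^ m - K * (z.2 - t₀) with hΦ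
  have hΦc : ContinuousOn Φ S := by
    have c1 : ContinuousOn (fun p : EucSp N × ℝ => u p.1 p.2) S :=
      hu.mono (prod_mono (subset_univ _) hT)
    exact (c1.sub (continuousOn_const.mul hrpow.continuousOn)).sub (by fun_prop)
  have hxs : (x₀, s) ∈ S := ⟨mem_closedBall_self zero_le_one, hs⟩
  obtain ⟨⟨x, t⟩, ⟨hx, ht⟩, hmax⟩ := hSc.exists_isMaxOn ⟨_, hxs⟩ hΦc
  simp only at hx ht
  have hval : u x₀ t₀ + ε + C * ‖x - x₀‖ ^ m + K * (t - t₀) < u x t := by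
    have := hmax hxs
    simp only [mem_ofPred_eq, hΦ, sub_self, norm_zero, Real.zero_rpow hm0.ne'] at this
    linarith only [this, hcon]
  have hosc : u x t ≤ u x₀ t₀ + 2 * U := by
    have h1 := abs_le.1 (hU x t (hT ht))
    have h2 := abs_le.1 (hU x₀ t₀ (hT ht₀))
    linarith only [h1.2, h2.1]
  have hn0 : 0 ≤ C * ‖x - x₀‖ ^ m := by positivity
  have hp0 : 0 ≤ K * (t - t₀) := mul_nonneg hK0 (sub_nonneg.2 ht.1)
  have htl : t₀ < t := by
    rcases ht.1.eq_or_lt with heq | hlt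
    · subst heq
      have := hinit x hx
      linarith
    · exact hlt
  have htr : t < t₀ + τ := by
    rcases ht.2.eq_or_lt with heq | hlt
    · rw [heq, add_sub_cancel_left] at hval
      rw [heq] at hosc
      linarith
    · exact hlt
  have hxb : x ∈ ball x₀ 1 := by
    rw [mem_ball_iff_norm]
    rw [mem_closedBall_iff_norm] at hx
    refine hx.lt_of_ne fun h1 => ?_
    rw [h1, Real.one_rpow, mul_one] at hval
    linarith
  have hloc : ∀ᶠ w : EucSp N × ℝ in nhds (x, t), Φ w ≤ Φ (x, t) := by
    filter_upwards [(isOpen_ball.prod isOpen_Ioo).mem_nhds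
      (show (x, t) ∈ ball x₀ 1 ×ˢ Ioo t₀ (t₀ + τ) from ⟨hxb, htl, htr⟩)] with w hw
    exact hmax ⟨ball_subset_closedBall hw.1, Ioo_subset_Icc_self hw.2⟩
  rcases eq_or_ne x x₀ with rfl | hne
  · have := time_slope_le_of_vertex (K := K) hα hA hG hCh hMf hu hsub hm2 hm hC (hT ht) (by
      filter_upwards [hloc] with w hw
      simp only [hΦ, sub_self, norm_zero, Real.zero_rpow hm0.ne'] at hw
      linarith only [hw])
    linarith only [this, hK]
  · have := time_slope_le_of_touch (K := K) (κ := 0) hα hA hG hCh hMf hsub hm2 hm hC hne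
      (mem_ball_iff_norm.1 hxb).le (hT ht) (by
      filter_upwards [hloc] with w hw
      simp only [hΦ] at hw
      linarith only [hw])
    have h1 : (C * m) ^ (1 + α) ≤ (2 * C * m) ^ (1 + α) := by
      have : 0 < 1 + α := by linarith
      gcongr
      linarith
    have h2 := mul_le_mul_of_nonneg_left h1 hB0
    linarith only [this, hK, h2]

/-- Young-type inequality turning a Hölder cone into a power barrier. -/
lemma mul_rpow_le_add_rpow {M γ m ε r : ℝ} (hM : 0 < M) (hγ : 0 < γ) (hm : γ ≤ m) (hε : 0 < ε)
    (hr : 0 ≤ r) :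
    M * r ^ γ ≤ ε + M ^ (m / γ) * ε ^ (1 - m / γ) * r ^ m := by
  have hp : 0 ≤ M ^ (m / γ) * ε ^ (1 - m / γ) * r ^ m := by positivity
  rcases le_total (M * r ^ γ) ε with h1 | h1
  · linarith
  · have e1 : M ^ (m / γ) * ε ^ (1 - m / γ) * r ^ m = ε * (M * r ^ γ / ε) ^ (m / γ) := by
      rw [Real.div_rpow (by positivity) hε.le, Real.mul_rpow hM.le (by positivity),
        ← Real.rpow_mul hr, mul_div_cancel₀ _ hγ.ne', Real.rpow_sub hε, Real.rpow_one]
      ring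
    have h2 : 1 ≤ M * r ^ γ / ε := by rwa [one_le_div hε]
    have h3 : M * r ^ γ / ε ≤ (M * r ^ γ / ε) ^ (m / γ) :=
      Real.self_le_rpow_of_one_le h2 ((one_le_div hγ).2 hm)
    have h4 := mul_le_mul_of_nonneg_left h3 hε.le
    rw [mul_div_cancel₀ _ hε.ne'] at h4
    rw [e1]
    linarith

lemma exists_time_holder (hα : -1 < α) (hA : 0 ≤ A) (hG : IsBoundedOnIdentity G α A)
    {Ch Mf U : ℝ} (hCh : ∀ x, ∀ t ∈ Ioo (0 : ℝ) T, ‖h x t‖ ≤ Ch)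
    (hMf : ∀ x, ∀ t ∈ Ioo (0 : ℝ) T, |f x t| ≤ Mf)
    (hU : ∀ x, ∀ t ∈ Ioo (0 : ℝ) T, |u x t| ≤ U) (hCh0 : 0 ≤ Ch) (hMf0 : 0 ≤ Mf) (hU0 : 0 ≤ U)
    (hu : ContinuousOn (fun p : EucSp N × ℝ => u p.1 p.2) (univ ×ˢ Ioo 0 T))
    (hsub : HasSubJets T G h α f u) {m γ q θ M τ : ℝ} (hm2 : 2 ≤ m)
    (hm : 1 ≤ (m - 1) * (1 + α)) (hγ0 : 0 < γ) (hγ1 : γ < 1) (hq : q = m / γ)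
    (hθ : θ = 1 / (q * (α + 1) - α)) (hτ : 0 < τ) :
    ∃ c, 0 ≤ c ∧ ∀ t₀, Icc t₀ (t₀ + τ) ⊆ Ioo 0 T →
      (∀ x y, u x t₀ - u y t₀ ≤ M * ‖x - y‖ ^ γ) →
      ∀ s, 0 < s → s ≤ 1 → s ≤ τ → ∀ x, u x (t₀ + s) - u x t₀ ≤ c * s ^ θ := by
  have hα1 : 0 < 1 + α := by linarith
  have hm0 : 0 < m := by linarith
  have hq1 : 1 ≤ q := by rw [hq, one_le_div hγ0]; linarith
  have hden : 0 < q * (α + 1) - α := by nlinarith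
  have hθ0 : 0 < θ := by rw [hθ]; positivity
  obtain ⟨M', hM'1, hM'U, hMM'⟩ : ∃ M', 1 ≤ M' ∧ 2 * U ≤ M' ∧ M ≤ M' :=
    ⟨max 1 (max (2 * U) M), le_max_left _ _, (le_max_left _ _).trans (le_max_right _ _),
      (le_max_right _ _).trans (le_max_right _ _)⟩
  have hM'0 : 0 < M' := by linarith
  set B := (6 * A * N * m + Ch) * (2 * m) ^ (1 + α) with hB
  have hB0 : 0 ≤ B := by positivity
  set k := Mf + 3 + B + 2 * U / τ with hk
  have hk0 : 0 ≤ k := by positivity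
  refine ⟨1 + k * M' ^ (q * (1 + α)), by positivity, fun t₀ hT hsp s hs hs1 hsτ x₀ => ?_⟩
  set ε := s ^ θ with hε
  have hε0 : 0 < ε := Real.rpow_pos_of_pos hs θ
  have hε1 : ε ≤ 1 := Real.rpow_le_one hs.le hs1 hθ0.le
  set C := M' ^ q * ε ^ (1 - q) with hC
  have hCM : M' ≤ C := by
    have h1 : M' ≤ M' ^ q := Real.self_le_rpow_of_one_le hM'1 hq1
    have h2 : 1 ≤ ε ^ (1 - q) :=
      Real.one_le_rpow_of_pos_of_le_one_of_nonpos hε0 hε1 (by linarith)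
    exact h1.trans (le_mul_of_one_le_right (by positivity) h2)
  have hC1 : 1 ≤ C := hM'1.trans hCM
  have hC0 : 0 < C := by linarith
  set Cα := C ^ (1 + α) with hCα
  have hCα1 : 1 ≤ Cα := Real.one_le_rpow hC1 hα1.le
  have hK1 : Mf + 2 + (6 * A * N * m + Ch) * (2 * C * m) ^ (1 + α) < k * Cα := by
    have e1 : (2 * C * m) ^ (1 + α) = (2 * m) ^ (1 + α) * Cα := by
      rw [hCα, ← Real.mul_rpow (by positivity) hC0.le]
      congr 1
      ring
    have e2 : (6 * A * N * m + Ch) * (2 * C * m) ^ (1 + α) = B * Cα := by rw [e1, hB]; ring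
    have e3 : 0 ≤ 2 * U / τ * Cα := by positivity
    have e4 : Mf + 3 ≤ (Mf + 3) * Cα := le_mul_of_one_le_right (by positivity) hCα1
    rw [e2, hk]
    linarith only [e3, e4]
  have hK2 : 2 * U ≤ k * Cα * τ := by
    have e1 : 2 * U / τ ≤ k := by
      rw [hk]
      linarith
    have e2 : k ≤ k * Cα := le_mul_of_one_le_right hk0 hCα1
    rw [← div_le_iff₀ hτ]
    linarith
  have hbar := le_power_barrier (x₀ := x₀) hα hA hG hCh hMf hU hu hsub hm2 hm hC0
    (hM'U.trans hCM) hε0.le hτ.le hT hK2 hK1 (by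
      intro x _
      have h1 := hsp x x₀
      have h2 := mul_rpow_le_add_rpow hM'0 hγ0 (by linarith : γ ≤ m) hε0 (norm_nonneg (x - x₀))
      rw [← hq] at h2
      have h3 : M * ‖x - x₀‖ ^ γ ≤ M' * ‖x - x₀‖ ^ γ := by gcongr
      linarith only [h1, h2, h3]) (t₀ + s) ⟨by linarith, by linarith⟩
  rw [add_sub_cancel_left] at hbar
  have e5 : Cα * s = M' ^ (q * (1 + α)) * ε := by
    rw [hCα, hC, Real.mul_rpow (by positivity) (by positivity), ← Real.rpow_mul hM'0.le,
      ← Real.rpow_mul hε0.le, mul_assoc]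
    congr 1
    rw [hε, ← Real.rpow_mul hs.le]
    nth_rw 2 [← Real.rpow_one s]
    rw [← Real.rpow_add hs]
    congr 1
    rw [hθ]
    field_simp
    ring
  have e6 : k * Cα * s = k * M' ^ (q * (1 + α)) * ε := by rw [mul_assoc, e5, mul_assoc]
  rw [e6] at hbar
  linarith only [hbar]

end TimeHolder

/-- Hölder regularity on `ℝ^N` (Proposition 8 of the paper). -/
theorem holder_regularity_RN
    (N : ℕ) (hN : 1 ≤ N) (α : ℝ) (hα : -1 < α)
    (T : ℝ) (hT : 0 < T)
    (F : EucSp N → EucSp N → MatN N → ℝ) (a A : ℝ)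
    (hFc : Fcont (Set.univ : Set (EucSp N)) F)
    (hF1 : H1 (Set.univ : Set (EucSp N)) F α)
    (hF2 : H2 (Set.univ : Set (EucSp N)) F α a A)
    (hF3 : H3 (Set.univ : Set (EucSp N)) F) (hF6 : H6 F α)
    (h : EucSp N → ℝ → EucSp N) (hh : HContBdd (Set.univ : Set (EucSp N)) T h)
    (hh5 : H5 (Set.univ : Set (EucSp N)) T h α)
    (ψ : EucSp N → ℝ) (γψ : ℝ) (hγψ : γψ ∈ Set.Ioo (0 : ℝ) 1)
    (cψ Mψ : ℝ) (hcψ : 0 < cψ)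
    (hψH : ∀ x y : EucSp N, |ψ x - ψ y| ≤ cψ * ‖x - y‖ ^ γψ)
    (hψb : ∀ x : EucSp N, |ψ x| ≤ Mψ)
    (f : EucSp N → ℝ → ℝ)
    (hfu : UniformContinuousOn (fun p : EucSp N × ℝ => f p.1 p.2)
      (Set.univ ×ˢ Set.Ioo 0 T))
    (Mf : ℝ) (hfb : ∀ x : EucSp N, ∀ t ∈ Set.Ioo (0 : ℝ) T, |f x t| ≤ Mf)
    (γf cf : ℝ) (hγf : 0 < γf) (hγf1 : γf ≤ 1) (hcf : 0 < cf)
    (hft : ∀ x : EucSp N, ∀ t ∈ Set.Ioo (0 : ℝ) T, ∀ s ∈ Set.Ioo (0 : ℝ) T,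
      |f x t - f x s| ≤ cf * |t - s| ^ γf)
    (q₁ q γs : ℝ) (hq₁ : q₁ = max (2 : ℝ) ((α + 2) / (α + 1))) (hq : q = q₁ / γψ)
    (hγs : γs = min γf (1 / (q * (α + 1) - α)))
    (u : EucSp N → ℝ → ℝ) (hu : IsSolutionRN T F h α f ψ u)
    (c₁ c₂ : ℝ)
    (hlow : ∀ x y : EucSp N, ∀ t ∈ Set.Ioo (0 : ℝ) T,
      ψ y - c₁ * ‖x - y‖ ^ γψ - c₂ * t ^ (1 / (q * (α + 1) - α)) ≤ u x t)
    (hupp : ∀ x y : EucSp N, ∀ t ∈ Set.Ioo (0 : ℝ) T,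
      u x t ≤ ψ y + c₁ * ‖x - y‖ ^ γψ + c₂ * t ^ (1 / (q * (α + 1) - α))) :
    ∀ K : Set (EucSp N × ℝ), IsCompact K → K ⊆ Set.univ ×ˢ Set.Ioo 0 T →
      ∃ c : ℝ, ∀ p ∈ K, ∀ p' ∈ K,
        |u p.1 p.2 - u p'.1 p'.2| ≤ c * (‖p.1 - p'.1‖ ^ γψ + |p.2 - p'.2| ^ γs) := by
  have hα1 : 0 < α + 1 := by linarith
  have hq₁2 : 2 ≤ q₁ := hq₁ ▸ le_max_left _ _
  have hm : 1 ≤ (q₁ - 1) * (1 + α) := by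
    have h1 : (α + 2) / (α + 1) ≤ q₁ := hq₁ ▸ le_max_right _ _
    rw [div_le_iff₀ hα1] at h1
    linarith
  have hq1 : 1 ≤ q := by
    rw [hq, one_le_div hγψ.1]
    linarith [hγψ.2]
  obtain ⟨θ, hθ⟩ : ∃ θ, θ = 1 / (q * (α + 1) - α) := ⟨_, rfl⟩
  have hθ0 : 0 < θ := by
    have : 0 < q * (α + 1) - α := by nlinarith
    rw [hθ]
    positivity
  rw [← hθ] at hγs
  simp only [← hθ] at hlow hupp
  have hγs0 : 0 < γs := hγs ▸ lt_min hγf hθ0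
  have hγsθ : γs ≤ θ := hγs ▸ min_le_right _ _
  have hA0 : 0 ≤ A := hF2.1.le.trans hF2.2.1
  have huc : ContinuousOn (fun p : EucSp N × ℝ => u p.1 p.2) (univ ×ˢ Ioo 0 T) :=
    hu.1.mono (prod_mono subset_rfl Ioo_subset_Ico_self)
  have hsub := hasSubJets_of_isSubSol huc hu.2.1
  have hsup : HasSubJets T (dualOp F) h α (fun x t => -f x t) (fun x t => -u x t) :=
    hasSubJets_neg_of_isSuperSol huc hu.2.2.1
  obtain ⟨Ch, hCh'⟩ := hh.2
  have hCh : ∀ x, ∀ t ∈ Ioo (0 : ℝ) T, ‖h x t‖ ≤ Ch := fun x => hCh' x (mem_univ x)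
  obtain ⟨ω, hωc, -, hω⟩ := hF3
  obtain ⟨C, hC, hF6⟩ := hF6
  have hU : ∀ x, ∀ t ∈ Ioo (0 : ℝ) T, |u x t| ≤ Mψ + |c₂| * T ^ θ := by
    intro x t ht
    have h1 := hlow x x t ht
    have h2 := hupp x x t ht
    rw [sub_self, norm_zero, Real.zero_rpow hγψ.1.ne'] at h1 h2
    have h3 := abs_le.1 (hψb x)
    have h4 : |c₂ * t ^ θ| ≤ |c₂| * T ^ θ := by
      rw [abs_mul, abs_of_nonneg (Real.rpow_nonneg ht.1.le θ)]
      have := Real.rpow_le_rpow ht.1.le ht.2.le hθ0.le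
      gcongr
    have h5 := abs_le.1 h4
    rw [abs_le]
    constructor <;> linarith only [h1, h2, h3.1, h3.2, h5.1, h5.2]
  obtain ⟨U, hUdef⟩ : ∃ U, U = Mψ + |c₂| * T ^ θ := ⟨_, rfl⟩
  rw [← hUdef] at hU
  have hTm : T / 2 ∈ Ioo 0 T := ⟨by linarith, by linarith⟩
  have hU0 : 0 ≤ U := (abs_nonneg _).trans (hU 0 _ hTm)
  have hCh0 : 0 ≤ Ch := (norm_nonneg _).trans (hCh 0 _ hTm)
  have hMf0 : 0 ≤ Mf := (abs_nonneg _).trans (hfb 0 _ hTm)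
  intro K hK hKsub
  obtain ⟨δ, hδ, hδT⟩ := (hK.image continuous_snd).exists_cthickening_subset_open isOpen_Ioo
    (show Prod.snd '' K ⊆ Ioo 0 T by
      rintro _ ⟨p, hp, rfl⟩
      exact (hKsub hp).2)
  obtain ⟨τ, hτdef⟩ : ∃ τ, τ = min δ 1 := ⟨_, rfl⟩
  have hτ : 0 < τ := hτdef ▸ lt_min hδ one_pos
  have hτ1 : τ ≤ 1 := hτdef ▸ min_le_right _ _
  have hcb : ∀ p ∈ K, closedBall p.2 τ ⊆ Ioo 0 T := fun p hp =>
    (closedBall_subset_closedBall (hτdef ▸ min_le_left _ _)).trans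
      ((closedBall_subset_cthickening (mem_image_of_mem _ hp) δ).trans hδT)
  have hIcc : ∀ p ∈ K, Icc p.2 (p.2 + τ) ⊆ Ioo 0 T := fun p hp =>
    Subset.trans (by
      rw [Real.closedBall_eq_Icc]
      exact Icc_subset_Icc_left (by linarith)) (hcb p hp)
  obtain ⟨M, hM0, hM⟩ := exists_space_holder hα hF1 hF2 hωc hω hC hF6 hCh hfb huc hsub hsup hU
    hγψ.1 hγψ.2 hτ hτ1
  obtain ⟨c, hc0, hc⟩ := exists_time_holder (M := M) hα hA0 (isBoundedOnIdentity_of_H1_H2 hF1 hF2)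
    hCh hfb hU hCh0 hMf0 hU0 huc hsub hq₁2 hm hγψ.1 hγψ.2 hq hθ hτ
  obtain ⟨c', hc'0, hc'⟩ := exists_time_holder (M := M) hα hA0 (isBoundedOnIdentity_dualOp hF1 hF2)
    hCh (f := fun x t => -f x t) (u := fun x t => -u x t)
    (fun x t ht => (abs_neg (f x t)).trans_le (hfb x t ht))
    (fun x t ht => (abs_neg (u x t)).trans_le (hU x t ht)) hCh0 hMf0 hU0 huc.neg hsup hq₁2 hm
    hγψ.1 hγψ.2 hq hθ hτ
  obtain ⟨D, hD⟩ : ∃ D, D = c + c' + 2 * U / τ ^ γs := ⟨_, rfl⟩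
  have hUτ : 0 ≤ 2 * U / τ ^ γs := by positivity
  have hspace : ∀ p ∈ K, ∀ x y, |u x p.2 - u y p.2| ≤ M * ‖x - y‖ ^ γψ := by
    intro p hp x y
    have h1 := hM p.2 (hcb p hp) x y
    have h2 := hM p.2 (hcb p hp) y x
    rw [norm_sub_rev] at h2
    rw [abs_le]
    constructor <;> linarith
  have htime : ∀ p ∈ K, ∀ p' ∈ K, p.2 < p'.2 → ∀ x,
      |u x p'.2 - u x p.2| ≤ D * |p'.2 - p.2| ^ γs := by
    intro p hp p' hp' hlt x
    obtain ⟨s, hs⟩ : ∃ s, s = p'.2 - p.2 := ⟨_, rfl⟩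
    have hs0 : 0 < s := by linarith
    have hps : p'.2 = p.2 + s := by linarith
    rw [← hs, abs_of_pos hs0]
    have hsγ : 0 < s ^ γs := Real.rpow_pos_of_pos hs0 _
    rcases le_total s τ with hsτ | hsτ
    · have hs1 := hsτ.trans hτ1
      have h1 := hc p.2 (hIcc p hp) (hM p.2 (hcb p hp)) s hs0 hs1 hsτ x
      have h2 := hc' p.2 (hIcc p hp) (fun x y => by
        have := hM p.2 (hcb p hp) y x
        rw [norm_sub_rev] at this
        linarith) s hs0 hs1 hsτ x
      rw [← hps] at h1 h2
      have h3 : s ^ θ ≤ s ^ γs := Real.rpow_le_rpow_of_exponent_ge hs0 hs1 hγsθ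
      have h4 := mul_le_mul_of_nonneg_left h3 hc0
      have h5 := mul_le_mul_of_nonneg_left h3 hc'0
      have h6 := mul_nonneg hc0 hsγ.le
      have h7 := mul_nonneg hc'0 hsγ.le
      have h8 := mul_nonneg hUτ hsγ.le
      rw [hD, abs_le]
      constructor <;> linarith only [h1, h2, h4, h5, h6, h7, h8]
    · have h1 := abs_le.1 (hU x p.2 (hKsub hp).2)
      have h2 := abs_le.1 (hU x p'.2 (hKsub hp').2)
      have h3 : 2 * U ≤ 2 * U / τ ^ γs * s ^ γs := by
        have : τ ^ γs ≤ s ^ γs := Real.rpow_le_rpow hτ.le hsτ hγs0.le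
        calc 2 * U = 2 * U / τ ^ γs * τ ^ γs := by field_simp
          _ ≤ _ := by gcongr
      have h6 := mul_nonneg hc0 hsγ.le
      have h7 := mul_nonneg hc'0 hsγ.le
      rw [hD, abs_le]
      constructor <;> linarith only [h1.1, h1.2, h2.1, h2.2, h3, h6, h7]
  have hD0 : 0 ≤ D := by rw [hD]; positivity
  refine ⟨M + D, fun p hp p' hp' => ?_⟩
  have h1 := hspace p hp p.1 p'.1
  have h2 : |u p'.1 p.2 - u p'.1 p'.2| ≤ D * |p.2 - p'.2| ^ γs := by
    rcases lt_trichotomy p.2 p'.2 with hlt | heq | hlt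
    · have := htime p hp p' hp' hlt p'.1
      rwa [abs_sub_comm (u p'.1 p.2), abs_sub_comm p.2]
    · rw [heq, sub_self, abs_zero]
      positivity
    · exact htime p' hp' p hp hlt p'.1
  have h3 := abs_sub_le (u p.1 p.2) (u p'.1 p.2) (u p'.1 p'.2)
  have h4 : 0 ≤ M * |p.2 - p'.2| ^ γs := by positivity
  have h5 : 0 ≤ D * ‖p.1 - p'.1‖ ^ γψ := by positivity
  linarith only [h1, h2, h3, h4, h5]
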